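/- arXiv:1512.06145 — 2 statements merged into one kernel-verified Lean document; each statement's English description precedes it below -/
import Mathlib

section
/- Let (s_n) be a positive sequence with s_n → ∞ and let (f_n) be continuous, strictly increasing, differentiable functions from (0,∞) to (0,∞) satisfying Conditions (S), (D1) and (D3). For all sufficiently large n, let λ_n > 0 be the unique solution of ∫_0^∞ e^{−λ f_n(x)} dx = 1, and set φ_n = ( λ_n · ∫_0^∞ f_n(x) e^{−λ_n f_n(x)} dx )^{−1} (which equals λ_n′(1)/λ_n(1) for the map a ↦ λ_n(a) defined by a ∫_0^∞ e^{−λ_n(a) f_n(x)} dx = 1). Then φ_n/s_n → 1 and λ_n f_n(1) → e^{−γ} as n → ∞, where γ is the Euler–Mascheroni constant. -/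
open MeasureTheory Filter

lemma aux_bound (b C ε p u g : ℝ) (hb : 0 < b) (hC : 0 ≤ C) (hε : 0 < ε) (hp : 0 < p)
    (hp1 : p ≤ 1) (hu : 0 < u) (h1 : u ≤ 1 → |g| ≤ C * u ^ ε)
    (h2 : 1 < u → |g| ≤ C * Real.exp (-b * u ^ ε)) :
    ‖u ^ (p - 1) * g‖ ≤ C * Real.exp b * (u ^ (ε - 1) * Real.exp (-b * u ^ ε))
      + C * (u ^ (0:ℝ) * Real.exp (-b * u ^ ε)) := by
  rw [norm_mul, Real.norm_eq_abs, Real.norm_eq_abs, abs_of_pos (Real.rpow_pos_of_pos hu _)]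
  have e1 : 0 < u ^ (ε - 1) := Real.rpow_pos_of_pos hu _
  have e2 : 0 < u ^ (p - 1) := Real.rpow_pos_of_pos hu _
  rw [Real.rpow_zero, one_mul]
  rcases le_or_gt u 1 with h | h
  · have h3 : u ^ (p - 1) * u ^ ε ≤ u ^ (ε - 1) := by
      rw [← Real.rpow_add hu]
      exact Real.rpow_le_rpow_of_exponent_ge hu h (by linarith)
    have h4 : 1 ≤ Real.exp b * Real.exp (-b * u ^ ε) := by
      rw [← Real.exp_add, ← Real.exp_zero]
      apply Real.exp_le_exp.2
      have : u ^ ε ≤ 1 := Real.rpow_le_one hu.le h hε.le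
      nlinarith
    calc u ^ (p - 1) * |g| ≤ u ^ (p - 1) * (C * u ^ ε) := by gcongr; exact h1 h
      _ = C * (u ^ (p - 1) * u ^ ε) := by ring
      _ ≤ C * u ^ (ε - 1) := by gcongr
      _ = C * u ^ (ε - 1) * 1 := by ring
      _ ≤ C * u ^ (ε - 1) * (Real.exp b * Real.exp (-b * u ^ ε)) := by gcongr
      _ = C * Real.exp b * (u ^ (ε - 1) * Real.exp (-b * u ^ ε)) := by ring
      _ ≤ _ := by
        have : 0 ≤ C * Real.exp (-b * u ^ ε) := by positivity
        linarith
  · have h3 : u ^ (p - 1) ≤ 1 := Real.rpow_le_one_of_one_le_of_nonpos h.le (by linarith)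
    calc u ^ (p - 1) * |g| ≤ 1 * (C * Real.exp (-b * u ^ ε)) := by gcongr; exact h2 h
      _ ≤ _ := by
        have : 0 ≤ C * Real.exp b * (u ^ (ε - 1) * Real.exp (-b * u ^ ε)) := by positivity
        linarith

lemma keyA (s : ℕ → ℝ) (hs_pos : ∀ n, 0 < s n) (hs : Tendsto s atTop atTop)
    (G : ℕ → ℝ → ℝ) (hG : ∀ n, Measurable (G n)) (ρ ε b C : ℝ) (hρ : 0 < ρ) (hρ1 : ρ < 1)
    (hε : 0 < ε) (hb : 0 < b) (hC : 0 ≤ C)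
    (h1 : ∀ᶠ n in atTop, ∀ x, 0 < x → x ≤ ρ → |G n x| ≤ C * ρ ^ (ε * s n))
    (h2 : ∀ᶠ n in atTop, ∀ x, ρ < x → x ≤ 1 → |G n x| ≤ C * x ^ (ε * s n))
    (h3 : ∀ᶠ n in atTop, ∀ x, 1 < x → |G n x| ≤ C * Real.exp (-b * x ^ (ε * s n)))
    (L : ℝ → ℝ)
    (hL : ∀ u, 0 < u → Tendsto (fun n => G n (u ^ (1 / s n))) atTop (nhds (L u))) :
    (∀ᶠ n in atTop, IntegrableOn (G n) (Set.Ioi 0)) ∧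
    Tendsto (fun n => s n * ∫ x in Set.Ioi 0, G n x) atTop
      (nhds (∫ u in Set.Ioi 0, u ^ (-1:ℝ) * L u)) := by
  set G1 : ℕ → ℝ → ℝ := fun n => (Set.Ioi ρ).indicator (G n) with hG1
  have hG1m : ∀ n, Measurable (G1 n) := fun n => (hG n).indicator measurableSet_Ioi
  set bd : ℝ → ℝ := fun u => C * Real.exp b * (u ^ (ε - 1) * Real.exp (-b * u ^ ε))
      + C * (u ^ (0:ℝ) * Real.exp (-b * u ^ ε)) with hbd
  have hbdi : IntegrableOn bd (Set.Ioi 0) :=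
    ((integrableOn_rpow_mul_exp_neg_mul_rpow (by linarith) hε hb).const_mul _).add
      ((integrableOn_rpow_mul_exp_neg_mul_rpow (by norm_num) hε hb).const_mul _)
  have hmeas : ∀ n, AEStronglyMeasurable (fun u : ℝ => u ^ (1 / s n - 1) * G1 n (u ^ (1 / s n)))
      (volume.restrict (Set.Ioi 0)) := fun n => by
    have := hG1m n
    exact Measurable.aestronglyMeasurable (by fun_prop)
  have hdom : ∀ᶠ n in atTop, ∀ᵐ u ∂(volume.restrict (Set.Ioi (0:ℝ))),
      ‖u ^ (1 / s n - 1) * G1 n (u ^ (1 / s n))‖ ≤ bd u := by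
    filter_upwards [h2, h3, hs.eventually_ge_atTop 1] with n h2 h3 hsn
    refine (ae_restrict_iff' measurableSet_Ioi).2 (Eventually.of_forall fun u hu => ?_)
    have hu : 0 < u := hu
    have hx : 0 < u ^ (1 / s n) := Real.rpow_pos_of_pos hu _
    have he : (u ^ (1 / s n)) ^ (ε * s n) = u ^ ε := by
      rw [← Real.rpow_mul hu.le]
      congr 1
      have := (hs_pos n).ne'
      field_simp
    refine aux_bound b C ε (1 / s n) u _ hb hC hε (by have := hs_pos n; positivity)
      (by rw [div_le_one (hs_pos n)]; exact hsn) hu ?_ ?_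
    · intro hu1
      by_cases hr : u ^ (1 / s n) ∈ Set.Ioi ρ
      · simp only [hG1, Set.indicator_of_mem hr]
        rw [← he]
        exact h2 _ hr (Real.rpow_le_one hu.le hu1 (by have := hs_pos n; positivity))
      · simp only [hG1, Set.indicator_of_notMem hr]
        rw [abs_zero]; positivity
    · intro hu1
      have hx1 : 1 < u ^ (1 / s n) := Real.one_lt_rpow hu1 (by have := hs_pos n; positivity)
      have hr : u ^ (1 / s n) ∈ Set.Ioi ρ := hρ1.trans hx1
      simp only [hG1, Set.indicator_of_mem hr]
      rw [← he]
      exact h3 _ hx1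
  have hinv : Tendsto (fun n => 1 / s n) atTop (nhds 0) := by
    simpa only [one_div] using! hs.inv_tendsto_atTop
  have hlim : ∀ᵐ u ∂(volume.restrict (Set.Ioi (0:ℝ))),
      Tendsto (fun n => u ^ (1 / s n - 1) * G1 n (u ^ (1 / s n))) atTop
        (nhds (u ^ (-1:ℝ) * L u)) := by
    refine (ae_restrict_iff' measurableSet_Ioi).2 (Eventually.of_forall fun u hu => ?_)
    have hu : 0 < u := hu
    refine Tendsto.mul ?_ ?_
    · have := (Real.continuousAt_const_rpow (b := -1) hu.ne').tendsto.comp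
        (by simpa using hinv.sub_const 1 : Tendsto (fun n => 1 / s n - 1) atTop (nhds (-1)))
      exact this
    · have h4 : Tendsto (fun n => u ^ (1 / s n)) atTop (nhds 1) := by
        have := (Real.continuousAt_const_rpow (b := 0) hu.ne').tendsto.comp hinv
        simpa only [Real.rpow_zero] using! this
      refine (hL u hu).congr' ?_
      filter_upwards [h4.eventually (lt_mem_nhds hρ1)] with n hn
      exact (Set.indicator_of_mem (s := Set.Ioi ρ) hn (G n)).symm
  have hDCT := tendsto_integral_filter_of_dominated_convergence bd
    (Eventually.of_forall hmeas) hdom hbdi hlim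
  have hInt1 : ∀ᶠ n in atTop, IntegrableOn (G1 n) (Set.Ioi 0) := by
    filter_upwards [hdom] with n hn
    have : IntegrableOn (fun u : ℝ => u ^ (1 / s n - 1) • G1 n (u ^ (1 / s n))) (Set.Ioi 0) :=
      Integrable.mono' hbdi (hmeas n) hn
    exact (integrableOn_Ioi_comp_rpow_iff' (G1 n) (one_div_pos.2 (hs_pos n)).ne').1 this
  have hInt2 : ∀ᶠ n in atTop, IntegrableOn (G n) (Set.Ioc 0 ρ) := by
    filter_upwards [h1] with n hn
    refine Measure.integrableOn_of_bounded (M := C * ρ ^ (ε * s n)) (by simp)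
      (hG n).aestronglyMeasurable ?_
    exact (ae_restrict_iff' measurableSet_Ioc).2 (Eventually.of_forall fun u hu => hn u hu.1 hu.2)
  have hun : Set.Ioc 0 ρ ∪ Set.Ioi ρ = Set.Ioi 0 := Set.Ioc_union_Ioi_eq_Ioi hρ.le
  have hInt3 : ∀ᶠ n in atTop, IntegrableOn (G n) (Set.Ioi ρ) := by
    filter_upwards [hInt1] with n hn
    have : IntegrableOn (G1 n) (Set.Ioi ρ) := hn.mono_set (Set.Ioi_subset_Ioi hρ.le)
    exact this.congr_fun (fun x hx => Set.indicator_of_mem hx _) measurableSet_Ioi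
  refine ⟨?_, ?_⟩
  · filter_upwards [hInt2, hInt3] with n ha hb
    rw [← hun]; exact ha.union hb
  have hsmall : Tendsto (fun n => s n * ∫ x in Set.Ioc 0 ρ, G n x) atTop (nhds 0) := by
    have hk : 0 < ε * (-Real.log ρ) := mul_pos hε (by linarith [Real.log_neg hρ hρ1])
    have ht := (tendsto_rpow_mul_exp_neg_mul_atTop_nhds_zero 1 _ hk).comp hs
    have ht2 := ht.const_mul (C * ρ)
    rw [mul_zero] at ht2
    refine squeeze_zero_norm' ?_ ht2
    filter_upwards [h1] with n hn
    have := norm_setIntegral_le_of_norm_le_const (μ := volume) (s := Set.Ioc 0 ρ) (f := G n)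
      (by simp) (fun x hx => hn x hx.1 hx.2)
    rw [Real.volume_real_Ioc_of_le hρ.le, sub_zero] at this
    rw [norm_mul, Real.norm_of_nonneg (hs_pos n).le]
    calc s n * ‖∫ x in Set.Ioc 0 ρ, G n x‖ ≤ s n * (C * ρ ^ (ε * s n) * ρ) :=
          mul_le_mul_of_nonneg_left this (hs_pos n).le
      _ = _ := by
        simp only [Function.comp, Real.rpow_one]
        rw [Real.rpow_def_of_pos hρ]
        ring_nf
  have hsum := hsmall.add hDCT
  rw [zero_add] at hsum
  refine hsum.congr' ?_
  filter_upwards [hInt2, hInt3] with n ha hb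
  have e0 : ∫ x in Set.Ioi 0, G n x = (∫ x in Set.Ioc 0 ρ, G n x) + ∫ x in Set.Ioi ρ, G n x := by
    rw [← hun, setIntegral_union (Set.Ioc_disjoint_Ioi le_rfl) measurableSet_Ioi ha hb]
  rw [e0, mul_add]
  congr 1
  have e1 : ∫ x in Set.Ioi 0, G1 n x = ∫ x in Set.Ioi ρ, G n x := by
    rw [setIntegral_indicator measurableSet_Ioi,
      Set.inter_eq_right.2 (Set.Ioi_subset_Ioi hρ.le)]
  rw [← e1, ← integral_comp_rpow_Ioi_of_pos (g := G1 n) (one_div_pos.2 (hs_pos n)),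
    ← integral_const_mul]
  refine integral_congr_ae (Eventually.of_forall fun u => ?_)
  have := (hs_pos n).ne'
  simp only [smul_eq_mul]
  field_simp

structure Reg (s : ℕ → ℝ) (q : ℕ → ℝ → ℝ) (ρ ε : ℝ) : Prop where
  spos : ∀ n, 0 < s n
  slim : Tendsto s atTop atTop
  meas : ∀ n, Measurable (q n)
  nonneg : ∀ n x, 0 < x → 0 ≤ q n x
  rpos : 0 < ρ
  rlt : ρ < 1
  epos : 0 < ε
  b1 : ∀ᶠ n in atTop, ∀ x, 0 < x → x ≤ ρ → q n x ≤ ρ ^ (ε * s n)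
  b2 : ∀ᶠ n in atTop, ∀ x, ρ < x → x ≤ 1 → q n x ≤ x ^ (ε * s n)
  b3 : ∀ᶠ n in atTop, ∀ x, 1 < x → x ^ (ε * s n) ≤ q n x
  lim : ∀ u, 0 < u → Tendsto (fun n => q n (u ^ (1 / s n))) atTop (nhds u)

lemma aux_abs (y c : ℝ) (hc : 0 < c) (hy : 0 ≤ y) :
    |1 - Real.exp (-(c * y))| ≤ max c 1 * y := by
  have h1 : Real.exp (-(c * y)) ≤ 1 := Real.exp_le_one_iff.2 (by nlinarith)
  have h2 := Real.add_one_le_exp (-(c * y))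
  rw [abs_of_nonneg (by linarith)]
  have : c * y ≤ max c 1 * y := by gcongr; exact le_max_left _ _
  linarith

lemma keyB {s : ℕ → ℝ} {q : ℕ → ℝ → ℝ} {ρ ε : ℝ} (H : Reg s q ρ ε) (c : ℝ) (hc : 0 < c) :
    Tendsto (fun n => s n * (1 - ∫ x in Set.Ioi 0, Real.exp (-(c * q n x)))) atTop
      (nhds (∫ u in Set.Ioi (0:ℝ), u ^ (-1:ℝ) *
        ((Set.Iic (1:ℝ)).indicator (fun _ => (1:ℝ)) u - Real.exp (-(c * u))))) := by
  have hm := H.meas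
  have hspos := H.spos
  have hCC : (0:ℝ) ≤ max c 1 := le_trans zero_le_one (le_max_right _ _)
  obtain ⟨hI, hT⟩ := keyA s H.spos H.slim
    (fun n x => (Set.Iic (1:ℝ)).indicator (fun _ => (1:ℝ)) x - Real.exp (-(c * q n x)))
    (fun n => by
      have := hm n
      have h2 : Measurable ((Set.Iic (1:ℝ)).indicator (fun _ => (1:ℝ))) :=
        measurable_const.indicator measurableSet_Iic
      fun_prop) ρ ε c (max c 1) H.rpos H.rlt H.epos hc
    hCC
    (by
      filter_upwards [H.b1] with n hn x hx hx1
      rw [Set.indicator_of_mem (show x ∈ Set.Iic 1 from hx1.trans H.rlt.le)]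
      exact (aux_abs _ c hc (H.nonneg n x hx)).trans
        (mul_le_mul_of_nonneg_left (hn x hx hx1) hCC))
    (by
      filter_upwards [H.b2] with n hn x hx hx1
      rw [Set.indicator_of_mem (show x ∈ Set.Iic 1 from hx1)]
      exact (aux_abs _ c hc (H.nonneg n x (H.rpos.trans hx))).trans
        (mul_le_mul_of_nonneg_left (hn x hx hx1) hCC))
    (by
      filter_upwards [H.b3] with n hn x hx
      rw [Set.indicator_of_notMem (show x ∉ Set.Iic 1 from not_le.2 hx), zero_sub, abs_neg,
        Real.abs_exp]
      have h5 : Real.exp (-(c * q n x)) ≤ Real.exp (-c * x ^ (ε * s n)) := by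
        apply Real.exp_le_exp.2
        have := mul_le_mul_of_nonneg_left (hn x hx) hc.le
        linarith
      have h6 := mul_le_mul_of_nonneg_right (le_max_right c 1)
        (Real.exp_pos (-c * x ^ (ε * s n))).le
      linarith)
    (fun u => (Set.Iic (1:ℝ)).indicator (fun _ => (1:ℝ)) u - Real.exp (-(c * u)))
    (by
      intro u hu
      refine Tendsto.sub ?_ ?_
      · refine tendsto_const_nhds.congr fun n => ?_
        have hp : 0 < 1 / s n := one_div_pos.2 (hspos n)
        by_cases h : u ≤ 1
        · rw [Set.indicator_of_mem (show u ∈ Set.Iic 1 from h), Set.indicator_of_mem]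
          exact Real.rpow_le_one hu.le h hp.le
        · rw [Set.indicator_of_notMem (show u ∉ Set.Iic 1 from h), Set.indicator_of_notMem]
          exact not_le.2 (Real.one_lt_rpow (not_le.1 h) hp)
      · exact (Real.continuous_exp.tendsto _).comp ((H.lim u hu).const_mul c).neg)
  refine hT.congr' ?_
  filter_upwards [hI] with n hn
  congr 1
  have hi : IntegrableOn ((Set.Iic (1:ℝ)).indicator (fun _ => (1:ℝ))) (Set.Ioi 0) := by
    rw [IntegrableOn, integrable_indicator_iff measurableSet_Iic, IntegrableOn,
      Measure.restrict_restrict measurableSet_Iic]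
    have : Set.Iic (1:ℝ) ∩ Set.Ioi 0 = Set.Ioc 0 1 := by
      rw [Set.inter_comm]; exact Set.Ioi_inter_Iic
    rw [this]
    exact integrableOn_const (by simp)
  have he : IntegrableOn (fun x => Real.exp (-(c * q n x))) (Set.Ioi 0) := by
    refine (hi.sub hn).congr (Eventually.of_forall fun x => ?_)
    simp
  rw [integral_sub hi he]
  congr 1
  rw [setIntegral_indicator measurableSet_Iic, Set.Ioi_inter_Iic]
  simp

lemma constC (c : ℝ) (hc : 0 < c) :
    ∫ u in Set.Ioi (0:ℝ), u ^ (-1:ℝ) *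
        ((Set.Iic (1:ℝ)).indicator (fun _ => (1:ℝ)) u - Real.exp (-(c * u)))
      = Real.log c + Real.eulerMascheroniConstant := by
  have hst : Tendsto (fun n : ℕ => (n:ℝ) + 1) atTop atTop :=
    tendsto_atTop_add_const_right _ _ tendsto_natCast_atTop_atTop
  have hsp : ∀ n : ℕ, (0:ℝ) < (n:ℝ) + 1 := fun n => by positivity
  have H : Reg (fun n => (n:ℝ) + 1) (fun n x => x ^ ((n:ℝ) + 1)) (1/2) 1 :=
    { spos := hsp
      slim := hst
      meas := fun n => by fun_prop
      nonneg := fun n x hx => Real.rpow_nonneg hx.le _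
      rpos := by norm_num
      rlt := by norm_num
      epos := by norm_num
      b1 := Eventually.of_forall fun n x hx hx1 => by
        rw [one_mul]
        exact Real.rpow_le_rpow hx.le hx1 (hsp n).le
      b2 := Eventually.of_forall fun n x hx hx1 => by rw [one_mul]
      b3 := Eventually.of_forall fun n x hx => by rw [one_mul]
      lim := fun u hu => by
        refine tendsto_const_nhds.congr fun n => ?_
        have := (hsp n).ne'
        rw [← Real.rpow_mul hu.le, one_div, inv_mul_cancel₀ this, Real.rpow_one] }
  refine tendsto_nhds_unique (keyB H c hc) ?_
  have hd : HasDerivAt (fun t : ℝ => c ^ (-t) * Real.Gamma (t + 1))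
      (-Real.log c - Real.eulerMascheroniConstant) 0 := by
    have h1 : HasDerivAt (fun t : ℝ => c ^ (-t)) (-Real.log c) 0 := by
      have := (hasDerivAt_neg (0:ℝ)).const_rpow hc
      simpa using this
    have h2 : HasDerivAt (fun t : ℝ => Real.Gamma (t + 1)) (-Real.eulerMascheroniConstant) 0 := by
      have h3 : HasDerivAt Real.Gamma (-Real.eulerMascheroniConstant) (0 + 1) := by
        rw [zero_add]; exact Real.hasDerivAt_Gamma_one
      exact h3.comp_add_const 0 1
    have := h1.mul h2
    simp only [zero_add, Real.Gamma_one, neg_zero, Real.rpow_zero] at this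
    convert! this using 1
    ring
  rw [hasDerivAt_iff_tendsto_slope_zero] at hd
  have hz : Tendsto (fun n : ℕ => 1 / ((n:ℝ) + 1)) atTop (nhdsWithin 0 {0}ᶜ) := by
    refine tendsto_nhdsWithin_iff.2 ⟨tendsto_one_div_add_atTop_nhds_zero_nat, ?_⟩
    exact Eventually.of_forall fun n => (one_div_pos.2 (hsp n)).ne'
  have h4 := (hd.comp hz).neg
  rw [show -(-Real.log c - Real.eulerMascheroniConstant)
    = Real.log c + Real.eulerMascheroniConstant by ring] at h4
  refine h4.congr fun n => ?_
  have h5 := integral_exp_neg_mul_rpow (hsp n) hc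
  have h6 : ∫ x in Set.Ioi (0:ℝ), Real.exp (-(c * x ^ ((n:ℝ) + 1)))
      = c ^ (-1 / ((n:ℝ) + 1)) * Real.Gamma (1 / ((n:ℝ) + 1) + 1) := by
    rw [← h5]; simp only [neg_mul]
  rw [h6]
  simp only [Function.comp, zero_add, neg_zero, Real.rpow_zero, Real.Gamma_one, smul_eq_mul,
    one_div, inv_inv, neg_div]
  ring

lemma keyD {s : ℕ → ℝ} {q : ℕ → ℝ → ℝ} {ρ ε : ℝ} (H : Reg s q ρ ε) (c : ℕ → ℝ) (d : ℝ)
    (hd : 0 < d) (hc : Tendsto c atTop (nhds d)) :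
    Tendsto (fun n => s n * ∫ x in Set.Ioi 0, c n * q n x * Real.exp (-(c n * q n x))) atTop
      (nhds 1) := by
  have hm := H.meas
  have hlo : ∀ᶠ n in atTop, d / 2 < c n := hc.eventually (lt_mem_nhds (by linarith))
  have hhi : ∀ᶠ n in atTop, c n < 2 * d := hc.eventually (gt_mem_nhds (by linarith))
  have hCC : (0:ℝ) ≤ 2 * d + 2 := by linarith
  have bnd : ∀ y a : ℝ, 0 ≤ y → d / 2 < a → a < 2 * d →
      |a * y * Real.exp (-(a * y))| ≤ (2 * d + 2) * y := by
    intro y a hy h1 h2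
    have ha : 0 < a := by linarith
    rw [abs_of_nonneg (by positivity)]
    have h3 : Real.exp (-(a * y)) ≤ 1 := Real.exp_le_one_iff.2 (by nlinarith)
    calc a * y * Real.exp (-(a * y)) ≤ a * y * 1 := by gcongr
      _ ≤ _ := by nlinarith
  have bnd2 : ∀ y a z : ℝ, 0 ≤ z → z ≤ y → d / 2 < a → a < 2 * d →
      |a * y * Real.exp (-(a * y))| ≤ (2 * d + 2) * Real.exp (-(d / 4) * z) := by
    intro y a z hz hzy h1 h2
    have ha : 0 < a := by linarith
    have hy : 0 ≤ y := hz.trans hzy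
    rw [abs_of_nonneg (by positivity)]
    have h3 : a * y ≤ 2 * Real.exp (a * y / 2) := by
      linarith [Real.add_one_le_exp (a * y / 2)]
    have h4 : Real.exp (-(a * y / 2)) ≤ Real.exp (-(d / 4) * z) := by
      apply Real.exp_le_exp.2
      have : d / 2 * z ≤ a * y := by gcongr
      linarith
    calc a * y * Real.exp (-(a * y)) ≤ 2 * Real.exp (a * y / 2) * Real.exp (-(a * y)) := by gcongr
      _ = 2 * Real.exp (-(a * y / 2)) := by
        rw [mul_assoc, ← Real.exp_add]; ring_nf
      _ ≤ 2 * Real.exp (-(d / 4) * z) := by gcongr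
      _ ≤ _ := by gcongr; linarith
  obtain ⟨-, hT⟩ := keyA s H.spos H.slim
    (fun n x => c n * q n x * Real.exp (-(c n * q n x)))
    (fun n => by have := hm n; fun_prop) ρ ε (d / 4) (2 * d + 2) H.rpos H.rlt H.epos
    (by linarith) hCC
    (by
      filter_upwards [H.b1, hlo, hhi] with n hn h1 h2 x hx hx1
      exact (bnd _ _ (H.nonneg n x hx) h1 h2).trans
        (mul_le_mul_of_nonneg_left (hn x hx hx1) hCC))
    (by
      filter_upwards [H.b2, hlo, hhi] with n hn h1 h2 x hx hx1
      exact (bnd _ _ (H.nonneg n x (H.rpos.trans hx)) h1 h2).trans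
        (mul_le_mul_of_nonneg_left (hn x hx hx1) hCC))
    (by
      filter_upwards [H.b3, hlo, hhi] with n hn h1 h2 x hx
      exact bnd2 _ _ _ (Real.rpow_nonneg (by linarith) _) (hn x hx) h1 h2)
    (fun u => d * u * Real.exp (-(d * u)))
    (by
      intro u hu
      have h1 := hc.mul (H.lim u hu)
      exact h1.mul ((Real.continuous_exp.tendsto _).comp h1.neg))
  have he : ∫ u in Set.Ioi (0:ℝ), u ^ (-1:ℝ) * (d * u * Real.exp (-(d * u))) = 1 := by
    have h1 : ∫ u in Set.Ioi (0:ℝ), u ^ (-1:ℝ) * (d * u * Real.exp (-(d * u)))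
        = ∫ u in Set.Ioi (0:ℝ), d * Real.exp (-d * u) := by
      refine setIntegral_congr_fun measurableSet_Ioi fun u hu => ?_
      have hu : (0:ℝ) < u := hu
      simp only [Real.rpow_neg_one, neg_mul]
      field_simp
    rw [h1, integral_const_mul, integral_exp_mul_Ioi (by linarith) 0]
    simp
    field_simp
  rwa [he] at hT

lemma growth (f f' : ℝ → ℝ) (hpos : ∀ x, 0 < x → 0 < f x)
    (hd : ∀ x, 0 < x → HasDerivAt f (f' x) x) (ρ k : ℝ) (hρ : 0 < ρ)
    (hk : ∀ x, ρ ≤ x → k ≤ x * f' x / f x) (x y : ℝ) (hx : ρ ≤ x) (hxy : x ≤ y) :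
    Real.log (f x) - k * Real.log x ≤ Real.log (f y) - k * Real.log y := by
  have hD : ∀ z, 0 < z → HasDerivAt (fun z => Real.log (f z) - k * Real.log z)
      (f' z / f z - k * z⁻¹) z := fun z hz =>
    ((hd z hz).log (hpos z hz).ne').sub ((Real.hasDerivAt_log hz.ne').const_mul k)
  refine monotoneOn_of_deriv_nonneg (convex_Ici ρ) (f := fun z => Real.log (f z) - k * Real.log z)
    ?_ ?_ ?_ (show x ∈ Set.Ici ρ from hx) (show y ∈ Set.Ici ρ from hx.trans hxy) hxy
  · exact fun z hz => (hD z (hρ.trans_le hz)).continuousAt.continuousWithinAt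
  · intro z hz
    rw [interior_Ici] at hz
    exact (hD z (hρ.trans hz)).differentiableAt.differentiableWithinAt
  · intro z hz
    rw [interior_Ici] at hz
    have hz0 : 0 < z := hρ.trans hz
    rw [(hD z hz0).deriv]
    have h1 := hk z (le_of_lt hz)
    have h2 : f' z / f z = (z * f' z / f z) * z⁻¹ := by
      have := (hpos z hz0).ne'
      field_simp
    rw [h2, ← sub_mul]
    have : 0 < z⁻¹ := inv_pos.2 hz0
    exact mul_nonneg (by linarith) this.le

theorem statement14 (s : ℕ → ℝ) (hs_pos : ∀ n, 0 < s n) (hs : Tendsto s atTop atTop)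
    (f f' : ℕ → ℝ → ℝ)
    (hf_cont : ∀ n, ContinuousOn (f n) (Set.Ioi 0))
    (hf_mono : ∀ n, StrictMonoOn (f n) (Set.Ioi 0))
    (hf_pos : ∀ n x, 0 < x → 0 < f n x)
    (hf_deriv : ∀ n x, 0 < x → HasDerivAt (f n) (f' n x) x)
    -- Condition (S)
    (hS : ∀ x : ℝ, 0 ≤ x → Tendsto (fun n => f n (x ^ (1 / s n)) / f n 1) atTop (nhds x))
    -- Condition (D1)
    (hD1 : ∃ ε₀ : ℝ, 0 < ε₀ ∧ ∃ δ₀ ∈ Set.Ioc (0:ℝ) 1, ∃ n₀ : ℕ,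
      ∀ n ≥ n₀, ∀ x : ℝ, 1 - δ₀ ≤ x → x ≤ 1 →
        ε₀ * s n ≤ x * f' n x / f n x ∧ x * f' n x / f n x ≤ s n / ε₀)
    -- Condition (D3)
    (hD3 : ∃ ε₀ : ℝ, 0 < ε₀ ∧ ∃ n₀ : ℕ, ∀ n ≥ n₀, ∀ x : ℝ, 1 ≤ x →
      ε₀ * s n ≤ x * f' n x / f n x)
    -- the Malthusian parameter, defined for sufficiently large n
    (lam : ℕ → ℝ) (n₁ : ℕ)
    (hlam : ∀ n ≥ n₁, 0 < lam n ∧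
      ∫ x in Set.Ioi (0:ℝ), Real.exp (-(lam n * f n x)) = 1) :
    Tendsto (fun n =>
        (lam n * ∫ x in Set.Ioi (0:ℝ), f n x * Real.exp (-(lam n * f n x)))⁻¹ / s n)
      atTop (nhds 1) ∧
    Tendsto (fun n => lam n * f n 1) atTop
      (nhds (Real.exp (-Real.eulerMascheroniConstant))) := by
  classical
  obtain ⟨ε1, hε1, δ, ⟨hδ, hδ1⟩, na, hA⟩ := hD1
  obtain ⟨ε2, hε2, nb, hB⟩ := hD3
  set ρ : ℝ := 1 - δ / 2 with hρd
  set ε : ℝ := min ε1 ε2 with hεd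
  have hε : 0 < ε := lt_min hε1 hε2
  have hρ : 0 < ρ := by linarith
  have hρ1 : ρ < 1 := by linarith
  set q : ℕ → ℝ → ℝ := fun n => (Set.Ioi (0:ℝ)).piecewise (fun x => f n x / f n 1) (fun _ => 0)
    with hq
  have hqe : ∀ n x, 0 < x → q n x = f n x / f n 1 := fun n x hx =>
    Set.piecewise_eq_of_mem _ _ _ hx
  have h1pos : ∀ n, 0 < f n 1 := fun n => hf_pos n 1 one_pos
  have hgr : ∀ᶠ n in atTop, ∀ x y, ρ ≤ x → x ≤ y →
      Real.log (f n x) - ε * s n * Real.log x ≤ Real.log (f n y) - ε * s n * Real.log y := by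
    filter_upwards [eventually_ge_atTop na, eventually_ge_atTop nb] with n ha hb x y hx hxy
    refine growth (f n) (f' n) (hf_pos n) (hf_deriv n) ρ (ε * s n) hρ ?_ x y hx hxy
    intro z hz
    rcases le_total z 1 with h | h
    · exact (mul_le_mul_of_nonneg_right (min_le_left _ _) (hs_pos n).le).trans
        (hA n ha z (by linarith) h).1
    · exact (mul_le_mul_of_nonneg_right (min_le_right _ _) (hs_pos n).le).trans (hB n hb z h)
  have hlogq : ∀ n x, 0 < x → Real.log (f n x / f n 1) = Real.log (f n x) - Real.log (f n 1) :=
    fun n x hx => Real.log_div (hf_pos n x hx).ne' (h1pos n).ne'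
  have hb2 : ∀ᶠ n in atTop, ∀ x, ρ ≤ x → x ≤ 1 → q n x ≤ x ^ (ε * s n) := by
    filter_upwards [hgr] with n hn x hx hx1
    have hx0 : 0 < x := hρ.trans_le hx
    rw [hqe n x hx0]
    have h := hn x 1 hx hx1
    rw [Real.log_one] at h
    rw [← Real.log_le_log_iff (div_pos (hf_pos n x hx0) (h1pos n)) (Real.rpow_pos_of_pos hx0 _),
      hlogq n x hx0, Real.log_rpow hx0]
    linarith
  have H : Reg s q ρ ε :=
    { spos := hs_pos
      slim := hs
      meas := fun n => ContinuousOn.measurable_piecewise ((hf_cont n).div_const _)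
        continuousOn_const measurableSet_Ioi
      nonneg := fun n x hx => by
        rw [hqe n x hx]; exact (div_pos (hf_pos n x hx) (h1pos n)).le
      rpos := hρ
      rlt := hρ1
      epos := hε
      b1 := by
        filter_upwards [hb2] with n hn x hx hx1
        refine le_trans ?_ (hn ρ le_rfl hρ1.le)
        rw [hqe n x hx, hqe n ρ hρ]
        exact div_le_div_of_nonneg_right ((hf_mono n).monotoneOn hx hρ hx1) (h1pos n).le
      b2 := by
        filter_upwards [hb2] with n hn x hx hx1 using hn x hx.le hx1
      b3 := by
        filter_upwards [hgr] with n hn x hx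
        have hx0 : 0 < x := one_pos.trans hx
        rw [hqe n x hx0]
        have h := hn 1 x hρ1.le hx.le
        rw [Real.log_one] at h
        rw [← Real.log_le_log_iff (Real.rpow_pos_of_pos hx0 _)
          (div_pos (hf_pos n x hx0) (h1pos n)), hlogq n x hx0, Real.log_rpow hx0]
        linarith
      lim := fun u hu => by
        refine (hS u hu.le).congr fun n => ?_
        rw [hqe n _ (Real.rpow_pos_of_pos hu _)] }
  set c : ℕ → ℝ := fun n => lam n * f n 1 with hcd
  have hcq : ∀ n x, 0 < x → c n * q n x = lam n * f n x := fun n x hx => by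
    rw [hqe n x hx, hcd]
    have := (h1pos n).ne'
    field_simp
  have hK1 : ∀ n ≥ n₁, ∫ x in Set.Ioi (0:ℝ), Real.exp (-(c n * q n x)) = 1 := fun n hn => by
    rw [← (hlam n hn).2]
    refine setIntegral_congr_fun measurableSet_Ioi fun x hx => ?_
    simp only [hcq n x hx]
  have hKlim : ∀ a, 0 < a → Tendsto
      (fun n => s n * (1 - ∫ x in Set.Ioi 0, Real.exp (-(a * q n x)))) atTop
      (nhds (Real.log a + Real.eulerMascheroniConstant)) := fun a ha => by
    have := keyB H a ha
    rwa [constC a ha] at this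
  -- antitonicity of the integral in the parameter
  have hmono : ∀ n a b, a ≤ b →
      (∫ x in Set.Ioi (0:ℝ), Real.exp (-(a * q n x))) ≠ 0 →
      (∫ x in Set.Ioi (0:ℝ), Real.exp (-(b * q n x)))
        ≤ ∫ x in Set.Ioi (0:ℝ), Real.exp (-(a * q n x)) := by
    intro n a b hab h0
    have hi := Integrable.of_integral_ne_zero h0
    refine integral_mono_of_nonneg (Eventually.of_forall fun x => (Real.exp_pos _).le) hi ?_
    refine (ae_restrict_iff' measurableSet_Ioi).2 (Eventually.of_forall fun x hx => ?_)
    apply Real.exp_le_exp.2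
    have := mul_le_mul_of_nonneg_right hab (H.nonneg n x hx)
    linarith
  have hc : Tendsto c atTop (nhds (Real.exp (-Real.eulerMascheroniConstant))) := by
    rw [tendsto_order]
    refine ⟨fun a ha => ?_, fun a ha => ?_⟩
    · rcases le_or_gt a 0 with h0 | h0
      · filter_upwards [eventually_ge_atTop n₁] with n hn
        exact h0.trans_lt (mul_pos (hlam n hn).1 (h1pos n))
      have hlog : Real.log a + Real.eulerMascheroniConstant < 0 := by
        have := (Real.log_lt_iff_lt_exp h0).2 ha
        linarith
      filter_upwards [eventually_ge_atTop n₁, (hKlim a h0).eventually (gt_mem_nhds hlog)]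
        with n hn hneg
      by_contra hcon
      have h2 := hmono n (c n) a (not_lt.1 hcon) (by rw [hK1 n hn]; norm_num)
      rw [hK1 n hn] at h2
      have := mul_nonneg (hs_pos n).le (sub_nonneg.2 h2)
      linarith
    · have h0 : 0 < a := (Real.exp_pos _).trans ha
      have hlog : 0 < Real.log a + Real.eulerMascheroniConstant := by
        have := (Real.lt_log_iff_exp_lt h0).2 ha
        linarith
      have hne : ∀ᶠ n in atTop, (∫ x in Set.Ioi (0:ℝ), Real.exp (-(a * q n x))) ≠ 0 := by
        filter_upwards [(hKlim a h0).eventually (gt_mem_nhds (lt_add_one _)),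
          hs.eventually_ge_atTop (Real.log a + Real.eulerMascheroniConstant + 1)] with n h3 h4 h5
        rw [h5] at h3
        linarith
      filter_upwards [eventually_ge_atTop n₁, (hKlim a h0).eventually (lt_mem_nhds hlog), hne]
        with n hn hp hne
      by_contra hcon
      have h2 := hmono n a (c n) (not_lt.1 hcon) hne
      rw [hK1 n hn] at h2
      have := mul_nonneg (hs_pos n).le (sub_nonneg.2 h2)
      linarith
  refine ⟨?_, hc⟩
  have hfin := (keyD H c _ (Real.exp_pos _) hc).inv₀ one_ne_zero
  rw [inv_one] at hfin
  refine hfin.congr fun n => ?_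
  have h1 : ∫ x in Set.Ioi (0:ℝ), c n * q n x * Real.exp (-(c n * q n x))
      = lam n * ∫ x in Set.Ioi (0:ℝ), f n x * Real.exp (-(lam n * f n x)) := by
    rw [← integral_const_mul]
    refine setIntegral_congr_fun measurableSet_Ioi fun x hx => ?_
    simp only [hcq n x hx]
    ring
  rw [h1, mul_inv, div_eq_mul_inv, mul_comm]
end

section
/- Let (s_n) be a positive sequence with s_n → ∞ and let (f_n) be continuous, strictly increasing, differentiable functions from (0,∞) to (0,∞) satisfying Conditions (S), (D1) and (D3). For a > 0 write ã = a^{1/s_n}; for all sufficiently large n let λ_n(ã) > 0 be the unique solution of ã ∫_0^∞ e^{−λ f_n(x)} dx = 1, let ν_ã be the probability measure with ν_ã(B) = ∫_0^∞ 1_B(f_n(x)) ã e^{−λ_n(ã) f_n(x)} dx, let (D_i)_{i≥1} be i.i.d. with law ν_ã, S_0 = 0, S_j = D_1 + ⋯ + D_j, and for χ : ℝ → [0,∞) vanishing on (−∞,0) set m̄_t^χ(ã) = E( Σ_{j=0}^∞ e^{−λ_n(ã)(t − S_j)} χ(t − S_j) ). Then: (i) given ε > 0 and a compact subset A ⊂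 (0,2), there exist K < ∞ and n₀ such that for all n ≥ n₀, all a ∈ A, every bounded, non-negative, non-decreasing χ, and every t with λ_n(1) t ≥ K: | s_n^{−1} m̄_t^χ(ã) − ∫_0^∞ e^{−z} χ( z/λ_n(ã) ) dz | ≤ ε · sup χ; (ii) moreover there exist a constant K′ < ∞ independent of ε and n₁ ∈ ℕ such that m̄_t^χ(ã) ≤ K′ (sup χ) s_n for all n ≥ n₁, all t ≥ 0 and all a ∈ A. -/
open MeasureTheory Filter

/-- The probability measure `ν_ã` on `(0,∞)` with `ν_ã(B) = ∫_0^∞ 1_B(f(x)) ã e^{-λ f(x)} dx`. -/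
noncomputable def nuMeasure (f : ℝ → ℝ) (atil lam : ℝ) : Measure ℝ :=
  Measure.map f ((volume.restrict (Set.Ioi 0)).withDensity
    fun x => ENNReal.ofReal (atil * Real.exp (-(lam * f x))))

/-- The law of the random walk `S_j = D_1 + ⋯ + D_j` with i.i.d. steps of law `ν`. -/
noncomputable def sumLaw (ν : Measure ℝ) : ℕ → Measure ℝ
  | 0 => Measure.dirac 0
  | j + 1 => Measure.map (fun p : ℝ × ℝ => p.1 + p.2) ((sumLaw ν j).prod ν)

/-- The rescaled expected one-vertex characteristic
`m̄_t^χ(ã) = E(Σ_j e^{-λ(t - S_j)} χ(t - S_j))`, expressed through the laws of the `S_j`. -/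
noncomputable def mbarChar (ν : Measure ℝ) (lam : ℝ) (χ : ℝ → ℝ) (t : ℝ) : ENNReal :=
  ∑' j : ℕ, ∫⁻ y, ENNReal.ofReal (Real.exp (-(lam * (t - y))) * χ (t - y)) ∂(sumLaw ν j)

theorem ren_identity (ρ : Measure ℝ) [IsProbabilityMeasure ρ] (hpos : ∀ᵐ y ∂ρ, 0 < y)
    (V : ℝ → ℝ) (K : ℝ) (hVm : Measurable V) (hV0 : ∀ u, 0 ≤ V u) (hVK : ∀ u, V u ≤ K)
    (hVneg : ∀ u, u < 0 → V u = 0) (τ : ℝ) (hτ : 0 ≤ τ) :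
    ∫ y in Set.Ioc 0 τ, V (τ - y) * ρ.real (Set.Ioi y) =
      ∫ u in Set.Ioc 0 τ, (V u - ∫ y, V (u - y) ∂ρ) := by
  have hVn : ∀ u, ‖V u‖ ≤ K := fun u => by
    rw [Real.norm_of_nonneg (hV0 u)]; exact hVK u
  have hfin : IsFiniteMeasure (volume.restrict (Set.Ioc 0 τ)) := inferInstance
  have hint1 : Integrable (fun p : ℝ × ℝ => V (p.1 - p.2)) ((volume.restrict (Set.Ioc 0 τ)).prod ρ) :=
    Integrable.of_bound (by
      have : Measurable fun p : ℝ × ℝ => V (p.1 - p.2) := by fun_prop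
      exact this.aestronglyMeasurable) K (Eventually.of_forall fun p => hVn _)
  have hmF : Measurable (fun p : ℝ × ℝ => if p.2 ≤ τ - p.1 then V p.1 else 0) :=
    Measurable.ite (measurableSet_le (by fun_prop) (by fun_prop)) (by fun_prop) (by fun_prop)
  have hint2 : Integrable (fun p : ℝ × ℝ => if p.2 ≤ τ - p.1 then V p.1 else 0)
      ((volume.restrict (Set.Ioc 0 τ)).prod ρ) := by
    refine Integrable.of_bound hmF.aestronglyMeasurable K (Eventually.of_forall fun p => ?_)
    split_ifs
    · exact hVn _
    · simpa using (hV0 0).trans (hVK 0)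
  have hswap : ∫ u in Set.Ioc 0 τ, ∫ y, V (u - y) ∂ρ =
      ∫ u in Set.Ioc 0 τ, V u * ρ.real (Set.Iic (τ - u)) := by
    calc ∫ u in Set.Ioc 0 τ, ∫ y, V (u - y) ∂ρ
        = ∫ y, (∫ u in Set.Ioc 0 τ, V (u - y)) ∂ρ := integral_integral_swap hint1
      _ = ∫ y, (∫ u in Set.Ioc 0 τ, if y ≤ τ - u then V u else 0) ∂ρ := by
          apply integral_congr_ae
          filter_upwards [hpos] with y hy
          rw [← integral_indicator measurableSet_Ioc, ← integral_indicator measurableSet_Ioc]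
          have h1 : ∫ x, (Set.Ioc 0 τ).indicator (fun u => V (u - y)) x =
              ∫ x, (fun v => (Set.Ioc 0 τ).indicator (fun _ => V v) (v + y)) (x - y) := by
            apply integral_congr_ae
            filter_upwards with x
            simp [Set.indicator]
          rw [h1, integral_sub_right_eq_self
            (fun v => (Set.Ioc 0 τ).indicator (fun _ => V v) (v + y)) y]
          apply integral_congr_ae
          have h0 : ∀ᵐ x : ℝ, x ≠ 0 := by
            simp [ae_iff]
          filter_upwards [h0] with x hx
          simp only [Set.indicator, Set.mem_Ioc]
          rcases lt_or_gt_of_ne hx with h | h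
          · rw [hVneg x h]; simp
          · by_cases h2 : y ≤ τ - x
            · rw [if_pos ⟨by linarith, by linarith⟩, if_pos ⟨by linarith, by linarith⟩, if_pos h2]
            · rw [if_neg (fun hh => h2 (by linarith [hh.2]))]
              simp [h2]
      _ = ∫ u in Set.Ioc 0 τ, ∫ y, (if y ≤ τ - u then V u else 0) ∂ρ :=
          (integral_integral_swap hint2).symm
      _ = _ := by
          congr 1
          ext u
          have : (fun y => if y ≤ τ - u then V u else 0) =
              (Set.Iic (τ - u)).indicator (fun _ => V u) := by
            ext y; simp [Set.indicator]
          rw [this, integral_indicator measurableSet_Iic]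
          simp [mul_comm]
  have hI1 : Integrable V (volume.restrict (Set.Ioc 0 τ)) :=
    Integrable.of_bound (by fun_prop) K (Eventually.of_forall fun p => hVn _)
  have hI2 : Integrable (fun u => ∫ y, V (u - y) ∂ρ) (volume.restrict (Set.Ioc 0 τ)) :=
    hint1.integral_prod_left
  have hmI : Measurable fun u => ρ.real (Set.Iic (τ - u)) := by
    apply Antitone.measurable
    intro a b hab
    exact measureReal_mono (Set.Iic_subset_Iic.2 (by linarith))
  have hI3 : Integrable (fun u => V u * ρ.real (Set.Iic (τ - u)))
      (volume.restrict (Set.Ioc 0 τ)) := by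
    refine Integrable.of_bound (by fun_prop) (K * 1) (Eventually.of_forall fun p => ?_)
    rw [norm_mul]
    refine mul_le_mul (hVn _) ?_ (norm_nonneg _) ((hV0 0).trans (hVK 0))
    rw [Real.norm_of_nonneg measureReal_nonneg]
    exact measureReal_le_one
  rw [integral_sub hI1 hI2, hswap, ← integral_sub hI1 hI3]
  rw [← intervalIntegral.integral_of_le hτ, ← intervalIntegral.integral_of_le hτ]
  have := intervalIntegral.integral_comp_sub_left (a := 0) (b := τ)
    (fun u => V u * ρ.real (Set.Ioi (τ - u))) τ
  simp only [sub_sub_cancel, sub_self, sub_zero] at this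
  rw [this]
  congr 1
  ext u
  have : ρ.real (Set.Ioi (τ - u)) = 1 - ρ.real (Set.Iic (τ - u)) := by
    rw [← Set.compl_Iic, probReal_compl_eq_one_sub measurableSet_Iic]
  rw [this]; ring
theorem ren_int (ρ : Measure ℝ) [IsProbabilityMeasure ρ]
    (V : ℝ → ℝ) (K : ℝ) (hVm : Measurable V) (hV0 : ∀ u, 0 ≤ V u) (hVK : ∀ u, V u ≤ K) (τ : ℝ) :
    Integrable (fun u => V u - ∫ y, V (u - y) ∂ρ) (volume.restrict (Set.Ioc 0 τ)) := by
  have hVn : ∀ u, ‖V u‖ ≤ K := fun u => by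
    rw [Real.norm_of_nonneg (hV0 u)]; exact hVK u
  have hint1 : Integrable (fun p : ℝ × ℝ => V (p.1 - p.2)) ((volume.restrict (Set.Ioc 0 τ)).prod ρ) :=
    Integrable.of_bound (by
      have : Measurable fun p : ℝ × ℝ => V (p.1 - p.2) := by fun_prop
      exact this.aestronglyMeasurable) K (Eventually.of_forall fun p => hVn _)
  have hI1 : Integrable V (volume.restrict (Set.Ioc 0 τ)) :=
    Integrable.of_bound (by fun_prop) K (Eventually.of_forall fun p => hVn _)
  exact hI1.sub hint1.integral_prod_left

theorem anti_tail (ρ : Measure ℝ) [IsProbabilityMeasure ρ] :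
    Antitone fun y => ρ.real (Set.Ioi y) := by
  intro a b hab
  exact measureReal_mono (Set.Ioi_subset_Ioi hab)

theorem ren_int2 (ρ : Measure ℝ) [IsProbabilityMeasure ρ]
    (V : ℝ → ℝ) (K : ℝ) (hVm : Measurable V) (hV0 : ∀ u, 0 ≤ V u) (hVK : ∀ u, V u ≤ K) (τ : ℝ) :
    IntegrableOn (fun y => V (τ - y) * ρ.real (Set.Ioi y)) (Set.Ioc 0 τ) := by
  have hm := (anti_tail ρ).measurable
  refine Integrable.of_bound (Measurable.aestronglyMeasurable (by fun_prop)) (K * 1)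
    (Eventually.of_forall fun p => ?_)
  rw [norm_mul]
  refine mul_le_mul ?_ ?_ (norm_nonneg _) ((hV0 0).trans (hVK 0))
  · rw [Real.norm_of_nonneg (hV0 _)]; exact hVK _
  · rw [Real.norm_of_nonneg measureReal_nonneg]
    exact measureReal_le_one

theorem exp_mono_shift (V : ℝ → ℝ) (hVmono : Monotone fun u => Real.exp u * V u) (a b : ℝ)
    (hab : a ≤ b) : V a ≤ Real.exp (b - a) * V b := by
  have := hVmono hab
  simp only at this
  rw [Real.exp_sub, div_mul_eq_mul_div, le_div_iff₀ (Real.exp_pos _)]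
  linarith

theorem meas_of_expmono (V : ℝ → ℝ) (hVmono : Monotone fun u => Real.exp u * V u) :
    Measurable V := by
  have h := hVmono.measurable
  have : V = fun u => Real.exp (-u) * (Real.exp u * V u) := by
    ext u
    rw [← mul_assoc, ← Real.exp_add]; simp
  rw [this]
  exact (Real.measurable_exp.comp measurable_neg).mul h

theorem ren_bound (s : ℝ) (hs : 0 < s) (ρ : Measure ℝ) [IsProbabilityMeasure ρ]
    (hpos : ∀ᵐ y ∂ρ, 0 < y)
    (V : ℝ → ℝ) (K : ℝ) (hV0 : ∀ u, 0 ≤ V u) (hVK : ∀ u, V u ≤ K)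
    (hVneg : ∀ u, u < 0 → V u = 0) (hVmono : Monotone fun u => Real.exp u * V u)
    (hineq : ∀ u, 0 ≤ u → V u ≤ Real.exp (-u) / s + ∫ y, V (u - y) ∂ρ)
    (κ : ℝ) (hκ : 0 < κ) (hκs : κ ≤ s * ρ.real (Set.Ioi 1)) (τ : ℝ) :
    V τ ≤ Real.exp 1 / κ := by
  have hVm := meas_of_expmono V hVmono
  rcases lt_or_ge τ 0 with h | hτ
  · rw [hVneg τ h]; positivity
  have hid := ren_identity ρ hpos V K hVm hV0 hVK hVneg (τ + 1) (by linarith)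
  have hexp : IntegrableOn (fun u : ℝ => Real.exp (-u)) (Set.Ioi 0) := integrableOn_exp_neg_Ioi 0
  have h1 : ∫ u in Set.Ioc 0 (τ + 1), (V u - ∫ y, V (u - y) ∂ρ) ≤ 1 / s := by
    calc _ ≤ ∫ u in Set.Ioc 0 (τ + 1), Real.exp (-u) / s := by
          apply setIntegral_mono_on (ren_int ρ V K hVm hV0 hVK _) _ measurableSet_Ioc
          · intro u hu
            linarith [hineq u hu.1.le]
          · exact (hexp.mono_set Set.Ioc_subset_Ioi_self).div_const s
      _ ≤ ∫ u in Set.Ioi 0, Real.exp (-u) / s := by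
          apply setIntegral_mono_set (hexp.div_const s)
          · exact Eventually.of_forall fun u => by positivity
          · exact Set.Ioc_subset_Ioi_self.eventuallyLE
      _ = 1 / s := by rw [integral_div, integral_exp_neg_Ioi_zero]
  have h2 : Real.exp (-1) * V τ * ρ.real (Set.Ioi 1) ≤
      ∫ y in Set.Ioc 0 (τ + 1), V (τ + 1 - y) * ρ.real (Set.Ioi y) := by
    have hi := ren_int2 ρ V K hVm hV0 hVK (τ + 1)
    have hsub : Set.Ioc (0:ℝ) 1 ⊆ Set.Ioc 0 (τ + 1) := Set.Ioc_subset_Ioc_right (by linarith)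
    calc Real.exp (-1) * V τ * ρ.real (Set.Ioi 1)
        = ∫ y in Set.Ioc (0:ℝ) 1, Real.exp (-1) * V τ * ρ.real (Set.Ioi 1) := by simp
      _ ≤ ∫ y in Set.Ioc (0:ℝ) 1, V (τ + 1 - y) * ρ.real (Set.Ioi y) := by
          apply setIntegral_mono_on (integrable_const _) (hi.mono_set hsub) measurableSet_Ioc
          intro y hy
          apply mul_le_mul _ (anti_tail ρ hy.2) measureReal_nonneg (hV0 _)
          have := exp_mono_shift V hVmono τ (τ + 1 - y) (by linarith [hy.2])
          have h3 : Real.exp (τ + 1 - y - τ) ≤ Real.exp 1 := Real.exp_le_exp.2 (by linarith [hy.1])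
          rw [Real.exp_neg, inv_mul_le_iff₀ (Real.exp_pos _)]
          exact this.trans (mul_le_mul_of_nonneg_right h3 (hV0 _))
      _ ≤ _ := by
          apply setIntegral_mono_set hi
          · exact Eventually.of_forall fun u => mul_nonneg (hV0 _) measureReal_nonneg
          · exact hsub.eventuallyLE
  have h3 : Real.exp (-1) * V τ * ρ.real (Set.Ioi 1) ≤ 1 / s := by linarith
  rw [le_div_iff₀ hs, Real.exp_neg] at h3
  rw [le_div_iff₀ hκ]
  have h4 : V τ * κ ≤ V τ * (s * ρ.real (Set.Ioi 1)) := mul_le_mul_of_nonneg_left hκs (hV0 _)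
  have h5 : (Real.exp 1)⁻¹ * (V τ * (s * ρ.real (Set.Ioi 1))) ≤ 1 := by linarith
  rw [inv_mul_le_iff₀ (Real.exp_pos _)] at h5
  linarith

structure Ren (s : ℝ) (ρ : Measure ℝ) (φ V : ℝ → ℝ) (K B : ℝ) : Prop where
  hs : 0 < s
  prob : IsProbabilityMeasure ρ
  pos : ∀ᵐ y ∂ρ, 0 < y
  φm : Measurable φ
  φ0 : ∀ u, 0 ≤ φ u
  φ1 : ∀ u, 0 ≤ u → φ u ≤ Real.exp (-u)
  V0 : ∀ u, 0 ≤ V u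
  VK : ∀ u, V u ≤ K
  Vneg : ∀ u, u < 0 → V u = 0
  Vmono : Monotone fun u => Real.exp u * V u
  eqn : ∀ u, 0 ≤ u → V u = φ u / s + ∫ y, V (u - y) ∂ρ
  i1 : Integrable (fun y : ℝ => Real.sqrt y) ρ
  i2 : Integrable (fun y : ℝ => y ^ 2) ρ
  m1 : s * ∫ y, Real.sqrt y ∂ρ ≤ B
  m2 : s * ∫ y, y ^ 2 ∂ρ ≤ B

theorem Ren.phi_int {s : ℝ} {ρ : Measure ℝ} {φ V : ℝ → ℝ} {K B : ℝ} (R : Ren s ρ φ V K B) :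
    IntegrableOn φ (Set.Ioi 0) := by
  refine Integrable.mono' (integrableOn_exp_neg_Ioi 0) R.φm.aestronglyMeasurable ?_
  filter_upwards [ae_restrict_mem measurableSet_Ioi] with u hu
  rw [Real.norm_of_nonneg (R.φ0 u)]
  exact R.φ1 u (le_of_lt hu)

theorem Ren.phi_le {s : ℝ} {ρ : Measure ℝ} {φ V : ℝ → ℝ} {K B : ℝ} (R : Ren s ρ φ V K B) :
    ∫ u in Set.Ioi 0, φ u ≤ 1 := by
  rw [← integral_exp_neg_Ioi_zero]
  exact setIntegral_mono_on R.phi_int (integrableOn_exp_neg_Ioi 0) measurableSet_Ioi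
    fun u hu => R.φ1 u (le_of_lt hu)

theorem Ren.phi_nonneg {s : ℝ} {ρ : Measure ℝ} {φ V : ℝ → ℝ} {K B : ℝ} (R : Ren s ρ φ V K B) :
    0 ≤ ∫ u in Set.Ioi 0, φ u := integral_nonneg R.φ0

theorem Ren.ident {s : ℝ} {ρ : Measure ℝ} {φ V : ℝ → ℝ} {K B : ℝ} (R : Ren s ρ φ V K B)
    (τ : ℝ) (hτ : 0 ≤ τ) :
    ∫ y in Set.Ioc 0 τ, V (τ - y) * (s * ρ.real (Set.Ioi y)) = ∫ u in Set.Ioc 0 τ, φ u := by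
  have := R.prob
  have hs := R.hs
  have hVm := meas_of_expmono V R.Vmono
  have h := ren_identity ρ R.pos V K hVm R.V0 R.VK R.Vneg τ hτ
  have h1 : ∫ u in Set.Ioc 0 τ, (V u - ∫ y, V (u - y) ∂ρ) = ∫ u in Set.Ioc 0 τ, φ u / s := by
    apply setIntegral_congr_fun measurableSet_Ioc
    intro u hu
    simp only
    linarith [R.eqn u hu.1.le]
  rw [h1, integral_div] at h
  have h2 : ∀ y, V (τ - y) * (s * ρ.real (Set.Ioi y)) = s * (V (τ - y) * ρ.real (Set.Ioi y)) :=
    fun y => by ring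
  simp_rw [h2]
  rw [integral_const_mul, h]
  field_simp

theorem Ren.intV {s : ℝ} {ρ : Measure ℝ} {φ V : ℝ → ℝ} {K B : ℝ} (R : Ren s ρ φ V K B)
    (τ : ℝ) : IntegrableOn (fun y => V (τ - y) * (s * ρ.real (Set.Ioi y))) (Set.Ioc 0 τ) := by
  have := R.prob
  have hVm := meas_of_expmono V R.Vmono
  have := (ren_int2 ρ V K hVm R.V0 R.VK τ).const_mul s
  refine this.congr (Eventually.of_forall fun y => ?_)
  simp only
  ring

theorem Ren.w_le {s : ℝ} {ρ : Measure ℝ} {φ V : ℝ → ℝ} {K B : ℝ} (R : Ren s ρ φ V K B)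
    (y : ℝ) (hy : 0 < y) : s * ρ.real (Set.Ioi y) ≤ B * y ^ (-2 : ℝ) := by
  have := R.prob
  have h := mul_meas_ge_le_integral_of_nonneg (μ := ρ) (f := fun y : ℝ => y ^ 2)
    (Eventually.of_forall fun y => by positivity) R.i2 (y ^ 2)
  have h2 : ρ.real (Set.Ioi y) ≤ ρ.real {x | y ^ 2 ≤ x ^ 2} := by
    refine measureReal_mono ?_ (measure_ne_top _ _)
    intro x hx
    have : y < x := hx
    change y ^ 2 ≤ x ^ 2
    gcongr
  rw [Real.rpow_neg hy.le, ← div_eq_mul_inv]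
  norm_cast
  rw [le_div_iff₀ (by positivity)]
  have h3 := mul_le_mul_of_nonneg_left h R.hs.le
  have h4 := mul_le_mul_of_nonneg_left h2 (mul_nonneg R.hs.le (sq_nonneg y))
  linarith [R.m2]

theorem Ren.B0 {s : ℝ} {ρ : Measure ℝ} {φ V : ℝ → ℝ} {K B : ℝ} (R : Ren s ρ φ V K B) :
    0 ≤ B := le_trans (mul_nonneg R.hs.le (integral_nonneg fun y => by positivity)) R.m2

theorem Ren.w_int {s : ℝ} {ρ : Measure ℝ} {φ V : ℝ → ℝ} {K B : ℝ} (R : Ren s ρ φ V K B) :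
    IntegrableOn (fun y => s * ρ.real (Set.Ioi y)) (Set.Ioi 0) := by
  have := R.prob
  have hm := (anti_tail ρ).measurable
  rw [← Set.Ioc_union_Ioi_eq_Ioi (zero_le_one (α := ℝ))]
  apply IntegrableOn.union
  · refine Integrable.of_bound (Measurable.aestronglyMeasurable (by fun_prop)) (s * 1)
      (Eventually.of_forall fun p => ?_)
    rw [Real.norm_of_nonneg (mul_nonneg R.hs.le measureReal_nonneg)]
    exact mul_le_mul_of_nonneg_left measureReal_le_one R.hs.le
  · refine Integrable.mono' ((integrableOn_Ioi_rpow_of_lt (a := -2) (by norm_num)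
      (zero_lt_one (α := ℝ))).const_mul B) (Measurable.aestronglyMeasurable (by fun_prop)) ?_
    filter_upwards [ae_restrict_mem measurableSet_Ioi] with u hu
    rw [Real.norm_of_nonneg (mul_nonneg R.hs.le measureReal_nonneg)]
    exact R.w_le u (lt_trans zero_lt_one hu)

theorem Ren.w_tail {s : ℝ} {ρ : Measure ℝ} {φ V : ℝ → ℝ} {K B : ℝ} (R : Ren s ρ φ V K B)
    (L : ℝ) (hL : 0 < L) : ∫ y in Set.Ioi L, s * ρ.real (Set.Ioi y) ≤ B / L := by
  have hi := (integrableOn_Ioi_rpow_of_lt (a := -2) (by norm_num) hL).const_mul B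
  calc _ ≤ ∫ y in Set.Ioi L, B * y ^ (-2:ℝ) := by
        apply setIntegral_mono_on (R.w_int.mono_set (Set.Ioi_subset_Ioi hL.le)) hi measurableSet_Ioi
        intro y hy
        exact R.w_le y (hL.trans hy)
    _ = B / L := by
        rw [integral_const_mul, integral_Ioi_rpow_of_lt (by norm_num) hL]
        norm_num
        rw [Real.rpow_neg hL.le]
        simp [div_eq_mul_inv]

theorem Ren.id_int {s : ℝ} {ρ : Measure ℝ} {φ V : ℝ → ℝ} {K B : ℝ} (R : Ren s ρ φ V K B) :
    Integrable (fun y : ℝ => y) ρ := by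
  have := R.prob
  refine Integrable.mono' ((integrable_const (1:ℝ)).add R.i2) (by fun_prop) ?_
  filter_upwards with y
  simp only [Pi.add_apply, Real.norm_eq_abs]
  rw [← sq_abs]
  nlinarith [abs_nonneg y, sq_nonneg (|y| - 1)]

theorem Ren.w_eq {s : ℝ} {ρ : Measure ℝ} {φ V : ℝ → ℝ} {K B : ℝ} (R : Ren s ρ φ V K B) :
    ∫ y in Set.Ioi 0, s * ρ.real (Set.Ioi y) = s * ∫ y, y ∂ρ := by
  rw [integral_const_mul, R.id_int.integral_eq_integral_meas_lt
    (R.pos.mono fun y hy => le_of_lt hy)]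
  rfl
theorem Ren.near_max {s : ℝ} {ρ : Measure ℝ} {φ V : ℝ → ℝ} {K B : ℝ} (R : Ren s ρ φ V K B)
    (δ Q T L τ d κ u v : ℝ) (hδ : 0 < δ) (hδK : δ ≤ K) (hL : 1 ≤ L) (hT : 0 ≤ T) (hτ : T + L ≤ τ)
    (hup : ∀ t, T ≤ t → V t ≤ Q + δ) (hlow : Q - δ ≤ V τ) 
    (hκ : κ ≤ s * ρ.real (Set.Ioo u v)) (hd0 : 0 ≤ d)
    (hd : Real.exp (-τ) + 2 * Real.sqrt (δ * K) * B + K * B / L ^ 2 < d * κ) :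
    ∃ y ∈ Set.Ioo u v, V τ - V (τ - y) ≤ d := by
  by_contra! hcon
  have := R.prob
  have hs := R.hs
  have hVm := meas_of_expmono V R.Vmono
  have hK : 0 < K := lt_of_lt_of_le hδ hδK
  have hVi : Integrable (fun y => V (τ - y)) ρ :=
    Integrable.of_bound (Measurable.aestronglyMeasurable (by fun_prop)) K
      (Eventually.of_forall fun y => by
        rw [Real.norm_of_nonneg (R.V0 _)]; exact R.VK _)
  have h1 : ∫ y, (V τ - V (τ - y)) ∂ρ = φ τ / s := by
    rw [integral_sub (integrable_const _) hVi]
    have := R.eqn τ (by linarith)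
    simp
    linarith
  have hpt : ∀ᵐ y ∂ρ, (Set.Ioo u v).indicator (fun _ => d) y
      - 2 * Real.sqrt (δ * K) * Real.sqrt y - K / L ^ 2 * y ^ 2 ≤ V τ - V (τ - y) := by
    filter_upwards [R.pos] with y hy
    have hsq : 0 ≤ Real.sqrt (δ * K) := Real.sqrt_nonneg _
    have hsy : 0 ≤ Real.sqrt y := Real.sqrt_nonneg _
    have hq : 0 ≤ K / L ^ 2 * y ^ 2 := by positivity
    have hp : 0 ≤ 2 * Real.sqrt (δ * K) * Real.sqrt y := by positivity
    by_cases hmem : y ∈ Set.Ioo u v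
    · rw [Set.indicator_of_mem hmem]
      linarith [hcon y hmem]
    · rw [Set.indicator_of_notMem hmem]
      rcases lt_or_ge L y with hLy | hyL
      · have h2 : K ≤ K / L ^ 2 * y ^ 2 := by
          rw [div_mul_eq_mul_div, le_div_iff₀ (by positivity)]
          gcongr
        linarith [R.VK (τ - y), R.V0 τ]
      · have h3 : V (τ - y) - V τ ≤ 2 * δ := by linarith [hup (τ - y) (by linarith)]
        have h4 : V (τ - y) - V τ ≤ 2 * Real.sqrt (δ * K) * Real.sqrt y := by
          rcases le_total y 1 with hy1 | hy1
          · have h5 := exp_mono_shift V R.Vmono (τ - y) τ (by linarith)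
            rw [sub_sub_cancel] at h5
            have h6 : Real.exp y ≤ 1 + 2 * y := by
              have := Real.abs_exp_sub_one_le (x := y) (by rw [abs_of_pos hy]; exact hy1)
              rw [abs_of_pos hy] at this
              linarith [le_abs_self (Real.exp y - 1)]
            have h7 : V (τ - y) - V τ ≤ 2 * K * y := by
              have := mul_le_mul_of_nonneg_right h6 (R.V0 τ)
              nlinarith [R.VK τ]
            rw [mul_assoc, ← Real.sqrt_mul (by positivity)]
            by_cases h0 : V (τ - y) - V τ ≤ 0
            · exact h0.trans (by positivity)
            push Not at h0
            have : (V (τ - y) - V τ) / 2 ≤ Real.sqrt (δ * K * y) := by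
              apply Real.le_sqrt_of_sq_le
              have : (V (τ - y) - V τ) ^ 2 ≤ (2 * δ) * (2 * K * y) := by
                rw [sq]; exact mul_le_mul h3 h7 h0.le (by positivity)
              nlinarith
            linarith
          · have h5 : δ ≤ Real.sqrt (δ * K) := by
              apply Real.le_sqrt_of_sq_le
              nlinarith
            have h6 : 1 ≤ Real.sqrt y := Real.one_le_sqrt.2 hy1
            nlinarith
        linarith
  have i1 := R.i1.const_mul (2 * Real.sqrt (δ * K))
  have i2 := R.i2.const_mul (K / L ^ 2)
  have i0 : Integrable ((Set.Ioo u v).indicator (fun _ => d)) ρ :=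
    (integrable_const d).indicator measurableSet_Ioo
  have i01 : Integrable (fun y => (Set.Ioo u v).indicator (fun _ => d) y -
      2 * Real.sqrt (δ * K) * Real.sqrt y) ρ := i0.sub i1
  have h2 := integral_mono_ae (i01.sub i2) ((integrable_const _).sub hVi) hpt
  simp only [Pi.sub_apply] at h2
  rw [h1, integral_sub i01 i2, integral_sub i0 i1, integral_const_mul, integral_const_mul,
    integral_indicator measurableSet_Ioo] at h2
  simp only [integral_const, MeasurableSet.univ, measureReal_restrict_apply, Set.univ_inter,
    smul_eq_mul] at h2
  rw [le_div_iff₀ hs] at h2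
  have h3 := R.φ1 τ (by linarith)
  have h4 := mul_le_mul_of_nonneg_left R.m1 (by positivity : 0 ≤ 2 * Real.sqrt (δ * K))
  have h5 := mul_le_mul_of_nonneg_left R.m2 (by positivity : 0 ≤ K / L ^ 2)
  have h6 := mul_le_mul_of_nonneg_left hκ hd0
  have h7 : K / L ^ 2 * B = K * B / L ^ 2 := by ring
  nlinarith

theorem Ren.upper_step {s : ℝ} {ρ : Measure ℝ} {φ V : ℝ → ℝ} {K B : ℝ} (R : Ren s ρ φ V K B)
    (δ Q T L τ d κ h θ : ℝ) (J : ℕ) (hJ : 0 < J) (hδ : 0 < δ) (hδK : δ ≤ K) (hL : 1 ≤ L) (hT : 0 ≤ T)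
    (hh : 0 < h) (hJL : J * h ≤ L)
    (hτ : T + L ≤ τ)
    (hup : ∀ t, T ≤ t → V t ≤ Q + δ) (hlow : Q - δ ≤ V τ) 
    (hκ : ∀ j ∈ Finset.Icc 1 J, κ ≤ s * ρ.real (Set.Ioo (j * h) ((j + 1) * h))) (hd0 : 0 ≤ d)
    (hd : Real.exp (-τ) + 2 * Real.sqrt (δ * K) * B + K * B / L ^ 2 < d * κ)
    (hQ : 0 ≤ Q - δ - d) (hθ : 1 - θ ≤ s * ∫ y, y ∂ρ) :
    Real.exp (-(2 * h)) * (Q - δ - d) * (1 - θ - B / (J * h)) ≤ ∫ u in Set.Ioi 0, φ u := by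
  have := R.prob
  have hJh : 0 < (J:ℝ) * h := by positivity
  have hpt : ∀ y ∈ Set.Ioc 0 (J * h), Real.exp (-(2 * h)) * (Q - δ - d) ≤ V (τ - y) := by
    intro y hy
    set j := ⌈y / h⌉₊ with hj
    have hj1 : y / h ≤ j := Nat.le_ceil _
    have hj2 : (j:ℝ) < y / h + 1 := Nat.ceil_lt_add_one (div_nonneg hy.1.le hh.le)
    have hj3 : 1 ≤ j := Nat.one_le_iff_ne_zero.2 (by
      have : 0 < j := Nat.ceil_pos.2 (div_pos hy.1 hh)
      omega)
    have hj4 : j ≤ J := Nat.ceil_le.2 (by rw [div_le_iff₀ hh]; exact hy.2)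
    rw [div_le_iff₀ hh] at hj1
    have hj2' : (j:ℝ) * h < y + h := by
      have := mul_lt_mul_of_pos_right hj2 hh
      rw [add_mul, div_mul_cancel₀ _ hh.ne'] at this
      linarith
    obtain ⟨z, hz, hz2⟩ := R.near_max δ Q T L τ d κ _ _ hδ hδK hL hT hτ hup hlow
      (hκ j (Finset.mem_Icc.2 ⟨hj3, hj4⟩)) hd0 hd
    have h1 := exp_mono_shift V R.Vmono (τ - z) (τ - y) (by linarith [hz.1])
    have h2 : Real.exp (τ - y - (τ - z)) ≤ Real.exp (2 * h) :=
      Real.exp_le_exp.2 (by nlinarith [hz.2])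
    have h3 := mul_le_mul_of_nonneg_right h2 (R.V0 (τ - y))
    rw [Real.exp_neg, inv_mul_le_iff₀ (Real.exp_pos _)]
    linarith
  have hsub : Set.Ioc 0 (J * h) ⊆ Set.Ioc 0 τ := Set.Ioc_subset_Ioc_right (by linarith)
  have hw := R.w_int.mono_set (Set.Ioc_subset_Ioi_self : Set.Ioc (0:ℝ) (J * h) ⊆ Set.Ioi 0)
  have hw2 := R.w_int.mono_set (Set.Ioi_subset_Ioi hJh.le)
  have hsplit : ∫ y in Set.Ioi 0, s * ρ.real (Set.Ioi y) =
      (∫ y in Set.Ioc 0 (J * h), s * ρ.real (Set.Ioi y)) +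
      ∫ y in Set.Ioi (J * h), s * ρ.real (Set.Ioi y) := by
    rw [← Set.Ioc_union_Ioi_eq_Ioi hJh.le, setIntegral_union (Set.Ioc_disjoint_Ioi le_rfl)
      measurableSet_Ioi hw hw2]
  have ht := R.w_tail _ hJh
  rw [R.w_eq] at hsplit
  calc Real.exp (-(2 * h)) * (Q - δ - d) * (1 - θ - B / (J * h))
      ≤ Real.exp (-(2 * h)) * (Q - δ - d) * ∫ y in Set.Ioc 0 (J * h), s * ρ.real (Set.Ioi y) := by
        apply mul_le_mul_of_nonneg_left _ (by positivity)
        linarith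
    _ = ∫ y in Set.Ioc 0 (J * h), Real.exp (-(2 * h)) * (Q - δ - d) * (s * ρ.real (Set.Ioi y)) :=
        (integral_const_mul _ _).symm
    _ ≤ ∫ y in Set.Ioc 0 (J * h), V (τ - y) * (s * ρ.real (Set.Ioi y)) := by
        apply setIntegral_mono_on (hw.const_mul _) ((R.intV τ).mono_set hsub) measurableSet_Ioc
        intro y hy
        exact mul_le_mul_of_nonneg_right (hpt y hy) (mul_nonneg R.hs.le measureReal_nonneg)
    _ ≤ ∫ y in Set.Ioc 0 τ, V (τ - y) * (s * ρ.real (Set.Ioi y)) := by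
        apply setIntegral_mono_set (R.intV τ)
        · exact Eventually.of_forall fun u => mul_nonneg (R.V0 _) (mul_nonneg R.hs.le measureReal_nonneg)
        · exact hsub.eventuallyLE
    _ = ∫ u in Set.Ioc 0 τ, φ u := R.ident τ (by linarith)
    _ ≤ _ := by
        apply setIntegral_mono_set R.phi_int
        · exact Eventually.of_forall R.φ0
        · exact Set.Ioc_subset_Ioi_self.eventuallyLE

theorem Ren.lower {s : ℝ} {ρ : Measure ℝ} {φ V : ℝ → ℝ} {K B : ℝ} (R : Ren s ρ φ V K B)
    (δ T L τ κ h θ ε I : ℝ) (hI : I = ∫ u in Set.Ioi 0, φ u) (hδ : 0 < δ) (hT : 0 ≤ T)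
    (hh : 0 < h) (hL : 0 < L) (hhL : Real.exp h ≤ 1 + ε / 2) (hε : 0 < ε)
    (hτ : T + L ≤ τ) (hτh : h ≤ τ)
    (hup : ∀ t, T ≤ t → V t ≤ I + δ) (hlow : V τ < I - ε) 
    (hκ : κ ≤ s * ρ.real (Set.Ioi h)) (hθ : s * ∫ y, y ∂ρ ≤ 1 + θ) :
    I - Real.exp (-τ) ≤ (I + δ) * (1 + θ) - ε / 2 * (h * κ) + K * (B / L) := by
  have := R.prob
  have hI0 : 0 ≤ I := hI ▸ R.phi_nonneg
  have hI1 : I ≤ 1 := hI ▸ R.phi_le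
  have hK0 : 0 ≤ K := (R.V0 0).trans (R.VK 0)
  have hτ0 : 0 ≤ τ := by linarith
  have hw0 : ∀ y, 0 ≤ s * ρ.real (Set.Ioi y) := fun y => mul_nonneg R.hs.le measureReal_nonneg
  have hw := R.w_int
  have hphi : I - Real.exp (-τ) ≤ ∫ u in Set.Ioc 0 τ, φ u := by
    have h1 : ∫ u in Set.Ioi τ, φ u ≤ Real.exp (-τ) := by
      rw [← integral_exp_neg_Ioi]
      exact setIntegral_mono_on (R.phi_int.mono_set (Set.Ioi_subset_Ioi hτ0))
        (integrableOn_exp_neg_Ioi τ) measurableSet_Ioi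
        fun u hu => R.φ1 u (hτ0.trans (le_of_lt hu))
    have h2 : ∫ u in Set.Ioi 0, φ u = (∫ u in Set.Ioc 0 τ, φ u) + ∫ u in Set.Ioi τ, φ u := by
      rw [← Set.Ioc_union_Ioi_eq_Ioi hτ0, setIntegral_union (Set.Ioc_disjoint_Ioi le_rfl)
        measurableSet_Ioi (R.phi_int.mono_set Set.Ioc_subset_Ioi_self)
        (R.phi_int.mono_set (Set.Ioi_subset_Ioi hτ0))]
    linarith
  rw [← R.ident τ hτ0] at hphi
  refine hphi.trans ?_
  have iA := hw.const_mul (I + δ)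
  have iB : IntegrableOn ((Set.Ioc 0 h).indicator fun y => ε / 2 * (s * ρ.real (Set.Ioi y)))
      (Set.Ioi 0) := (hw.const_mul (ε / 2)).indicator measurableSet_Ioc
  have iC : IntegrableOn ((Set.Ioi L).indicator fun y => K * (s * ρ.real (Set.Ioi y)))
      (Set.Ioi 0) := (hw.const_mul K).indicator measurableSet_Ioi
  have iAB : IntegrableOn (fun y => (I + δ) * (s * ρ.real (Set.Ioi y)) -
        (Set.Ioc 0 h).indicator (fun y => ε / 2 * (s * ρ.real (Set.Ioi y))) y) (Set.Ioi 0) :=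
    iA.sub iB
  have iABC : IntegrableOn (fun y => (I + δ) * (s * ρ.real (Set.Ioi y)) -
        (Set.Ioc 0 h).indicator (fun y => ε / 2 * (s * ρ.real (Set.Ioi y))) y +
        (Set.Ioi L).indicator (fun y => K * (s * ρ.real (Set.Ioi y))) y) (Set.Ioi 0) :=
    iAB.add iC
  have hsub : Set.Ioc 0 τ ⊆ Set.Ioi 0 := Set.Ioc_subset_Ioi_self
  rw [← integral_indicator measurableSet_Ioc]
  have hle : ∫ y, (Set.Ioc 0 τ).indicator (fun y => V (τ - y) * (s * ρ.real (Set.Ioi y))) y ≤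
      ∫ y in Set.Ioi 0, ((I + δ) * (s * ρ.real (Set.Ioi y)) -
        (Set.Ioc 0 h).indicator (fun y => ε / 2 * (s * ρ.real (Set.Ioi y))) y +
        (Set.Ioi L).indicator (fun y => K * (s * ρ.real (Set.Ioi y))) y) := by
    rw [← integral_indicator measurableSet_Ioi]
    apply integral_mono ((integrable_indicator_iff measurableSet_Ioc).2 (R.intV τ))
      ((integrable_indicator_iff measurableSet_Ioi).2 iABC)
    intro y
    simp only
    by_cases hy0 : y ∈ Set.Ioi (0:ℝ)
    swap
    · rw [Set.indicator_of_notMem hy0, Set.indicator_of_notMem (fun h => hy0 (hsub h))]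
    have hy0' : 0 < y := hy0
    rw [Set.indicator_of_mem hy0]
    have hwy := hw0 y
    simp only [Set.indicator, Set.mem_Ioc, Set.mem_Ioi]
    by_cases hyh : y ≤ h
    · rw [if_pos ⟨hy0', hyh.trans hτh⟩, if_pos ⟨hy0', hyh⟩]
      have h1 : V (τ - y) ≤ I - ε / 2 := by
        have h2 := exp_mono_shift V R.Vmono (τ - y) τ (by linarith)
        rw [sub_sub_cancel] at h2
        have h3 : Real.exp y ≤ 1 + ε / 2 := (Real.exp_le_exp.2 hyh).trans hhL
        have h4 : Real.exp y * V τ ≤ (1 + ε / 2) * V τ := mul_le_mul_of_nonneg_right h3 (R.V0 _)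
        nlinarith
      have h5 : 0 ≤ (if L < y then K * (s * ρ.real (Set.Ioi y)) else 0) := by
        split_ifs
        · positivity
        · exact le_rfl
      nlinarith
    · rw [if_neg (fun hh : 0 < y ∧ y ≤ h => hyh hh.2)]
      by_cases hyL : L < y
      · rw [if_pos hyL]
        have : (if 0 < y ∧ y ≤ τ then V (τ - y) * (s * ρ.real (Set.Ioi y)) else 0) ≤
            K * (s * ρ.real (Set.Ioi y)) := by
          split_ifs
          · exact mul_le_mul_of_nonneg_right (R.VK _) hwy
          · positivity
        have : 0 ≤ (I + δ) * (s * ρ.real (Set.Ioi y)) := by positivity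
        linarith
      · rw [if_neg hyL, if_pos ⟨hy0', by linarith⟩]
        have := mul_le_mul_of_nonneg_right (hup (τ - y) (by linarith)) hwy
        linarith
  refine hle.trans ?_
  rw [integral_add iAB iC, integral_sub iA iB, integral_const_mul, R.w_eq,
    setIntegral_indicator measurableSet_Ioc, setIntegral_indicator measurableSet_Ioi,
    Set.inter_eq_right.2 Set.Ioc_subset_Ioi_self,
    Set.inter_eq_right.2 (Set.Ioi_subset_Ioi hL.le), integral_const_mul (ε / 2), integral_const_mul K]
  have h1 := mul_le_mul_of_nonneg_left (R.w_tail L hL) hK0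
  have h2 : h * κ ≤ ∫ y in Set.Ioc 0 h, s * ρ.real (Set.Ioi y) := by
    calc h * κ = ∫ y in Set.Ioc 0 h, κ := by simp [hh.le]
      _ ≤ _ := by
        apply setIntegral_mono_on (integrable_const _) (hw.mono_set Set.Ioc_subset_Ioi_self)
          measurableSet_Ioc
        intro y hy
        exact hκ.trans (mul_le_mul_of_nonneg_left (anti_tail ρ hy.2) R.hs.le)
  have h3 := mul_le_mul_of_nonneg_left hθ (by positivity : 0 ≤ I + δ)
  have h4 := mul_le_mul_of_nonneg_left h2 (by positivity : 0 ≤ ε / 2)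
  linarith
theorem exp_neg_le_of (c τ : ℝ) (hc : 0 < c) (h : 1 / c ≤ τ) : Real.exp (-τ) ≤ c := by
  rw [Real.exp_neg, inv_le_comm₀ (Real.exp_pos _) hc, ← one_div]
  linarith [Real.add_one_le_exp τ]

theorem Ren.mono {s : ℝ} {ρ : Measure ℝ} {φ V : ℝ → ℝ} {K K' B : ℝ} (R : Ren s ρ φ V K B)
    (h : K ≤ K') : Ren s ρ φ V K' B :=
  { R with VK := fun u => (R.VK u).trans h }

theorem unif_kappa {ι : Type*} (l : Filter ι) (g : ℕ → ι → ℝ) (F : Finset ℕ)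
    (h : ∀ j ∈ F, ∃ κ : ℝ, 0 < κ ∧ ∀ᶠ p in l, κ ≤ g j p) :
    ∃ κ : ℝ, 0 < κ ∧ ∀ᶠ p in l, ∀ j ∈ F, κ ≤ g j p := by
  classical
  induction F using Finset.induction_on with
  | empty => exact ⟨1, one_pos, by simp⟩
  | insert a F ha ih =>
    obtain ⟨κ, hκ, h1⟩ := ih fun j hj => h j (Finset.mem_insert_of_mem hj)
    obtain ⟨κ', hκ', h2⟩ := h a (Finset.mem_insert_self _ _)
    refine ⟨min κ κ', lt_min hκ hκ', ?_⟩
    filter_upwards [h1, h2] with p hp1 hp2 j hj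
    rcases Finset.mem_insert.1 hj with rfl | hj
    · exact (min_le_right _ _).trans hp2
    · exact (min_le_left _ _).trans (hp1 j hj)

theorem ren_upper {ι : Type*} (l : Filter ι) (s : ι → ℝ) (ρ : ι → Measure ℝ) (φ V : ι → ℝ → ℝ)
    (K B : ℝ) (hK : 1 ≤ K) (hB : 0 ≤ B) (hR : ∀ᶠ p in l, Ren (s p) (ρ p) (φ p) (V p) K B)
    (hκ : ∀ u v : ℝ, 0 < u → u < v → ∃ κ : ℝ, 0 < κ ∧
      ∀ᶠ p in l, κ ≤ s p * (ρ p).real (Set.Ioo u v))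
    (hm : Tendsto (fun p => s p * ∫ y, y ∂(ρ p)) l (nhds 1)) (ε : ℝ) (hε : 0 < ε) (hε1 : ε ≤ 1) :
    ∃ T : ℝ, 0 ≤ T ∧ ∀ᶠ p in l, ∀ τ, T ≤ τ → V p τ ≤ ε + ∫ u in Set.Ioi 0, φ p u := by
  set ω := ε / 8 with hω
  have hω0 : 0 < ω := by positivity
  set h := ω / 4 with hh
  have hh0 : 0 < h := by positivity
  obtain ⟨J0, hJ0⟩ := exists_nat_ge (4 * B / ω / h)
  set J := J0 + 1 with hJ
  have hJpos : (0:ℝ) < J := by rw [hJ]; positivity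
  have hJh : 4 * B / ω ≤ J * h := by
    rw [div_le_iff₀ hh0] at hJ0
    have : (J0 : ℝ) * h ≤ J * h := by
      apply mul_le_mul_of_nonneg_right _ hh0.le
      rw [hJ]; push_cast; linarith
    linarith
  obtain ⟨κ, hκ0, hκe⟩ := unif_kappa l
    (fun j p => s p * (ρ p).real (Set.Ioo (j * h) ((j + 1) * h))) (Finset.Icc 1 J) (by
      intro j hj
      have hj1 : (1:ℝ) ≤ j := by exact_mod_cast (Finset.mem_Icc.1 hj).1
      exact hκ _ _ (by positivity) (by nlinarith))
  set d := ε / 8 with hd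
  have hd0 : 0 < d := by positivity
  set η := d * κ / (8 * (B + 1)) with hη
  have hη0 : 0 < η := by positivity
  set δ := min (ε / 8) (η ^ 2 / K) with hδ
  have hδ0 : 0 < δ := lt_min (by positivity) (by positivity)
  have hδε : δ ≤ ε / 8 := min_le_left _ _
  have hδK : δ ≤ K := by linarith
  have hsq : 2 * Real.sqrt (δ * K) * B ≤ d * κ / 4 := by
    have h1 : δ * K ≤ η ^ 2 := by
      have := min_le_right (ε / 8) (η ^ 2 / K)
      rwa [← hδ, le_div_iff₀ (by positivity)] at this
    have h2 : Real.sqrt (δ * K) ≤ η := by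
      rw [← Real.sqrt_sq hη0.le]; exact Real.sqrt_le_sqrt h1
    have h3 : η * (8 * (B + 1)) = d * κ := by rw [hη]; field_simp
    nlinarith
  set L := max 1 (max (J * h) (4 * K * B / (d * κ) )) with hL
  have hL1 : 1 ≤ L := le_max_left _ _
  have hL2 : J * h ≤ L := (le_max_left _ _).trans (le_max_right _ _)
  have hL3 : 4 * K * B / (d * κ) ≤ L := (le_max_right _ _).trans (le_max_right _ _)
  have hL4 : K * B / L ^ 2 ≤ d * κ / 4 := by
    rw [div_le_iff₀ (by positivity)] at hL3 ⊢
    have : L * (d * κ) ≤ L ^ 2 * (d * κ) :=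
      mul_le_mul_of_nonneg_right (by nlinarith) (by positivity)
    linarith
  have hθ : ∀ᶠ p in l, 1 - ω / 4 ≤ s p * ∫ y, y ∂(ρ p) := by
    filter_upwards [hm.eventually (lt_mem_nhds (show 1 - ω / 4 < 1 by linarith))] with p hp
    exact hp.le
  have step : ∀ M T : ℝ, ε ≤ M → 0 ≤ T →
      (∀ᶠ p in l, ∀ τ, T ≤ τ → V p τ ≤ M + ∫ u in Set.Ioi 0, φ p u) →
      ∃ T' : ℝ, 0 ≤ T' ∧ ∀ᶠ p in l, ∀ τ, T' ≤ τ → V p τ ≤ (M - 2 * δ) + ∫ u in Set.Ioi 0, φ p u := by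
    intro M T hM hT hev
    refine ⟨T + L + 1 / (d * κ / 4), by positivity, ?_⟩
    filter_upwards [hev, hR, hκe, hθ] with p hp R hκp hθp τ hτ
    by_contra! hcon
    set I := ∫ u in Set.Ioi 0, φ p u with hI
    have hI0 : 0 ≤ I := R.phi_nonneg
    have hI1 : I ≤ 1 := R.phi_le
    have hpos : 0 < 1 / (d * κ / 4) := by positivity
    have hexp := exp_neg_le_of (d * κ / 4) τ (by positivity) (by linarith)
    have hfin := R.upper_step δ (M + I - δ) T L τ d κ h (ω / 4) J (Nat.succ_pos _) hδ0 hδK hL1 hT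
      hh0 hL2 (by linarith) (by intro t ht; linarith [hp t ht]) (by linarith) hκp hd0.le
      (by linarith [mul_pos hd0 hκ0]) (by linarith) hθp
    have h1 : 1 - ω / 2 ≤ Real.exp (-(2 * h)) := by
      have := Real.add_one_le_exp (-(2 * h))
      linarith
    have h2 : B / (J * h) ≤ ω / 4 := by
      rw [div_le_iff₀ (by positivity)]
      rw [div_le_iff₀ hω0] at hJh
      linarith
    have h3 : 0 ≤ M + I - δ - δ - d := by linarith
    have h4 : (1 - ω / 2) * (I + 5 * ε / 8) * (1 - ω / 2) ≤ I := by
      refine le_trans ?_ hfin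
      apply mul_le_mul _ (by linarith) (by linarith) (by positivity)
      exact mul_le_mul h1 (by linarith) (by linarith) (Real.exp_pos _).le
    have h5 : (I + 5 * ε / 8) * ω ≤ 2 * ω := mul_le_mul_of_nonneg_right (by linarith) hω0.le
    have h6 : 0 ≤ (I + 5 * ε / 8) * ω ^ 2 := by positivity
    have hωε : ω = ε / 8 := rfl
    have h7 : (1 - ω / 2) * (I + 5 * ε / 8) * (1 - ω / 2) =
      I + 5 * ε / 8 - (I + 5 * ε / 8) * ω + (I + 5 * ε / 8) * ω ^ 2 / 4 := by ring
    linarith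
  have iter : ∀ k : ℕ, ∃ T : ℝ, 0 ≤ T ∧
      ∀ᶠ p in l, ∀ τ, T ≤ τ → V p τ ≤ max ε (K - 2 * δ * k) + ∫ u in Set.Ioi 0, φ p u := by
    intro k
    induction k with
    | zero =>
      refine ⟨0, le_rfl, ?_⟩
      filter_upwards [hR] with p R τ _
      have := le_max_right ε (K - 2 * δ * (0:ℕ))
      push_cast at this ⊢
      linarith [R.VK τ, R.phi_nonneg]
    | succ k ih =>
      obtain ⟨T, hT, hev⟩ := ih
      obtain ⟨T', hT', hev'⟩ := step _ T (le_max_left _ _) hT hev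
      refine ⟨T', hT', ?_⟩
      filter_upwards [hev'] with p hp τ hτ
      refine (hp τ hτ).trans ?_
      gcongr
      rw [sub_le_iff_le_add]
      apply max_le
      · linarith [le_max_left ε (K - 2 * δ * ((k + 1 : ℕ):ℝ))]
      · have := le_max_right ε (K - 2 * δ * ((k + 1 : ℕ):ℝ))
        push_cast at this ⊢
        linarith
  obtain ⟨k, hk⟩ := exists_nat_ge (K / (2 * δ))
  obtain ⟨T, hT, hev⟩ := iter k
  refine ⟨T, hT, ?_⟩
  have : max ε (K - 2 * δ * k) = ε := by
    apply max_eq_left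
    rw [div_le_iff₀ (by positivity)] at hk
    linarith
  rwa [this] at hev

theorem ren_main {ι : Type*} (l : Filter ι) (s : ι → ℝ) (ρ : ι → Measure ℝ) (φ V : ι → ℝ → ℝ)
    (K B : ℝ) (hK : 1 ≤ K) (hB : 0 ≤ B) (hR : ∀ᶠ p in l, Ren (s p) (ρ p) (φ p) (V p) K B)
    (hκ : ∀ u v : ℝ, 0 < u → u < v → ∃ κ : ℝ, 0 < κ ∧
      ∀ᶠ p in l, κ ≤ s p * (ρ p).real (Set.Ioo u v))
    (hm : Tendsto (fun p => s p * ∫ y, y ∂(ρ p)) l (nhds 1)) (ε : ℝ) (hε : 0 < ε) (hε1 : ε ≤ 1) :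
    ∃ T : ℝ, 0 ≤ T ∧ ∀ᶠ p in l, ∀ τ, T ≤ τ → |V p τ - ∫ u in Set.Ioi 0, φ p u| ≤ ε := by
  set h := Real.log (1 + ε / 2) with hh
  have hh0 : 0 < h := Real.log_pos (by linarith)
  have hexph : Real.exp h ≤ 1 + ε / 2 := by rw [hh, Real.exp_log (by linarith)]
  obtain ⟨κ, hκ0, hκe⟩ := hκ h (2 * h) hh0 (by linarith)
  set η := ε / 2 * (h * κ) with hη
  have hη0 : 0 < η := by positivity
  set δ := min ε (η / 8) with hδ
  have hδ0 : 0 < δ := lt_min hε (by positivity)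
  have hδε : δ ≤ ε := min_le_left _ _
  have hδη : δ ≤ η / 8 := min_le_right _ _
  obtain ⟨T, hT, hev⟩ := ren_upper l s ρ φ V K B hK hB hR hκ hm δ hδ0 (by linarith)
  set L := K * B / (η / 8) + 1 with hL
  have hL0 : 0 < L := by positivity
  have hKL : K * (B / L) ≤ η / 8 := by
    rw [← mul_div_assoc, div_le_iff₀ hL0, hL]
    have : η / 8 * (K * B / (η / 8)) = K * B := by field_simp
    nlinarith
  have hθ : ∀ᶠ p in l, s p * ∫ y, y ∂(ρ p) ≤ 1 + η / 16 := by
    filter_upwards [hm.eventually (gt_mem_nhds (show 1 < 1 + η / 16 by linarith))] with p hp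
    exact hp.le
  refine ⟨T + L + h + 1 / (η / 8), by positivity, ?_⟩
  filter_upwards [hev, hR, hκe, hθ] with p hp R hκp hθp τ hτ
  have := R.prob
  set I := ∫ u in Set.Ioi 0, φ p u with hI
  have hI0 : 0 ≤ I := R.phi_nonneg
  have hI1 : I ≤ 1 := R.phi_le
  have hpos : 0 < 1 / (η / 8) := by positivity
  have hexp := exp_neg_le_of (η / 8) τ (by positivity) (by linarith)
  rw [abs_le]
  constructor
  · by_contra! hcon
    have := R.lower δ T L τ κ h (η / 16) ε I hI hδ0 hT hh0 hL0 hexph hε (by linarith) (by linarith)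
      (by intro t ht; linarith [hp t ht]) (by linarith)
      (hκp.trans (mul_le_mul_of_nonneg_left (measureReal_mono Set.Ioo_subset_Ioi_self) R.hs.le)) hθp
    nlinarith
  · linarith [hp τ (by linarith)]
theorem sumLaw_prob (ν : Measure ℝ) [IsProbabilityMeasure ν] (j : ℕ) :
    IsProbabilityMeasure (sumLaw ν j) := by
  induction j with
  | zero => unfold sumLaw; infer_instance
  | succ j ih =>
    unfold sumLaw
    exact Measure.isProbabilityMeasure_map (by fun_prop)

noncomputable def aTerm (ν : Measure ℝ) (F : ℝ → ENNReal) (j : ℕ) (t : ℝ) : ENNReal :=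
  ∫⁻ y, F (t - y) ∂(sumLaw ν j)

theorem aTerm_zero (ν : Measure ℝ) (F : ℝ → ENNReal) (hF : Measurable F) (t : ℝ) :
    aTerm ν F 0 t = F t := by
  unfold aTerm sumLaw
  rw [lintegral_dirac' _ (by fun_prop)]
  simp

theorem aTerm_succ (ν : Measure ℝ) [IsProbabilityMeasure ν] (F : ℝ → ENNReal) (hF : Measurable F)
    (j : ℕ) (t : ℝ) : aTerm ν F (j + 1) t = ∫⁻ y, aTerm ν F j (t - y) ∂ν := by
  have := sumLaw_prob ν j
  unfold aTerm
  rw [sumLaw, lintegral_map (by fun_prop) (by fun_prop), lintegral_prod_symm _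
    (Measurable.aemeasurable (by fun_prop))]
  congr 1
  ext y
  congr 1
  ext x
  congr 1
  ring

theorem aTerm_meas (ν : Measure ℝ) [IsProbabilityMeasure ν] (F : ℝ → ENNReal) (hF : Measurable F)
    (j : ℕ) : Measurable (aTerm ν F j) := by
  have := sumLaw_prob ν j
  unfold aTerm
  apply Measurable.lintegral_prod_right' (f := fun p : ℝ × ℝ => F (p.1 - p.2))
  fun_prop

theorem aTerm_le (ν : Measure ℝ) [IsProbabilityMeasure ν] (F : ℝ → ENNReal)
    (hF1 : ∀ u, F u ≤ 1) (j : ℕ) (t : ℝ) : aTerm ν F j t ≤ 1 := by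
  have := sumLaw_prob ν j
  unfold aTerm
  calc _ ≤ ∫⁻ y, 1 ∂(sumLaw ν j) := lintegral_mono fun y => hF1 _
    _ = 1 := by simp

theorem aTerm_neg (ν : Measure ℝ) [IsProbabilityMeasure ν] (hpos : ∀ᵐ y ∂ν, 0 < y)
    (F : ℝ → ENNReal) (hF : Measurable F)
    (hF0 : ∀ u, u < 0 → F u = 0) (j : ℕ) : ∀ t, t < 0 → aTerm ν F j t = 0 := by
  induction j with
  | zero => intro t ht; rw [aTerm_zero ν F hF, hF0 t ht]
  | succ j ih =>
    intro t ht
    rw [aTerm_succ ν F hF]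
    rw [lintegral_eq_zero_iff' (by
      have := aTerm_meas ν F hF j
      exact Measurable.aemeasurable (by fun_prop))]
    filter_upwards [hpos] with y hy
    exact ih _ (by linarith)

theorem aTerm_mono (ν : Measure ℝ) [IsProbabilityMeasure ν] (lam : ℝ)
    (F : ℝ → ENNReal) (hF : Measurable F)
    (hFm : ∀ u v, u ≤ v → F u ≤ ENNReal.ofReal (Real.exp (lam * (v - u))) * F v) (j : ℕ) :
    ∀ u v, u ≤ v → aTerm ν F j u ≤ ENNReal.ofReal (Real.exp (lam * (v - u))) * aTerm ν F j v := by
  intro u v huv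
  unfold aTerm
  rw [← lintegral_const_mul _ (by fun_prop)]
  apply lintegral_mono
  intro y
  have := hFm (u - y) (v - y) (by linarith)
  rwa [show v - y - (u - y) = v - u by ring] at this

theorem conv_real (ν : Measure ℝ) [IsProbabilityMeasure ν] (lam s : ℝ) (hlam : 0 < lam)
    (g : ℝ → ENNReal) (hg : Measurable g) (hfin : ∀ t, g t ≠ ⊤) (u : ℝ) :
    ∫ z, s⁻¹ * (g ((u - z) / lam)).toReal ∂(Measure.map (fun y => lam * y) ν) =
      s⁻¹ * (∫⁻ y, g (u / lam - y) ∂ν).toReal := by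
  rw [integral_map (by fun_prop) (Measurable.aestronglyMeasurable (by fun_prop)),
    integral_const_mul]
  congr 1
  rw [← integral_toReal (Measurable.aemeasurable (by fun_prop))
    (Eventually.of_forall fun y => (hfin _).lt_top)]
  congr 1
  ext y
  congr 2
  field_simp

theorem expmono_real (lam s : ℝ) (hs : 0 < s) (hlam : 0 < lam)
    (g : ℝ → ENNReal) (hfin : ∀ t, g t ≠ ⊤)
    (hgm : ∀ u v, u ≤ v → g u ≤ ENNReal.ofReal (Real.exp (lam * (v - u))) * g v) :
    Monotone fun τ => Real.exp τ * (s⁻¹ * (g (τ / lam)).toReal) := by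
  intro a b hab
  simp only
  have h := hgm (a / lam) (b / lam) (by gcongr)
  have h2 := ENNReal.toReal_mono (ENNReal.mul_ne_top ENNReal.ofReal_ne_top (hfin _)) h
  rw [ENNReal.toReal_mul, ENNReal.toReal_ofReal (Real.exp_pos _).le] at h2
  have h3 : lam * (b / lam - a / lam) = b - a := by field_simp
  rw [h3, Real.exp_sub, div_mul_eq_mul_div, le_div_iff₀ (Real.exp_pos _)] at h2
  have : 0 < s⁻¹ := inv_pos.2 hs
  nlinarith

theorem mbar_ren (ν : Measure ℝ) [IsProbabilityMeasure ν] (hpos : ∀ᵐ y ∂ν, 0 < y) (lam s κ B : ℝ)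
    (hlam : 0 < lam) (hs : 0 < s) (hκ : 0 < κ)
    (hκs : κ ≤ s * (Measure.map (fun y => lam * y) ν).real (Set.Ioi 1))
    (i1 : Integrable (fun y : ℝ => Real.sqrt y) (Measure.map (fun y => lam * y) ν))
    (i2 : Integrable (fun y : ℝ => y ^ 2) (Measure.map (fun y => lam * y) ν))
    (m1 : s * ∫ y, Real.sqrt y ∂(Measure.map (fun y => lam * y) ν) ≤ B)
    (m2 : s * ∫ y, y ^ 2 ∂(Measure.map (fun y => lam * y) ν) ≤ B)
    (χ : ℝ → ℝ) (h0 : ∀ u, 0 ≤ χ u) (hneg : ∀ u, u < 0 → χ u = 0)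
    (hmono : MonotoneOn χ (Set.Ici 0)) (h1 : ∀ u, χ u ≤ 1) :
    Ren s (Measure.map (fun y => lam * y) ν) (fun z => Real.exp (-z) * χ (z / lam))
      (fun τ => s⁻¹ * (mbarChar ν lam χ (τ / lam)).toReal) (Real.exp 1 / κ) B := by
  have hχ : Monotone χ := by
    intro a b hab
    rcases lt_or_ge a 0 with ha | ha
    · rw [hneg a ha]; exact h0 b
    · exact hmono ha (ha.trans hab) hab
  have hχm := hχ.measurable
  set ρ := Measure.map (fun y => lam * y) ν with hρ
  have hρp : IsProbabilityMeasure ρ := Measure.isProbabilityMeasure_map (by fun_prop)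
  have hρpos : ∀ᵐ y ∂ρ, 0 < y := by
    rw [hρ, ae_map_iff (by fun_prop) measurableSet_Ioi]
    filter_upwards [hpos] with y hy
    positivity
  set F : ℝ → ENNReal := fun u => ENNReal.ofReal (Real.exp (-(lam * u)) * χ u) with hF
  have hFm : Measurable F := by fun_prop
  have hFle : ∀ u, F u ≤ ENNReal.ofReal (Real.exp (-(lam * u))) := fun u =>
    ENNReal.ofReal_le_ofReal (mul_le_of_le_one_right (Real.exp_pos _).le (h1 u))
  have hFneg : ∀ u, u < 0 → F u = 0 := fun u hu => by simp [hF, hneg u hu]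
  have hF1 : ∀ u, F u ≤ 1 := by
    intro u
    rcases lt_or_ge u 0 with hu | hu
    · rw [hFneg u hu]; exact zero_le_one
    · refine (hFle u).trans ?_
      rw [ENNReal.ofReal_le_one]
      exact Real.exp_le_one_iff.2 (by nlinarith)
  have hFmono : ∀ u v, u ≤ v → F u ≤ ENNReal.ofReal (Real.exp (lam * (v - u))) * F v := by
    intro u v huv
    simp only [hF]
    rw [← ENNReal.ofReal_mul (Real.exp_pos _).le, ← mul_assoc, ← Real.exp_add,
      show lam * (v - u) + -(lam * v) = -(lam * u) by ring]
    exact ENNReal.ofReal_le_ofReal (mul_le_mul_of_nonneg_left (hχ huv) (Real.exp_pos _).le)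
  have ham := aTerm_meas ν F hFm
  have hmbar : ∀ t, mbarChar ν lam χ t = ∑' j, aTerm ν F j t := fun t => rfl
  -- partial sums
  have hGb : ∀ N t, ∑ j ∈ Finset.range N, aTerm ν F j t ≤ ENNReal.ofReal (s * (Real.exp 1 / κ)) := by
    intro N t
    set g : ℝ → ENNReal := fun t => ∑ j ∈ Finset.range N, aTerm ν F j t with hg
    have hgm : Measurable g := by
      exact Finset.measurable_fun_sum _ fun j _ => ham j
    have hgN : ∀ t, g t ≤ N := fun t => by
      calc g t ≤ ∑ j ∈ Finset.range N, 1 := Finset.sum_le_sum fun j _ => aTerm_le ν F hF1 j t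
        _ = N := by simp
    have hgfin : ∀ t, g t ≠ ⊤ := fun t => ne_top_of_le_ne_top (ENNReal.natCast_ne_top N) (hgN t)
    have key := ren_bound s hs ρ hρpos (fun τ => s⁻¹ * (g (τ / lam)).toReal) (s⁻¹ * N)
      (fun u => by positivity)
      (fun u => by
        apply mul_le_mul_of_nonneg_left _ (by positivity)
        have := ENNReal.toReal_mono (ENNReal.natCast_ne_top N) (hgN (u / lam))
        simpa using this)
      (fun u hu => by
        have : g (u / lam) = 0 := by
          simp only [hg]
          exact Finset.sum_eq_zero fun j _ =>
            aTerm_neg ν hpos F hFm hFneg j _ (div_neg_of_neg_of_pos hu hlam)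
        simp [this])
      (expmono_real lam s hs hlam g hgfin (by
        intro u v huv
        simp only [hg]
        rw [Finset.mul_sum]
        exact Finset.sum_le_sum fun j _ => aTerm_mono ν lam F hFm hFmono j u v huv))
      (by
        intro u hu
        rw [conv_real ν lam s hlam g hgm hgfin u]
        have hrec : g (u / lam) ≤ F (u / lam) + ∫⁻ y, g (u / lam - y) ∂ν := by
          calc g (u / lam) ≤ ∑ j ∈ Finset.range (N + 1), aTerm ν F j (u / lam) := by
                rw [Finset.sum_range_succ]; exact le_self_add
            _ = _ := by
                rw [Finset.sum_range_succ', aTerm_zero ν F hFm, add_comm]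
                congr 1
                simp only [hg]
                rw [lintegral_finsetSum _ fun j _ => by
                  have := ham j
                  fun_prop]
                exact Finset.sum_congr rfl fun j _ => aTerm_succ ν F hFm j _
        have hIfin : ∫⁻ y, g (u / lam - y) ∂ν ≠ ⊤ := by
          apply ne_top_of_le_ne_top (ENNReal.natCast_ne_top N)
          calc _ ≤ ∫⁻ y, N ∂ν := lintegral_mono fun y => hgN _
            _ = N := by simp
        have hFfin : F (u / lam) ≠ ⊤ := ENNReal.ofReal_ne_top
        have h2 := ENNReal.toReal_mono (ENNReal.add_ne_top.2 ⟨hFfin, hIfin⟩) hrec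
        rw [ENNReal.toReal_add hFfin hIfin] at h2
        have h3 : (F (u / lam)).toReal ≤ Real.exp (-u) := by
          have := ENNReal.toReal_mono ENNReal.ofReal_ne_top (hFle (u / lam))
          rwa [ENNReal.toReal_ofReal (Real.exp_pos _).le, mul_div_cancel₀ _ hlam.ne'] at this
        rw [div_eq_inv_mul (Real.exp (-u)) s, ← mul_add]
        exact mul_le_mul_of_nonneg_left (by linarith) (by positivity))
      κ hκ hκs (lam * t)
    rw [mul_div_cancel_left₀ _ hlam.ne', inv_mul_le_iff₀ hs] at key
    change g t ≤ _
    rw [← ENNReal.ofReal_toReal (hgfin t)]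
    exact ENNReal.ofReal_le_ofReal key
  set m : ℝ → ENNReal := fun t => mbarChar ν lam χ t with hm
  have hmb : ∀ t, m t ≤ ENNReal.ofReal (s * (Real.exp 1 / κ)) := fun t =>
    ENNReal.tsum_le_of_sum_range_le fun N => hGb N t
  have hmfin : ∀ t, m t ≠ ⊤ := fun t => ne_top_of_le_ne_top ENNReal.ofReal_ne_top (hmb t)
  have hmm : Measurable m := by
    simp only [hm, hmbar]
    exact Measurable.tsum ham
  refine ⟨hs, hρp, hρpos, by fun_prop, fun u => mul_nonneg (Real.exp_pos _).le (h0 _),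
    fun u _ => mul_le_of_le_one_right (Real.exp_pos _).le (h1 _), fun u => by positivity,
    ?_, ?_, ?_, ?_, i1, i2, m1, m2⟩
  · intro u
    rw [inv_mul_le_iff₀ hs]
    have := ENNReal.toReal_mono ENNReal.ofReal_ne_top (hmb (u / lam))
    rwa [ENNReal.toReal_ofReal (by positivity)] at this
  · intro u hu
    have : mbarChar ν lam χ (u / lam) = 0 := by
      rw [hmbar, ENNReal.tsum_eq_zero]
      exact fun j => aTerm_neg ν hpos F hFm hFneg j _ (div_neg_of_neg_of_pos hu hlam)
    simp [this]
  · apply expmono_real lam s hs hlam m hmfin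
    intro u v huv
    simp only [hm, hmbar]
    rw [← ENNReal.tsum_mul_left]
    exact ENNReal.tsum_le_tsum fun j => aTerm_mono ν lam F hFm hFmono j u v huv
  · intro u hu
    have hconv := conv_real ν lam s hlam m hmm hmfin u
    rw [← hρ] at hconv
    simp only [hm] at hconv
    rw [hconv]
    have hrec : m (u / lam) = F (u / lam) + ∫⁻ y, m (u / lam - y) ∂ν := by
      simp only [hm, hmbar]
      rw [tsum_eq_zero_add' ENNReal.summable, aTerm_zero ν F hFm, lintegral_tsum fun j => by
        have := ham j
        exact Measurable.aemeasurable (by fun_prop)]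
      congr 1
      exact tsum_congr fun j => aTerm_succ ν F hFm j _
    have hIfin : ∫⁻ y, m (u / lam - y) ∂ν ≠ ⊤ := by
      intro htop
      rw [htop] at hrec
      exact hmfin (u / lam) (by rw [hrec]; simp)
    have h2 : (m (u / lam)).toReal = _ := congrArg ENNReal.toReal hrec
    rw [ENNReal.toReal_add ENNReal.ofReal_ne_top hIfin] at h2
    have h3 : (F (u / lam)).toReal = Real.exp (-u) * χ (u / lam) := by
      simp only [hF]
      rw [ENNReal.toReal_ofReal (mul_nonneg (Real.exp_pos _).le (h0 _)),
        mul_div_cancel₀ _ hlam.ne']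
    simp only [hm] at h2
    rw [h2, h3, div_eq_inv_mul (Real.exp (-u) * χ (u / lam)) s, mul_add]

theorem mbar_scale (ν : Measure ℝ) (lam C : ℝ) (hC : 0 < C) (χ : ℝ → ℝ) (t : ℝ) :
    (mbarChar ν lam χ t).toReal = C * (mbarChar ν lam (fun u => χ u / C) t).toReal := by
  have : mbarChar ν lam χ t = ENNReal.ofReal C * mbarChar ν lam (fun u => χ u / C) t := by
    unfold mbarChar
    rw [← ENNReal.tsum_mul_left]
    congr 1
    ext j
    rw [← lintegral_const_mul' _ _ ENNReal.ofReal_ne_top]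
    congr 1
    ext y
    rw [← ENNReal.ofReal_mul hC.le]
    congr 1
    field_simp
  rw [this, ENNReal.toReal_mul, ENNReal.toReal_ofReal hC.le]

theorem mbar_zero (ν : Measure ℝ) (lam : ℝ) (χ : ℝ → ℝ) (h : ∀ u, χ u = 0) (t : ℝ) :
    (mbarChar ν lam χ t).toReal = 0 := by
  unfold mbarChar
  simp [h]

theorem pow_growth (f f' : ℝ → ℝ) (b d k : ℝ) (hb : 0 < b) (hbd : b ≤ d)
    (hpos : ∀ x, 0 < x → 0 < f x) (hd : ∀ x, 0 < x → HasDerivAt f (f' x) x)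
    (hk : ∀ x, b ≤ x → x ≤ d → k ≤ x * f' x / f x) :
    f b * (d / b) ^ k ≤ f d := by
  have hd0 : 0 < d := hb.trans_le hbd
  have hder : ∀ x, 0 < x → HasDerivAt (fun x => Real.log (f x) - k * Real.log x)
      (f' x / f x - k * x⁻¹) x := fun x hx =>
    ((hd x hx).log (hpos x hx).ne').sub ((Real.hasDerivAt_log hx.ne').const_mul k)
  have hm : MonotoneOn (fun x => Real.log (f x) - k * Real.log x) (Set.Icc b d) := by
    apply monotoneOn_of_deriv_nonneg (convex_Icc b d)
    · intro x hx
      exact (hder x (hb.trans_le hx.1)).continuousAt.continuousWithinAt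
    · intro x hx
      rw [interior_Icc] at hx
      exact (hder x (hb.trans hx.1)).differentiableAt.differentiableWithinAt
    · intro x hx
      rw [interior_Icc] at hx
      have hx0 := hb.trans hx.1
      rw [(hder x hx0).deriv]
      have h1 := hk x hx.1.le hx.2.le
      have h2 : f' x / f x = (x * f' x / f x) * x⁻¹ := by
        field_simp
      rw [h2, ← sub_mul]
      exact mul_nonneg (by linarith) (by positivity)
  have h := hm (Set.left_mem_Icc.2 hbd) (Set.right_mem_Icc.2 hbd) hbd
  simp only at h
  rw [← Real.log_le_log_iff (mul_pos (hpos b hb) (Real.rpow_pos_of_pos (div_pos hd0 hb) _)) (hpos d hd0),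
    Real.log_mul (hpos b hb).ne' (Real.rpow_pos_of_pos (div_pos hd0 hb) _).ne',
    Real.log_rpow (div_pos hd0 hb), Real.log_div hd0.ne' hb.ne']
  linarith

structure Base (ε δ s : ℝ) (f : ℝ → ℝ) : Prop where
  ε0 : 0 < ε
  ε1 : ε ≤ 1
  δ0 : 0 < δ
  δ1 : δ < 1
  s1 : 1 ≤ s
  pos : ∀ x, 0 < x → 0 < f x
  cont : ContinuousOn f (Set.Ioi 0)
  mono : MonotoneOn f (Set.Ioi 0)
  b1 : ∀ x, 1 - δ ≤ x → x ≤ 1 → f x ≤ f 1 * x ^ (ε * s)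
  b2 : ∀ x, 1 ≤ x → f 1 * x ^ (ε * s) ≤ f x

theorem exp_rpow_bound (r : ℝ) (hr : 0 < r) :
    ∃ K : ℝ, 0 < K ∧ ∀ w : ℝ, 0 < w → w ^ r * Real.exp (-(w / 2)) ≤ K := by
  refine ⟨Real.exp (r * (Real.log (2 * r) - 1)), Real.exp_pos _, fun w hw => ?_⟩
  rw [Real.rpow_def_of_pos hw, ← Real.exp_add]
  apply Real.exp_le_exp.2
  have h := Real.log_le_sub_one_of_pos (show 0 < w / (2 * r) by positivity)
  rw [Real.log_div hw.ne' (by positivity)] at h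
  have h2 : Real.log w ≤ w / (2 * r) - 1 + Real.log (2 * r) := by linarith
  have h3 := mul_le_mul_of_nonneg_left h2 hr.le
  have h4 : r * (w / (2 * r)) = w / 2 := by field_simp
  nlinarith

theorem exp_rpow_bound2 (r : ℝ) (hr : 0 < r) :
    ∃ K : ℝ, 0 < K ∧ ∀ w : ℝ, 0 < w → Real.exp (-(w / 2)) ≤ K * w ^ (-r) ∧
      √w * Real.exp (-(w / 2)) ≤ K * w ^ (-r) := by
  obtain ⟨K1, h1, H1⟩ := exp_rpow_bound r hr
  obtain ⟨K2, h2, H2⟩ := exp_rpow_bound (r + 1 / 2) (by positivity)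
  refine ⟨max K1 K2, by positivity, fun w hw => ?_⟩
  have hp : 0 < w ^ r := Real.rpow_pos_of_pos hw _
  rw [Real.rpow_neg hw.le, ← div_eq_mul_inv, le_div_iff₀ hp, le_div_iff₀ hp]
  constructor
  · rw [mul_comm]
    exact (H1 w hw).trans (le_max_left _ _)
  · refine le_trans (le_of_eq ?_) ((H2 w hw).trans (le_max_right _ _))
    rw [Real.rpow_add hw, ← Real.sqrt_eq_rpow]
    ring

theorem W_bounds (ε cm cp : ℝ) (hε : 0 < ε) (hcm : 0 < cm) (hcp : 0 < cp) :
    ∃ K : ℝ, 0 < K ∧ ∀ (δ s : ℝ) (f : ℝ → ℝ) (lam : ℝ), Base ε δ s f → 0 < lam →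
      cm ≤ lam * f 1 → lam * f 1 ≤ cp →
      (∀ x, 0 < x → x ≤ 1 - δ →
        √(lam * f x) * Real.exp (-(lam * f x / 2)) ≤ K * (1 - δ) ^ (ε * s / 2)) ∧
      (∀ x, 1 - δ ≤ x → x ≤ 1 →
        √(lam * f x) * Real.exp (-(lam * f x / 2)) ≤ K * x ^ (ε * s / 2)) ∧
      (∀ x, 1 ≤ x →
        √(lam * f x) * Real.exp (-(lam * f x / 2)) ≤ K * x ^ (-2 * s)) := by
  obtain ⟨K0, hK0, H⟩ := exp_rpow_bound2 (2 / ε) (by positivity)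
  refine ⟨max (√cp) (K0 * cm ^ (-(2 / ε))), lt_max_of_lt_left (by positivity), ?_⟩
  intro δ s f lam hb hl h1 h2
  have key : ∀ x, 1 - δ ≤ x → x ≤ 1 → ∀ y, 0 < y → y ≤ x →
      √(lam * f y) * Real.exp (-(lam * f y / 2)) ≤
        max (√cp) (K0 * cm ^ (-(2 / ε))) * x ^ (ε * s / 2) := by
    intro x hx hx1 y hy hyx
    have hx0 : 0 < x := by linarith [hb.δ1]
    have hfy : f y ≤ f x := hb.mono hy hx0 hyx
    have hfx := hb.b1 x hx hx1
    have hpx : 0 < x ^ (ε * s) := Real.rpow_pos_of_pos hx0 _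
    have e1 : lam * f y ≤ cp * x ^ (ε * s) := by
      calc lam * f y ≤ lam * (f 1 * x ^ (ε * s)) := by gcongr; linarith
        _ = lam * f 1 * x ^ (ε * s) := by ring
        _ ≤ _ := by gcongr
    have e2 : √(lam * f y) ≤ √cp * x ^ (ε * s / 2) := by
      refine (Real.sqrt_le_sqrt e1).trans (le_of_eq ?_)
      rw [Real.sqrt_mul hcp.le, Real.sqrt_eq_rpow (x ^ (ε * s)), ← Real.rpow_mul hx0.le]
      congr 2
      ring
    have hfy0 := hb.pos y hy
    have e3 : Real.exp (-(lam * f y / 2)) ≤ 1 := by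
      rw [Real.exp_le_one_iff]
      have : 0 < lam * f y := by positivity
      linarith
    calc _ ≤ √(lam * f y) * 1 := by gcongr
      _ ≤ √cp * x ^ (ε * s / 2) := by rw [mul_one]; exact e2
      _ ≤ _ := by
        gcongr
        exact le_max_left _ _
  refine ⟨fun x hx hx1 => key (1 - δ) le_rfl (by linarith [hb.δ0]) x hx hx1,
    fun x hx hx1 => key x hx hx1 x (by linarith [hb.δ1]) le_rfl, fun x hx => ?_⟩
  have hx0 : 0 < x := by linarith
  have hfx := hb.b2 x hx
  have hf1 := hb.pos 1 one_pos
  have hfx0 := hb.pos x hx0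
  have hpx : 0 < x ^ (ε * s) := Real.rpow_pos_of_pos hx0 _
  have e1 : cm * x ^ (ε * s) ≤ lam * f x := by
    calc _ ≤ lam * f 1 * x ^ (ε * s) := by gcongr
      _ = lam * (f 1 * x ^ (ε * s)) := by ring
      _ ≤ _ := by gcongr
  calc _ ≤ K0 * (lam * f x) ^ (-(2 / ε)) := (H _ (by positivity)).2
    _ ≤ K0 * (cm * x ^ (ε * s)) ^ (-(2 / ε)) := by
      apply mul_le_mul_of_nonneg_left _ hK0.le
      apply Real.rpow_le_rpow_of_nonpos (by positivity) e1
      have : 0 < 2 / ε := by positivity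
      linarith
    _ = K0 * cm ^ (-(2 / ε)) * x ^ (-2 * s) := by
      rw [Real.mul_rpow hcm.le hpx.le, ← Real.rpow_mul hx0.le,
        show ε * s * -(2 / ε) = -2 * s by field_simp]
      ring
    _ ≤ _ := by
      gcongr
      exact le_max_right _ _

theorem int_pow_Ioi (s : ℝ) (hs : 1 ≤ s) :
    IntegrableOn (fun x : ℝ => x ^ (-2 * s)) (Set.Ioi 1) ∧
      s * ∫ x in Set.Ioi (1:ℝ), x ^ (-2 * s) ≤ 1 := by
  refine ⟨integrableOn_Ioi_rpow_of_lt (by linarith) one_pos, ?_⟩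
  rw [integral_Ioi_rpow_of_lt (by linarith) one_pos, Real.one_rpow]
  have : -1 / (-2 * s + 1) = 1 / (2 * s - 1) := by
    rw [div_eq_div_iff] <;> linarith
  rw [this, mul_one_div, div_le_one] <;> linarith

theorem int_pow_Ioc (k s : ℝ) (hk : 0 < k) (hs : 0 < s) :
    IntegrableOn (fun x : ℝ => x ^ (k * s)) (Set.Ioc 0 1) ∧
      s * ∫ x in Set.Ioc (0:ℝ) 1, x ^ (k * s) ≤ 1 / k := by
  have hks : 0 < k * s := by positivity
  constructor
  · rw [← intervalIntegrable_iff_integrableOn_Ioc_of_le zero_le_one]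
    exact intervalIntegral.intervalIntegrable_rpow' (by linarith)
  · rw [← intervalIntegral.integral_of_le zero_le_one, integral_rpow (Or.inl (by linarith)),
      Real.one_rpow, Real.zero_rpow (by linarith), sub_zero, mul_one_div,
      div_le_div_iff₀ (by linarith) hk]
    linarith

theorem Base.aem {ε δ s : ℝ} {f : ℝ → ℝ} (hb : Base ε δ s f) :
    AEMeasurable f (volume.restrict (Set.Ioi 0)) :=
  hb.cont.aemeasurable measurableSet_Ioi

theorem W_int (ε cm cp : ℝ) (hε : 0 < ε) (hcm : 0 < cm) (hcp : 0 < cp) :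
    ∃ B : ℝ, 0 < B ∧ ∀ (δ s : ℝ) (f : ℝ → ℝ) (lam : ℝ), Base ε δ s f → 0 < lam →
      cm ≤ lam * f 1 → lam * f 1 ≤ cp → s * (1 - δ) ^ (ε * s / 2) ≤ 1 →
      IntegrableOn (fun x => √(lam * f x) * Real.exp (-(lam * f x / 2))) (Set.Ioi 0) ∧
      s * ∫ x in Set.Ioi (0:ℝ), √(lam * f x) * Real.exp (-(lam * f x / 2)) ≤ B := by
  obtain ⟨K, hK, H⟩ := W_bounds ε cm cp hε hcm hcp
  refine ⟨K * (1 + 1 / (ε / 2) + 1), by positivity, ?_⟩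
  intro δ s f lam hb hl h1 h2 h3
  obtain ⟨H1, H2, H3⟩ := H δ s f lam hb hl h1 h2
  have hs0 : 0 < s := by linarith [hb.s1]
  have hmeas : AEMeasurable (fun x => √(lam * f x) * Real.exp (-(lam * f x / 2)))
      (volume.restrict (Set.Ioi 0)) := by
    have := hb.aem
    fun_prop
  obtain ⟨I1, J1⟩ := int_pow_Ioc (ε / 2) s (by positivity) hs0
  obtain ⟨I2, J2⟩ := int_pow_Ioi s hb.s1
  have hδ : 0 < 1 - δ := by linarith [hb.δ1]
  have hcst : IntegrableOn (fun _ : ℝ => (1 - δ) ^ (ε * s / 2)) (Set.Ioc (0:ℝ) 1) := by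
    simp [integrableOn_const_iff]
  have I1' : IntegrableOn (fun x : ℝ => K * ((1 - δ) ^ (ε * s / 2) + x ^ (ε / 2 * s)))
      (Set.Ioc 0 1) := (hcst.add I1).const_mul K
  have I2' : IntegrableOn (fun x : ℝ => K * x ^ (-2 * s)) (Set.Ioi 1) := I2.const_mul K
  have hle1 : ∀ x ∈ Set.Ioc (0:ℝ) 1, √(lam * f x) * Real.exp (-(lam * f x / 2)) ≤
      K * ((1 - δ) ^ (ε * s / 2) + x ^ (ε / 2 * s)) := by
    intro x hx
    have e0 : 0 ≤ (1 - δ) ^ (ε * s / 2) := Real.rpow_nonneg hδ.le _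
    have e1 : 0 ≤ x ^ (ε / 2 * s) := Real.rpow_nonneg hx.1.le _
    rcases le_total x (1 - δ) with h | h
    · refine (H1 x hx.1 h).trans ?_
      gcongr
      linarith
    · refine (H2 x h hx.2).trans ?_
      rw [show ε * s / 2 = ε / 2 * s by ring] at e0 ⊢
      gcongr
      linarith
  have hsub1 : Set.Ioc (0:ℝ) 1 ⊆ Set.Ioi 0 := fun x hx => hx.1
  have hsub2 : Set.Ioi (1:ℝ) ⊆ Set.Ioi 0 := Set.Ioi_subset_Ioi zero_le_one
  have F1 : IntegrableOn (fun x => √(lam * f x) * Real.exp (-(lam * f x / 2)))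
      (Set.Ioc 0 1) := by
    refine Integrable.mono' I1' (hmeas.mono_measure (Measure.restrict_mono hsub1 le_rfl)).aestronglyMeasurable ?_
    refine (ae_restrict_iff' measurableSet_Ioc).2 (ae_of_all _ fun x hx => ?_)
    rw [Real.norm_of_nonneg (by positivity)]
    exact hle1 x hx
  have F2 : IntegrableOn (fun x => √(lam * f x) * Real.exp (-(lam * f x / 2)))
      (Set.Ioi 1) := by
    refine Integrable.mono' I2' (hmeas.mono_measure (Measure.restrict_mono hsub2 le_rfl)).aestronglyMeasurable ?_
    refine (ae_restrict_iff' measurableSet_Ioi).2 (ae_of_all _ fun x hx => ?_)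
    rw [Real.norm_of_nonneg (by positivity)]
    exact H3 x (le_of_lt hx)
  have hU : Set.Ioc (0:ℝ) 1 ∪ Set.Ioi 1 = Set.Ioi 0 := Set.Ioc_union_Ioi_eq_Ioi zero_le_one
  constructor
  · rw [← hU]
    exact F1.union F2
  · rw [← hU, setIntegral_union Set.Ioc_disjoint_Ioi_same measurableSet_Ioi F1 F2, mul_add]
    have g1 := setIntegral_mono_on F1 I1' measurableSet_Ioc hle1
    have g2 := setIntegral_mono_on F2 I2' measurableSet_Ioi fun x hx => H3 x (le_of_lt hx)
    rw [integral_const_mul, integral_add hcst I1] at g1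
    rw [integral_const_mul] at g2
    simp only [integral_const, MeasurableSet.univ, measureReal_restrict_apply, Set.univ_inter,
      Real.volume_real_Ioc, sub_zero, smul_eq_mul, max_eq_left zero_le_one, one_mul] at g1
    have k1 := mul_le_mul_of_nonneg_left g1 hs0.le
    have k2 := mul_le_mul_of_nonneg_left g2 hs0.le
    have k3 := mul_le_mul_of_nonneg_left J1 hK.le
    have k4 := mul_le_mul_of_nonneg_left J2 hK.le
    have k5 := mul_le_mul_of_nonneg_left h3 hK.le
    linarith

theorem tail_tendsto {ι : Type*} (l : Filter ι) (s : ι → ℝ) (hs : Tendsto s l atTop)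
    (ε δ : ℝ) (hε : 0 < ε) (hδ0 : 0 < δ) (hδ1 : δ < 1) :
    Tendsto (fun p => s p * (1 - δ) ^ (ε * s p / 2)) l (nhds 0) := by
  have hk : 0 < -Real.log (1 - δ) * ε / 2 := by
    have := Real.log_neg (show 0 < 1 - δ by linarith) (by linarith)
    have : 0 < -Real.log (1 - δ) := by linarith
    positivity
  have h := (tendsto_rpow_mul_exp_neg_mul_atTop_nhds_zero 1 _ hk).comp hs
  refine h.congr fun p => ?_
  simp only [Function.comp, Real.rpow_one]
  rw [Real.rpow_def_of_pos (by linarith)]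
  congr 2
  ring

theorem setint_le_const (g : ℝ → ℝ) (a b C : ℝ) (hab : a ≤ b) (hg : IntegrableOn g (Set.Ioc a b))
    (h : ∀ x ∈ Set.Ioc a b, g x ≤ C) : ∫ x in Set.Ioc a b, g x ≤ C * (b - a) := by
  have hc : IntegrableOn (fun _ : ℝ => C) (Set.Ioc a b) := by simp [integrableOn_const_iff]
  have := setIntegral_mono_on hg hc measurableSet_Ioc h
  simpa [Real.volume_real_Ioc, max_eq_left (sub_nonneg.2 hab), mul_comm] using this

theorem setint_ge_const (g : ℝ → ℝ) (a b C : ℝ) (hab : a ≤ b) (hg : IntegrableOn g (Set.Ioc a b))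
    (h : ∀ x ∈ Set.Ioc a b, C ≤ g x) : C * (b - a) ≤ ∫ x in Set.Ioc a b, g x := by
  have hc : IntegrableOn (fun _ : ℝ => C) (Set.Ioc a b) := by simp [integrableOn_const_iff]
  have := setIntegral_mono_on hc hg measurableSet_Ioc h
  simpa [Real.volume_real_Ioc, max_eq_left (sub_nonneg.2 hab), mul_comm] using this

theorem exp_int_of_eq {f : ℝ → ℝ} {lam α : ℝ}
    (h : α * ∫ x in Set.Ioi (0:ℝ), Real.exp (-(lam * f x)) = 1) :
    IntegrableOn (fun x => Real.exp (-(lam * f x))) (Set.Ioi 0) := by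
  by_contra hc
  rw [integral_undef hc] at h
  simp at h

theorem c_upper (ε : ℝ) (hε : 0 < ε) : ∃ C1 : ℝ, 0 < C1 ∧
    ∀ (δ s : ℝ) (f : ℝ → ℝ) (lam α Λ ℓ : ℝ), Base ε δ s f → 0 < lam → 0 < α →
      α * ∫ x in Set.Ioi (0:ℝ), Real.exp (-(lam * f x)) = 1 →
      |s * (1 / α - 1)| ≤ 2 * Λ → 0 < ℓ → ℓ ≤ s →
      f 1 * (Real.exp (-ℓ) / 2) ≤ f (Real.exp (-(ℓ / s))) →
      4 * (C1 + 2 * Λ) < ℓ → lam * f 1 ≤ 2 * Real.exp ℓ := by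
  obtain ⟨K0, hK0, H⟩ := exp_rpow_bound2 (2 / ε) (by positivity)
  refine ⟨K0, hK0, ?_⟩
  intro δ s f lam α Λ ℓ hb hl hα heq hΛ hℓ hℓs hf hC
  by_contra hcon
  push Not at hcon
  have hI := exp_int_of_eq heq
  have hs0 : 0 < s := by linarith [hb.s1]
  set x0 := Real.exp (-(ℓ / s)) with hx0
  have hx00 : 0 < x0 := Real.exp_pos _
  have ht : 0 < ℓ / s := by positivity
  have ht1 : ℓ / s ≤ 1 := by rw [div_le_one hs0]; exact hℓs
  have hx01 : x0 ≤ 1 - ℓ / s / 2 := by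
    have h2 := Real.add_one_le_exp (ℓ / s)
    rw [hx0, Real.exp_neg, ← one_div, div_le_iff₀ (Real.exp_pos _)]
    nlinarith
  have hx02 : x0 ≤ 1 := by linarith
  have hU1 : Set.Ioc 0 x0 ∪ Set.Ioc x0 1 = Set.Ioc (0:ℝ) 1 :=
    Set.Ioc_union_Ioc_eq_Ioc hx00.le hx02
  have hU : Set.Ioc (0:ℝ) 1 ∪ Set.Ioi 1 = Set.Ioi 0 := Set.Ioc_union_Ioi_eq_Ioi zero_le_one
  have J1 : IntegrableOn (fun x => Real.exp (-(lam * f x))) (Set.Ioc 0 x0) :=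
    hI.mono_set fun x hx => hx.1
  have J2 : IntegrableOn (fun x => Real.exp (-(lam * f x))) (Set.Ioc x0 1) :=
    hI.mono_set fun x hx => hx00.trans hx.1
  have J3 : IntegrableOn (fun x => Real.exp (-(lam * f x))) (Set.Ioi 1) :=
    hI.mono_set (Set.Ioi_subset_Ioi zero_le_one)
  have hf1 := hb.pos 1 one_pos
  have hℓ2 : 1 ≤ Real.exp ℓ := Real.one_le_exp hℓ.le
  have b1 : ∫ x in Set.Ioc 0 x0, Real.exp (-(lam * f x)) ≤ 1 * (x0 - 0) := by
    apply setint_le_const _ _ _ _ hx00.le J1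
    intro x hx
    rw [Real.exp_le_one_iff]
    have := mul_pos hl (hb.pos x hx.1)
    linarith
  have b2 : ∫ x in Set.Ioc x0 1, Real.exp (-(lam * f x)) ≤ 1 / 2 * (1 - x0) := by
    apply setint_le_const _ _ _ _ hx02 J2
    intro x hx
    have h1 : f x0 ≤ f x := hb.mono hx00 (hx00.trans hx.1) hx.1.le
    have h2 : 1 ≤ lam * f x := by
      calc 1 = 2 * Real.exp ℓ * (Real.exp (-ℓ) / 2) := by
            rw [Real.exp_neg]; field_simp
        _ ≤ lam * f 1 * (Real.exp (-ℓ) / 2) := by gcongr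
        _ = lam * (f 1 * (Real.exp (-ℓ) / 2)) := by ring
        _ ≤ lam * f x := by gcongr; linarith
    calc Real.exp (-(lam * f x)) ≤ Real.exp (-1) := by
          apply Real.exp_le_exp.2; linarith
      _ ≤ 1 / 2 := by
        rw [Real.exp_neg, ← one_div]
        apply one_div_le_one_div_of_le (by norm_num)
        linarith [Real.add_one_le_exp (1:ℝ)]
  obtain ⟨I2, JJ2⟩ := int_pow_Ioi s hb.s1
  have b3 : s * ∫ x in Set.Ioi (1:ℝ), Real.exp (-(lam * f x)) ≤ K0 := by
    have g2 := setIntegral_mono_on J3 (I2.const_mul K0) measurableSet_Ioi fun x hx => by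
      have hx1 : 1 < x := hx
      have hx0 : 0 < x := by linarith
      have hpx : 0 < x ^ (ε * s) := Real.rpow_pos_of_pos hx0 _
      have e1 : x ^ (ε * s) ≤ lam * f x := by
        calc _ ≤ lam * f 1 * x ^ (ε * s) := by
              apply le_mul_of_one_le_left hpx.le; linarith
          _ = lam * (f 1 * x ^ (ε * s)) := by ring
          _ ≤ _ := by gcongr; exact hb.b2 x hx1.le
      have hw : 0 < lam * f x := hpx.trans_le e1
      show Real.exp (-(lam * f x)) ≤ K0 * x ^ (-2 * s)
      calc _ ≤ Real.exp (-(lam * f x / 2)) := by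
            apply Real.exp_le_exp.2; linarith
        _ ≤ K0 * (lam * f x) ^ (-(2 / ε)) := (H _ hw).1
        _ ≤ K0 * (x ^ (ε * s)) ^ (-(2 / ε)) := by
          apply mul_le_mul_of_nonneg_left _ hK0.le
          apply Real.rpow_le_rpow_of_nonpos (by positivity) e1
          have : 0 < 2 / ε := by positivity
          linarith
        _ = K0 * x ^ (-2 * s) := by
          rw [← Real.rpow_mul hx0.le, show ε * s * -(2 / ε) = -2 * s by field_simp]
    rw [integral_const_mul] at g2
    have k2 := mul_le_mul_of_nonneg_left g2 hs0.le
    have k4 := mul_le_mul_of_nonneg_left JJ2 hK0.le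
    linarith
  have htot : 1 / α = (∫ x in Set.Ioc 0 x0, Real.exp (-(lam * f x))) +
      (∫ x in Set.Ioc x0 1, Real.exp (-(lam * f x))) +
      ∫ x in Set.Ioi (1:ℝ), Real.exp (-(lam * f x)) := by
    rw [← setIntegral_union (Set.Ioc_disjoint_Ioc_of_le le_rfl) measurableSet_Ioc J1 J2, hU1,
      ← setIntegral_union Set.Ioc_disjoint_Ioi_same measurableSet_Ioi _ J3, hU]
    · rw [div_eq_iff hα.ne']
      linarith
    · rw [← hU1]; exact J1.union J2
  have hlow := (abs_le.1 hΛ).1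
  rw [htot] at hlow
  have k : s * (ℓ / s) = ℓ := by field_simp
  have b12 : (∫ x in Set.Ioc 0 x0, Real.exp (-(lam * f x))) +
      (∫ x in Set.Ioc x0 1, Real.exp (-(lam * f x))) - 1 ≤ - (ℓ / s / 4) := by linarith
  have b12' := mul_le_mul_of_nonneg_left b12 hs0.le
  nlinarith

theorem c_lower (ε δ s : ℝ) (f : ℝ → ℝ) (lam α Λ L : ℝ) (hb : Base ε δ s f) (hl : 0 < lam)
    (hα : 0 < α) (heq : α * ∫ x in Set.Ioi (0:ℝ), Real.exp (-(lam * f x)) = 1)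
    (hΛ : |s * (1 / α - 1)| ≤ 2 * Λ) (hL0 : 0 ≤ L)
    (hf : f (Real.exp (L / s)) ≤ f 1 * (2 * Real.exp L))
    (htail : s * (1 - δ) ^ (ε * s / 2) ≤ 1)
    (hL : Real.exp 1 * (2 * Λ + 1 + 1 / ε) < L) : Real.exp (-L) / 2 ≤ lam * f 1 := by
  by_contra hcon
  push Not at hcon
  have hI := exp_int_of_eq heq
  have hs0 : 0 < s := by linarith [hb.s1]
  have hε := hb.ε0
  have hf1 := hb.pos 1 one_pos
  set x0 := Real.exp (L / s) with hx0
  have hx01 : 1 + L / s ≤ x0 := by linarith [Real.add_one_le_exp (L / s)]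
  have hLs : 0 ≤ L / s := by positivity
  have hU1 : Set.Ioc 1 x0 ∪ Set.Ioi x0 = Set.Ioi (1:ℝ) :=
    Set.Ioc_union_Ioi_eq_Ioi (by linarith)
  have hU : Set.Ioc (0:ℝ) 1 ∪ Set.Ioi 1 = Set.Ioi 0 := Set.Ioc_union_Ioi_eq_Ioi zero_le_one
  have J1 : IntegrableOn (fun x => Real.exp (-(lam * f x))) (Set.Ioc 0 1) :=
    hI.mono_set fun x hx => hx.1
  have J2 : IntegrableOn (fun x => Real.exp (-(lam * f x))) (Set.Ioc 1 x0) :=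
    hI.mono_set fun x hx => one_pos.trans hx.1
  have J3 : IntegrableOn (fun x => Real.exp (-(lam * f x))) (Set.Ioi 1) :=
    hI.mono_set (Set.Ioi_subset_Ioi zero_le_one)
  have b2 : Real.exp (-1) * (x0 - 1) ≤ ∫ x in Set.Ioi 1, Real.exp (-(lam * f x)) := by
    refine (setint_ge_const _ 1 x0 _ (by linarith) J2 fun x hx => ?_).trans
      (setIntegral_mono_set J3 (ae_of_all _ fun x => (Real.exp_pos _).le)
        (ae_of_all _ fun x hx => hx.1))
    apply Real.exp_le_exp.2
    have hx1 : 0 < x := one_pos.trans hx.1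
    have h1 : f x ≤ f x0 := hb.mono hx1 (hx1.trans_le hx.2) hx.2
    have h2 : lam * f x ≤ 1 := by
      calc lam * f x ≤ lam * (f 1 * (2 * Real.exp L)) := by gcongr; linarith
        _ = lam * f 1 * (2 * Real.exp L) := by ring
        _ ≤ Real.exp (-L) / 2 * (2 * Real.exp L) := by gcongr
        _ = 1 := by rw [Real.exp_neg]; field_simp
    linarith
  obtain ⟨I1, K1⟩ := int_pow_Ioc ε s hε hs0
  have hδ : 0 < 1 - δ := by linarith [hb.δ1]
  have hcst : IntegrableOn (fun _ : ℝ => (1 - δ) ^ (ε * s)) (Set.Ioc (0:ℝ) 1) := by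
    simp [integrableOn_const_iff]
  have hone : IntegrableOn (fun _ : ℝ => (1:ℝ)) (Set.Ioc (0:ℝ) 1) := by
    simp [integrableOn_const_iff]
  have b1 : ∫ x in Set.Ioc (0:ℝ) 1, (1 - Real.exp (-(lam * f x))) ≤
      ∫ x in Set.Ioc (0:ℝ) 1, lam * f 1 * ((1 - δ) ^ (ε * s) + x ^ (ε * s)) := by
    apply setIntegral_mono_on (hone.sub J1) ((hcst.add I1).const_mul _) measurableSet_Ioc
    intro x hx
    have e0 : 0 ≤ (1 - δ) ^ (ε * s) := Real.rpow_nonneg hδ.le _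
    have e1 : 0 ≤ x ^ (ε * s) := Real.rpow_nonneg hx.1.le _
    have hfx : f x ≤ f 1 * ((1 - δ) ^ (ε * s) + x ^ (ε * s)) := by
      rcases le_total x (1 - δ) with h | h
      · have h1 : f x ≤ f (1 - δ) := hb.mono hx.1 hδ h
        have h2 := hb.b1 (1 - δ) le_rfl (by linarith [hb.δ0])
        nlinarith
      · have h2 := hb.b1 x h hx.2
        nlinarith
    have h3 := Real.add_one_le_exp (-(lam * f x))
    show 1 - Real.exp (-(lam * f x)) ≤ lam * f 1 * ((1 - δ) ^ (ε * s) + x ^ (ε * s))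
    nlinarith
  rw [integral_const_mul, integral_add hcst I1, integral_sub hone J1] at b1
  simp only [integral_const, MeasurableSet.univ, measureReal_restrict_apply, Set.univ_inter,
      Real.volume_real_Ioc, sub_zero, smul_eq_mul, max_eq_left zero_le_one, one_mul] at b1
  have htot : 1 / α = (∫ x in Set.Ioc 0 1, Real.exp (-(lam * f x))) +
      ∫ x in Set.Ioi (1:ℝ), Real.exp (-(lam * f x)) := by
    rw [← setIntegral_union Set.Ioc_disjoint_Ioi_same measurableSet_Ioi J1 J3, hU]
    rw [div_eq_iff hα.ne']
    linarith
  have hup := (abs_le.1 hΛ).2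
  rw [htot] at hup
  have htail' : s * (1 - δ) ^ (ε * s) ≤ 1 := by
    refine le_trans ?_ htail
    gcongr 1
    apply Real.rpow_le_rpow_of_exponent_ge hδ (by linarith [hb.δ0])
    have : 0 < ε * s := by positivity
    linarith
  have hc1 : lam * f 1 ≤ 1 := by
    have : Real.exp (-L) ≤ 1 := by rw [Real.exp_le_one_iff]; linarith
    linarith
  have hc0 : 0 < lam * f 1 := by positivity
  have k1 : s * (lam * f 1 * ((1 - δ) ^ (ε * s) + ∫ x in Set.Ioc (0:ℝ) 1, x ^ (ε * s))) ≤
      1 + 1 / ε := by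
    have : s * (lam * f 1 * ((1 - δ) ^ (ε * s) + ∫ x in Set.Ioc (0:ℝ) 1, x ^ (ε * s))) =
        lam * f 1 * (s * (1 - δ) ^ (ε * s) + s * ∫ x in Set.Ioc (0:ℝ) 1, x ^ (ε * s)) := by ring
    rw [this]
    have h1 : 0 ≤ 1 + 1 / ε := by positivity
    calc _ ≤ lam * f 1 * (1 + 1 / ε) := by gcongr
      _ ≤ 1 * (1 + 1 / ε) := by gcongr
      _ = _ := one_mul _
  have k2 := mul_le_mul_of_nonneg_left b1 hs0.le
  have k3 : s * (Real.exp (-1) * (L / s)) ≤ s * ∫ x in Set.Ioi 1, Real.exp (-(lam * f x)) := by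
    apply mul_le_mul_of_nonneg_left _ hs0.le
    refine le_trans ?_ b2
    gcongr
    linarith
  have k4 : s * (Real.exp (-1) * (L / s)) = L / Real.exp 1 := by
    rw [Real.exp_neg]
    field_simp
  rw [k4] at k3
  have k5 : L / Real.exp 1 ≤ 2 * Λ + 1 + 1 / ε := by nlinarith
  rw [div_le_iff₀ (Real.exp_pos 1)] at k5
  linarith

theorem W_le_one (w : ℝ) : √w * Real.exp (-(w / 2)) ≤ 1 := by
  have h : √w ≤ Real.exp (w / 2) := by
    rw [Real.sqrt_le_left (Real.exp_pos _).le, ← Real.exp_nat_mul]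
    have := Real.add_one_le_exp w
    have e : ((2:ℕ):ℝ) * (w / 2) = w := by push_cast; ring
    rw [e]
    linarith
  rw [Real.exp_neg, ← div_eq_mul_inv, div_le_one (Real.exp_pos _)]
  exact h

theorem base_id (ε δ : ℝ) (hε : 0 < ε) (hε1 : ε ≤ 1) (h0 : 0 < δ) (h1 : δ < 1) :
    Base ε δ 1 (fun x => x) := by
  refine ⟨hε, hε1, h0, h1, le_rfl, fun x hx => hx, continuousOn_id, monotoneOn_id, ?_, ?_⟩
  · intro x hx hx1
    rw [one_mul, mul_one]
    have := Real.rpow_le_rpow_of_exponent_ge (show 0 < x by linarith) hx1 hε1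
    simpa using this
  · intro x hx
    rw [one_mul, mul_one]
    have := Real.rpow_le_rpow_of_exponent_le hx hε1
    simpa using this

noncomputable def bnd (ε y : ℝ) : ℝ := if y ≤ 1 then y ^ (ε / 2 - 1) else y ^ (-2 : ℝ)

theorem bnd_int (ε : ℝ) (hε : 0 < ε) : IntegrableOn (bnd ε) (Set.Ioi 0) := by
  rw [← Set.Ioc_union_Ioi_eq_Ioi (zero_le_one (α := ℝ))]
  apply IntegrableOn.union
  · have : IntegrableOn (fun y : ℝ => y ^ (ε / 2 - 1)) (Set.Ioc 0 1) := by
      rw [← intervalIntegrable_iff_integrableOn_Ioc_of_le zero_le_one]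
      exact intervalIntegral.intervalIntegrable_rpow' (by linarith)
    refine this.congr_fun (fun y hy => ?_) measurableSet_Ioc
    simp [bnd, hy.2]
  · have : IntegrableOn (fun y : ℝ => y ^ (-2 : ℝ)) (Set.Ioi 1) :=
      integrableOn_Ioi_rpow_of_lt (by norm_num) one_pos
    refine this.congr_fun (fun y hy => ?_) measurableSet_Ioi
    have : ¬ y ≤ 1 := not_le.2 hy
    simp [bnd, this]

/-- the two pointwise dominations -/
theorem dom_bounds (ε cm cp : ℝ) (hε : 0 < ε) (hε1 : ε ≤ 1) (hcm : 0 < cm) (hcp : 0 < cp) :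
    ∃ K : ℝ, 0 < K ∧ ∀ (δ s : ℝ) (f : ℝ → ℝ) (lam : ℝ), Base ε δ s f → 0 < lam →
      cm ≤ lam * f 1 → lam * f 1 ≤ cp →
      (∀ x, 0 < x → x ≤ 1 - δ →
        √(lam * f x) * Real.exp (-(lam * f x / 2)) ≤ K * (1 - δ) ^ (ε * s / 2)) ∧
      (∀ y, 0 < y → 1 - δ < y ^ (1 / s) → y ^ (1 / s - 1) *
        (√(lam * f (y ^ (1 / s))) * Real.exp (-(lam * f (y ^ (1 / s)) / 2))) ≤ K * bnd ε y) ∧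
      (∀ y, 0 < y → (√(lam * f 1 * y) * Real.exp (-(lam * f 1 * y / 2))) / y ≤ K * bnd ε y) := by
  obtain ⟨K, hK, H⟩ := W_bounds ε cm cp hε hcm hcp
  refine ⟨K, hK, ?_⟩
  intro δ s f lam hb hl h1 h2
  obtain ⟨H1, H2, H3⟩ := H δ s f lam hb hl h1 h2
  have hs0 : 0 < s := by linarith [hb.s1]
  refine ⟨H1, ?_, ?_⟩
  · intro y hy hyδ
    have hyp : 0 < y ^ (1 / s) := Real.rpow_pos_of_pos hy _
    have hyp2 : 0 < y ^ (1 / s - 1) := Real.rpow_pos_of_pos hy _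
    rcases le_or_gt y 1 with h | h
    · have hy1 : y ^ (1 / s) ≤ 1 := Real.rpow_le_one hy.le h (by positivity)
      simp only [bnd, h, if_true]
      calc _ ≤ y ^ (1 / s - 1) * (K * (y ^ (1 / s)) ^ (ε * s / 2)) := by
            exact mul_le_mul_of_nonneg_left (H2 _ hyδ.le hy1) hyp2.le
        _ = K * (y ^ (1 / s) * y ^ (ε / 2 - 1)) := by
            rw [← Real.rpow_mul hy.le, show 1 / s * (ε * s / 2) = ε / 2 by field_simp,
              Real.rpow_sub hy, Real.rpow_sub hy]
            ring
        _ ≤ _ := by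
          gcongr
          exact mul_le_of_le_one_left (Real.rpow_nonneg hy.le _) hy1
    · have hy1 : 1 ≤ y ^ (1 / s) := Real.one_le_rpow h.le (by positivity)
      simp only [bnd, not_le.2 h, if_false]
      calc _ ≤ y ^ (1 / s - 1) * (K * (y ^ (1 / s)) ^ (-2 * s)) := by
            exact mul_le_mul_of_nonneg_left (H3 _ hy1) hyp2.le
        _ = K * (y ^ (1 / s - 1) * y ^ (-2 : ℝ)) := by
            rw [← Real.rpow_mul hy.le, show 1 / s * (-2 * s) = -2 by field_simp]
            ring
        _ ≤ _ := by
          gcongr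
          apply mul_le_of_le_one_left (Real.rpow_nonneg hy.le _)
          apply Real.rpow_le_one_of_one_le_of_nonpos h.le
          have : 1 / s ≤ 1 := by rw [div_le_one hs0]; exact hb.s1
          linarith
  · intro y hy
    have hc : 0 < lam * f 1 := by linarith
    rcases le_or_gt y 1 with h | h
    · obtain ⟨-, G2, -⟩ := H (1 - y / 2) 1 (fun x => x) (lam * f 1)
        (base_id _ _ hε hε1 (by linarith) (by linarith)) hc (by simpa using h1) (by simpa using h2)
      have := G2 y (by linarith) h
      simp only [bnd, h, if_true]
      rw [div_le_iff₀ hy]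
      refine this.trans (le_of_eq ?_)
      rw [mul_one, Real.rpow_sub hy, Real.rpow_one]
      field_simp
    · obtain ⟨-, -, G3⟩ := H (1 / 2) 1 (fun x => x) (lam * f 1)
        (base_id _ _ hε hε1 (by norm_num) (by norm_num)) hc (by simpa using h1) (by simpa using h2)
      have := G3 y h.le
      simp only [bnd, not_le.2 h, if_false]
      rw [div_le_iff₀ hy]
      rw [mul_one] at this
      refine this.trans (le_mul_of_one_le_right ?_ h.le)
      have := Real.rpow_nonneg hy.le (-2)
      positivity

theorem dct_main {ι : Type*} (l : Filter ι) [l.IsCountablyGenerated] (s : ι → ℝ)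
    (f : ι → ℝ → ℝ) (lam : ι → ℝ) (ε δ cm cp : ℝ) (hε : 0 < ε) (hε1 : ε ≤ 1)
    (hδ0 : 0 < δ) (hδ1 : δ < 1) (hcm : 0 < cm) (hcp : 0 < cp)
    (hs : Tendsto s l atTop) (hb : ∀ᶠ p in l, Base ε δ (s p) (f p))
    (hl : ∀ᶠ p in l, 0 < lam p)
    (hc : ∀ᶠ p in l, cm ≤ lam p * f p 1 ∧ lam p * f p 1 ≤ cp)
    (hS : ∀ y : ℝ, 0 < y → Tendsto (fun p => f p (y ^ (1 / s p)) / f p 1) l (nhds y))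
    (Ψ : ℝ → ℝ) (hΨ : Continuous Ψ) (L C : ℝ) (hL0 : 0 ≤ L) (hC0 : 0 ≤ C)
    (hL : ∀ x y, 0 ≤ x → 0 ≤ y → |Ψ x - Ψ y| ≤ L * |x - y|)
    (hC : ∀ w, 0 ≤ w → |Ψ w| ≤ C * (√w * Real.exp (-(w / 2)))) :
    Tendsto (fun p => s p * ∫ x in Set.Ioi (0:ℝ), Ψ (lam p * f p x)) l
      (nhds (∫ w in Set.Ioi (0:ℝ), Ψ w / w)) := by
  obtain ⟨K, hK, H⟩ := dom_bounds ε cm cp hε hε1 hcm hcp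
  obtain ⟨B, hB, HB⟩ := W_int ε cm cp hε hcm hcp
  have htail := tail_tendsto l s hs ε δ hε hδ0 hδ1
  have hδ' : 0 < 1 - δ := by linarith
  set A : ι → ℝ → ℝ := fun p y => y ^ (1 / s p - 1) *
    (Set.Ioi (1 - δ)).indicator (fun x => Ψ (lam p * f p x)) (y ^ (1 / s p)) with hA
  set G : ι → ℝ → ℝ := fun p y => Ψ (lam p * f p 1 * y) / y with hG
  have hAbd : ∀ p, Base ε δ (s p) (f p) → 0 < lam p →
      (cm ≤ lam p * f p 1 ∧ lam p * f p 1 ≤ cp) → ∀ y, 0 < y → ‖A p y‖ ≤ C * K * bnd ε y := by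
    intro p hb hl hc y hy
    obtain ⟨-, H2, -⟩ := H δ (s p) (f p) (lam p) hb hl hc.1 hc.2
    have hyp : 0 < y ^ (1 / s p) := Real.rpow_pos_of_pos hy _
    have hyp2 : 0 < y ^ (1 / s p - 1) := Real.rpow_pos_of_pos hy _
    simp only [hA]
    rw [norm_mul, Real.norm_of_nonneg hyp2.le]
    by_cases h : 1 - δ < y ^ (1 / s p)
    · rw [Set.indicator_of_mem (show y ^ (1 / s p) ∈ Set.Ioi (1 - δ) from h), Real.norm_eq_abs]
      calc _ ≤ y ^ (1 / s p - 1) * (C * (√(lam p * f p (y ^ (1 / s p))) *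
            Real.exp (-(lam p * f p (y ^ (1 / s p)) / 2)))) := by
            gcongr
            exact hC _ (mul_pos hl (hb.pos _ hyp)).le
        _ = C * (y ^ (1 / s p - 1) * (√(lam p * f p (y ^ (1 / s p))) *
            Real.exp (-(lam p * f p (y ^ (1 / s p)) / 2)))) := by ring
        _ ≤ C * (K * bnd ε y) := by exact mul_le_mul_of_nonneg_left (H2 y hy h) hC0
        _ = _ := by ring
    · rw [Set.indicator_of_notMem (show y ^ (1 / s p) ∉ Set.Ioi (1 - δ) from h), norm_zero, mul_zero]
      have : 0 ≤ bnd ε y := by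
        unfold bnd
        split_ifs <;> exact Real.rpow_nonneg hy.le _
      positivity
  have hGbd : ∀ p, Base ε δ (s p) (f p) → 0 < lam p →
      (cm ≤ lam p * f p 1 ∧ lam p * f p 1 ≤ cp) → ∀ y, 0 < y → ‖G p y‖ ≤ C * K * bnd ε y := by
    intro p hb hl hc y hy
    obtain ⟨-, -, H3⟩ := H δ (s p) (f p) (lam p) hb hl hc.1 hc.2
    simp only [hG]
    rw [norm_div, Real.norm_of_nonneg hy.le, Real.norm_eq_abs]
    have hc0 : 0 ≤ lam p * f p 1 * y := mul_nonneg (by linarith) hy.le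
    calc _ ≤ C * (√(lam p * f p 1 * y) * Real.exp (-(lam p * f p 1 * y / 2))) / y := by
          gcongr; exact hC _ hc0
      _ = C * ((√(lam p * f p 1 * y) * Real.exp (-(lam p * f p 1 * y / 2))) / y) := by ring
      _ ≤ C * (K * bnd ε y) := by exact mul_le_mul_of_nonneg_left (H3 y hy) hC0
      _ = _ := by ring
  have hAm : ∀ p, Base ε δ (s p) (f p) →
      AEStronglyMeasurable (A p) (volume.restrict (Set.Ioi 0)) := by
    intro p hb
    have e : A p = Set.indicator {y : ℝ | 1 - δ < y ^ (1 / s p)}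
        (fun y => y ^ (1 / s p - 1) * Ψ (lam p * f p (y ^ (1 / s p)))) := by
      ext y
      simp only [hA]
      by_cases h : 1 - δ < y ^ (1 / s p)
      · rw [Set.indicator_of_mem (show y ^ (1 / s p) ∈ Set.Ioi (1 - δ) from h),
          Set.indicator_of_mem (show y ∈ {y : ℝ | 1 - δ < y ^ (1 / s p)} from h)]
      · rw [Set.indicator_of_notMem (show y ^ (1 / s p) ∉ Set.Ioi (1 - δ) from h),
          Set.indicator_of_notMem (show y ∉ {y : ℝ | 1 - δ < y ^ (1 / s p)} from h), mul_zero]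
    rw [e]
    apply AEStronglyMeasurable.indicator
    · apply ContinuousOn.aestronglyMeasurable _ measurableSet_Ioi
      have c1 : ∀ r : ℝ, ContinuousOn (fun y : ℝ => y ^ r) (Set.Ioi 0) := fun r y hy =>
        (Real.continuousAt_rpow_const y r (Or.inl (ne_of_gt hy))).continuousWithinAt
      have c2 : ContinuousOn (fun y : ℝ => f p (y ^ (1 / s p))) (Set.Ioi 0) :=
        hb.cont.comp (c1 _) fun y hy => Real.rpow_pos_of_pos hy _
      exact (c1 _).mul (hΨ.comp_continuousOn (continuousOn_const.mul c2))
    · exact measurableSet_lt measurable_const (by fun_prop)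
  have hGm : ∀ p, AEStronglyMeasurable (G p) (volume.restrict (Set.Ioi 0)) := by
    intro p
    have : Measurable (G p) := by
      have := hΨ.measurable
      simp only [hG]
      fun_prop
    exact this.aestronglyMeasurable
  have hbi : Integrable (fun y => C * K * bnd ε y) (volume.restrict (Set.Ioi 0)) :=
    (bnd_int ε hε).const_mul _
  have hAi : ∀ p, Base ε δ (s p) (f p) → 0 < lam p →
      (cm ≤ lam p * f p 1 ∧ lam p * f p 1 ≤ cp) → IntegrableOn (A p) (Set.Ioi 0) := by
    intro p h1 h2 h3
    exact Integrable.mono' hbi (hAm p h1)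
      ((ae_restrict_iff' measurableSet_Ioi).2 (ae_of_all _ (hAbd p h1 h2 h3)))
  have hGi : ∀ p, Base ε δ (s p) (f p) → 0 < lam p →
      (cm ≤ lam p * f p 1 ∧ lam p * f p 1 ≤ cp) → IntegrableOn (G p) (Set.Ioi 0) := by
    intro p h1 h2 h3
    exact Integrable.mono' hbi (hGm p)
      ((ae_restrict_iff' measurableSet_Ioi).2 (ae_of_all _ (hGbd p h1 h2 h3)))
  have hlim : Tendsto (fun p => ∫ y in Set.Ioi (0:ℝ), (A p y - G p y)) l
      (nhds (∫ y in Set.Ioi (0:ℝ), (0:ℝ))) := by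
    apply tendsto_integral_filter_of_dominated_convergence (fun y => C * K * bnd ε y + C * K * bnd ε y)
    · filter_upwards [hb] with p h1
      exact (hAm p h1).sub (hGm p)
    · filter_upwards [hb, hl, hc] with p h1 h2 h3
      refine (ae_restrict_iff' measurableSet_Ioi).2 (ae_of_all _ fun y hy => ?_)
      exact (norm_sub_le _ _).trans (add_le_add (hAbd p h1 h2 h3 y hy) (hGbd p h1 h2 h3 y hy))
    · exact hbi.add hbi
    · refine (ae_restrict_iff' measurableSet_Ioi).2 (ae_of_all _ fun y hy => ?_)
      have hy : 0 < y := hy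
      have hs1 : Tendsto (fun p => 1 / s p) l (nhds 0) := by
        simpa [Pi.inv_def] using hs.inv_tendsto_atTop
      have hy1 : Tendsto (fun p => y ^ (1 / s p)) l (nhds 1) := by
        have := (Real.continuousAt_const_rpow (a := y) (b := 0) hy.ne').tendsto.comp hs1
        simpa [Function.comp_def] using this
      have hbd : Tendsto (fun p => y⁻¹ * (|y ^ (1 / s p) - 1| * C +
          y ^ (1 / s p) * (L * (cp * |f p (y ^ (1 / s p)) / f p 1 - y|)))) l (nhds 0) := by
        have h1 : Tendsto (fun p => |y ^ (1 / s p) - 1|) l (nhds 0) := by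
          simpa using (hy1.sub_const 1).abs
        have h2 : Tendsto (fun p => |f p (y ^ (1 / s p)) / f p 1 - y|) l (nhds 0) := by
          simpa using ((hS y hy).sub_const y).abs
        have := ((h1.mul_const C).add (hy1.mul ((h2.const_mul cp).const_mul L))).const_mul y⁻¹
        simpa using this
      refine squeeze_zero_norm' ?_ hbd
      filter_upwards [hb, hl, hc, hy1.eventually (lt_mem_nhds (show 1 - δ < 1 by linarith))]
        with p h1 h2 h3 h4
      have hf1 := h1.pos 1 one_pos
      have hyp : 0 < y ^ (1 / s p) := Real.rpow_pos_of_pos hy _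
      simp only [hA, hG]
      rw [Set.indicator_of_mem (show y ^ (1 / s p) ∈ Set.Ioi (1 - δ) from h4),
        Real.rpow_sub hy, Real.rpow_one]
      have hc0 : 0 ≤ lam p * f p 1 * y := mul_nonneg (by linarith) hy.le
      have e : y ^ (1 / s p) / y * Ψ (lam p * f p (y ^ (1 / s p))) - Ψ (lam p * f p 1 * y) / y =
          y⁻¹ * ((y ^ (1 / s p) - 1) * Ψ (lam p * f p 1 * y) +
            y ^ (1 / s p) * (Ψ (lam p * f p (y ^ (1 / s p))) - Ψ (lam p * f p 1 * y))) := by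
        field_simp
        ring
      rw [e, norm_mul, Real.norm_of_nonneg (inv_nonneg.2 hy.le)]
      gcongr
      refine (norm_add_le _ _).trans (add_le_add ?_ ?_)
      · rw [norm_mul, Real.norm_eq_abs, Real.norm_eq_abs]
        gcongr
        refine (hC _ hc0).trans ?_
        exact mul_le_of_le_one_right hC0 (W_le_one _)
      · rw [norm_mul, Real.norm_of_nonneg hyp.le, Real.norm_eq_abs]
        gcongr
        refine (hL _ _ (mul_pos h2 (h1.pos _ hyp)).le hc0).trans ?_
        gcongr
        have e2 : lam p * f p (y ^ (1 / s p)) - lam p * f p 1 * y =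
            lam p * f p 1 * (f p (y ^ (1 / s p)) / f p 1 - y) := by
          field_simp
        rw [e2, abs_mul, abs_of_pos (by linarith)]
        gcongr
        exact h3.2
  rw [integral_zero] at hlim
  have hrest : Tendsto (fun p => s p * ∫ x in Set.Ioi (0:ℝ),
      (Set.Iic (1 - δ)).indicator (fun x => Ψ (lam p * f p x)) x) l (nhds 0) := by
    have := (htail.const_mul (C * K))
    rw [mul_zero] at this
    refine squeeze_zero_norm' ?_ this
    filter_upwards [hb, hl, hc] with p h1 h2 h3
    obtain ⟨H1, -, -⟩ := H δ (s p) (f p) (lam p) h1 h2 h3.1 h3.2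
    have hs0 : 0 < s p := by linarith [h1.s1]
    rw [norm_mul, Real.norm_of_nonneg hs0.le, setIntegral_indicator measurableSet_Iic,
      Set.Ioi_inter_Iic]
    have := norm_setIntegral_le_of_norm_le_const (μ := volume) (s := Set.Ioc 0 (1 - δ))
      (f := fun x => Ψ (lam p * f p x)) (C := C * (K * (1 - δ) ^ (ε * s p / 2))) (by simp) (by
        intro x hx
        rw [Real.norm_eq_abs]
        refine (hC _ (mul_pos h2 (h1.pos _ hx.1)).le).trans ?_
        exact mul_le_mul_of_nonneg_left (H1 x hx.1 hx.2) hC0)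
    rw [Real.volume_real_Ioc, sub_zero, max_eq_left hδ'.le] at this
    have hp : 0 ≤ (1 - δ) ^ (ε * s p / 2) := Real.rpow_nonneg hδ'.le _
    calc _ ≤ s p * (C * (K * (1 - δ) ^ (ε * s p / 2)) * (1 - δ)) := by gcongr
      _ ≤ s p * (C * (K * (1 - δ) ^ (ε * s p / 2))) := by
        refine mul_le_mul_of_nonneg_left ?_ hs0.le
        exact mul_le_of_le_one_right (by positivity) (by linarith)
      _ = _ := by ring
  have hsum := (hlim.add hrest).add_const (∫ w in Set.Ioi (0:ℝ), Ψ w / w)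
  rw [add_zero, zero_add] at hsum
  refine hsum.congr' ?_
  filter_upwards [hb, hl, hc, htail.eventually (ge_mem_nhds zero_lt_one)] with p h1 h2 h3 h4
  have hs0 : 0 < s p := by linarith [h1.s1]
  have hf1 := h1.pos 1 one_pos
  have hc0 : 0 < lam p * f p 1 := by positivity
  obtain ⟨hWi, -⟩ := HB δ (s p) (f p) (lam p) h1 h2 h3.1 h3.2 h4
  have hHi : IntegrableOn (fun x => Ψ (lam p * f p x)) (Set.Ioi 0) := by
    refine Integrable.mono' (hWi.const_mul C) ?_ ?_
    · have := h1.aem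
      have h5 := hΨ.measurable
      exact (h5.comp_aemeasurable (this.const_mul _)).aestronglyMeasurable
    · refine (ae_restrict_iff' measurableSet_Ioi).2 (ae_of_all _ fun x hx => ?_)
      exact hC _ (mul_pos h2 (h1.pos _ hx)).le
  rw [integral_sub (hAi p h1 h2 h3) (hGi p h1 h2 h3)]
  have eA : ∫ y in Set.Ioi (0:ℝ), A p y = s p * ∫ x in Set.Ioi (0:ℝ),
      (Set.Ioi (1 - δ)).indicator (fun x => Ψ (lam p * f p x)) x := by
    rw [← integral_comp_rpow_Ioi_of_pos
      (g := (Set.Ioi (1 - δ)).indicator (fun x => Ψ (lam p * f p x)))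
      (show 0 < 1 / s p by positivity), ← integral_const_mul]
    congr 1
    ext y
    simp only [hA, smul_eq_mul]
    rw [← mul_assoc, ← mul_assoc, mul_one_div_cancel hs0.ne', one_mul]
  have eG : ∫ y in Set.Ioi (0:ℝ), G p y = ∫ w in Set.Ioi (0:ℝ), Ψ w / w := by
    have := integral_comp_mul_left_Ioi' (fun w => Ψ w / w) 0 hc0
    rw [mul_zero] at this
    rw [← this, smul_eq_mul, ← integral_const_mul]
    congr 1
    ext y
    simp only [hG]
    rw [div_mul_eq_div_div, mul_div_assoc', mul_div_cancel₀ _ hc0.ne']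
  rw [eA, eG, sub_add_eq_add_sub, sub_add_cancel, ← mul_add,
    ← integral_add (hHi.indicator measurableSet_Ioi) (hHi.indicator measurableSet_Iic)]
  congr 2
  ext x
  have := congrFun (Set.indicator_self_add_compl (Set.Ioi (1 - δ))
    (fun x => Ψ (lam p * f p x))) x
  rw [Set.compl_Ioi] at this
  exact this

theorem nu_map {ε δ s : ℝ} {f : ℝ → ℝ} (hb : Base ε δ s f) (α lam : ℝ) :
    Measure.map (fun y => lam * y) (nuMeasure f α lam) =
      Measure.map (fun x => lam * f x) ((volume.restrict (Set.Ioi 0)).withDensity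
        fun x => ENNReal.ofReal (α * Real.exp (-(lam * f x)))) := by
  have hm : AEMeasurable f ((volume.restrict (Set.Ioi 0)).withDensity
        fun x => ENNReal.ofReal (α * Real.exp (-(lam * f x)))) :=
    hb.aem.mono_ac (withDensity_absolutelyContinuous _ _)
  unfold nuMeasure
  rw [AEMeasurable.map_map_of_aemeasurable (by fun_prop) hm]
  rfl

theorem nu_dens {ε δ s : ℝ} {f : ℝ → ℝ} (hb : Base ε δ s f) (α lam : ℝ) :
    AEMeasurable (fun x => ENNReal.ofReal (α * Real.exp (-(lam * f x))))
      (volume.restrict (Set.Ioi 0)) := by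
  have := hb.aem
  fun_prop

theorem nu_aem {ε δ s : ℝ} {f : ℝ → ℝ} (hb : Base ε δ s f) (α lam : ℝ) :
    AEMeasurable (fun x => lam * f x) ((volume.restrict (Set.Ioi 0)).withDensity
        fun x => ENNReal.ofReal (α * Real.exp (-(lam * f x)))) :=
  (hb.aem.const_mul lam).mono_ac (withDensity_absolutelyContinuous _ _)

theorem nu_integral {ε δ s : ℝ} {f : ℝ → ℝ} (hb : Base ε δ s f) (α lam : ℝ) (hα : 0 ≤ α)
    (φ : ℝ → ℝ) (hφ : Measurable φ) :
    ∫ y, φ y ∂(Measure.map (fun y => lam * y) (nuMeasure f α lam)) =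
      α * ∫ x in Set.Ioi (0:ℝ), φ (lam * f x) * Real.exp (-(lam * f x)) := by
  rw [nu_map hb, integral_map (nu_aem hb α lam) hφ.aestronglyMeasurable,
    integral_withDensity_eq_integral_toReal_smul₀ (nu_dens hb α lam) (by simp),
    ← integral_const_mul]
  congr 1
  ext x
  rw [ENNReal.toReal_ofReal (by positivity), smul_eq_mul]
  ring

theorem nu_integrable {ε δ s : ℝ} {f : ℝ → ℝ} (hb : Base ε δ s f) (α lam : ℝ) (hα : 0 ≤ α)
    (φ : ℝ → ℝ) (hφ : Measurable φ)
    (h : IntegrableOn (fun x => φ (lam * f x) * Real.exp (-(lam * f x))) (Set.Ioi 0)) :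
    Integrable φ (Measure.map (fun y => lam * y) (nuMeasure f α lam)) := by
  rw [nu_map hb, integrable_map_measure hφ.aestronglyMeasurable (nu_aem hb α lam),
    integrable_withDensity_iff_integrable_smul₀' (nu_dens hb α lam) (by simp)]
  refine (h.const_mul α).congr (ae_of_all _ fun x => ?_)
  simp only [Function.comp]
  rw [ENNReal.toReal_ofReal (by positivity), smul_eq_mul]
  ring

theorem nu_prob {ε δ s : ℝ} {f : ℝ → ℝ} (hb : Base ε δ s f) (α lam : ℝ) (hα : 0 ≤ α)
    (heq : α * ∫ x in Set.Ioi (0:ℝ), Real.exp (-(lam * f x)) = 1) :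
    IsProbabilityMeasure (nuMeasure f α lam) := by
  have hI := (exp_int_of_eq heq).const_mul α
  have hm : AEMeasurable f ((volume.restrict (Set.Ioi 0)).withDensity
        fun x => ENNReal.ofReal (α * Real.exp (-(lam * f x)))) :=
    hb.aem.mono_ac (withDensity_absolutelyContinuous _ _)
  constructor
  unfold nuMeasure
  rw [Measure.map_apply_of_aemeasurable hm MeasurableSet.univ, Set.preimage_univ,
    withDensity_apply _ MeasurableSet.univ, Measure.restrict_univ,
    ← ofReal_integral_eq_lintegral_ofReal hI (ae_of_all _ fun x => by positivity),
    integral_const_mul, heq, ENNReal.ofReal_one]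

theorem nu_pos {ε δ s : ℝ} {f : ℝ → ℝ} (hb : Base ε δ s f) (α lam : ℝ) :
    ∀ᵐ y ∂(nuMeasure f α lam), 0 < y := by
  have hm : AEMeasurable f ((volume.restrict (Set.Ioi 0)).withDensity
        fun x => ENNReal.ofReal (α * Real.exp (-(lam * f x)))) :=
    hb.aem.mono_ac (withDensity_absolutelyContinuous _ _)
  unfold nuMeasure
  rw [ae_map_iff hm measurableSet_Ioi]
  apply (withDensity_absolutelyContinuous _ _).ae_le
  exact (ae_restrict_iff' measurableSet_Ioi).2 (ae_of_all _ fun x hx => hb.pos x hx)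

structure Fam {ι : Type*} (l : Filter ι) (s : ι → ℝ) (f : ι → ℝ → ℝ) (lam α : ι → ℝ)
    (ε δ cm cp : ℝ) : Prop where
  hε : 0 < ε
  hε1 : ε ≤ 1
  hδ0 : 0 < δ
  hδ1 : δ < 1
  hcm : 0 < cm
  hcp : 0 < cp
  hs : Tendsto s l atTop
  hb : ∀ᶠ p in l, Base ε δ (s p) (f p)
  hl : ∀ᶠ p in l, 0 < lam p
  hc : ∀ᶠ p in l, cm ≤ lam p * f p 1 ∧ lam p * f p 1 ≤ cp
  hS : ∀ y : ℝ, 0 < y → Tendsto (fun p => f p (y ^ (1 / s p)) / f p 1) l (nhds y)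
  hα : Tendsto α l (nhds 1)
  heq : ∀ᶠ p in l, α p * ∫ x in Set.Ioi (0:ℝ), Real.exp (-(lam p * f p x)) = 1

theorem W_sq (w : ℝ) (hw : 0 ≤ w) :
    w * Real.exp (-w) = (√w * Real.exp (-(w / 2))) * (√w * Real.exp (-(w / 2))) := by
  have : (√w * Real.exp (-(w / 2))) * (√w * Real.exp (-(w / 2))) =
      (√w * √w) * (Real.exp (-(w / 2)) * Real.exp (-(w / 2))) := by ring
  rw [this, Real.mul_self_sqrt hw, ← Real.exp_add]
  congr 2
  ring

theorem lip_aux (φ : ℝ → ℝ) (hφL : ∀ x y, 0 ≤ x → 0 ≤ y → |φ x - φ y| ≤ |x - y|)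
    (hφ0 : ∀ x, 0 ≤ x → 0 ≤ φ x) (hφ1 : ∀ x, 0 ≤ x → φ x ≤ x) (x y : ℝ) (hx : 0 ≤ x)
    (hxy : y ≤ x) (hy : 0 ≤ y) :
    |φ x * Real.exp (-x) - φ y * Real.exp (-y)| ≤ 2 * |x - y| := by
  have e : φ x * Real.exp (-x) - φ y * Real.exp (-y) =
      (φ x - φ y) * Real.exp (-x) - φ y * (Real.exp (-y) - Real.exp (-x)) := by ring
  rw [e]
  have h1 : |(φ x - φ y) * Real.exp (-x)| ≤ |x - y| := by
    rw [abs_mul, abs_of_pos (Real.exp_pos _)]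
    have : Real.exp (-x) ≤ 1 := by rw [Real.exp_le_one_iff]; linarith
    calc _ ≤ |x - y| * 1 :=
          mul_le_mul (hφL x y hx hy) this (Real.exp_pos _).le (abs_nonneg _)
      _ = _ := mul_one _
  have h2 : |φ y * (Real.exp (-y) - Real.exp (-x))| ≤ |x - y| := by
    have h3 : Real.exp (-x) = Real.exp (-y) * Real.exp (-(x - y)) := by
      rw [← Real.exp_add]; congr 1; ring
    have h4 := Real.add_one_le_exp (-(x - y))
    have h5 : φ y * Real.exp (-y) ≤ 1 := by
      calc φ y * Real.exp (-y) ≤ y * Real.exp (-y) := by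
            gcongr; exact hφ1 y hy
        _ ≤ Real.exp y * Real.exp (-y) := by
          gcongr; linarith [Real.add_one_le_exp y]
        _ = 1 := by rw [← Real.exp_add]; simp
    have h6 : 0 ≤ φ y * Real.exp (-y) := mul_nonneg (hφ0 y hy) (Real.exp_pos _).le
    have h7 : Real.exp (-(x - y)) ≤ 1 := by rw [Real.exp_le_one_iff]; linarith
    rw [h3, show φ y * (Real.exp (-y) - Real.exp (-y) * Real.exp (-(x - y))) =
      (φ y * Real.exp (-y)) * (1 - Real.exp (-(x - y))) by ring, abs_mul, abs_of_nonneg h6,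
      abs_of_nonneg (by linarith), abs_of_nonneg (by linarith)]
    calc _ ≤ 1 * (1 - Real.exp (-(x - y))) := by
          gcongr
      _ ≤ _ := by linarith
  refine (abs_sub _ _).trans ?_
  linarith

theorem Fam.lim_phi {ι : Type*} {l : Filter ι} [l.IsCountablyGenerated] {s : ι → ℝ}
    {f : ι → ℝ → ℝ} {lam α : ι → ℝ} {ε δ cm cp : ℝ} (F : Fam l s f lam α ε δ cm cp)
    (φ : ℝ → ℝ) (hφc : Continuous φ) (hφL : ∀ x y, 0 ≤ x → 0 ≤ y → |φ x - φ y| ≤ |x - y|)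
    (hφ0 : ∀ x, 0 ≤ x → 0 ≤ φ x) (hφ1 : ∀ x, 0 ≤ x → φ x ≤ x) :
    Tendsto (fun p => s p * ∫ y, φ y ∂(Measure.map (fun y => lam p * y)
      (nuMeasure (f p) (α p) (lam p)))) l
      (nhds (∫ w in Set.Ioi (0:ℝ), φ w * Real.exp (-w) / w)) := by
  have h := dct_main l s f lam ε δ cm cp F.hε F.hε1 F.hδ0 F.hδ1 F.hcm F.hcp F.hs F.hb F.hl F.hc
    F.hS (fun w => φ w * Real.exp (-w)) (by fun_prop) 2 1 (by norm_num) zero_le_one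
    (by
      intro x y hx hy
      rcases le_total y x with h | h
      · exact lip_aux φ hφL hφ0 hφ1 x y hx h hy
      · rw [abs_sub_comm, abs_sub_comm x y]
        exact lip_aux φ hφL hφ0 hφ1 y x hy h hx)
    (by
      intro w hw
      rw [abs_of_nonneg (mul_nonneg (hφ0 w hw) (Real.exp_pos _).le), one_mul]
      calc _ ≤ w * Real.exp (-w) := by gcongr; exact hφ1 w hw
        _ = _ := W_sq w hw
        _ ≤ _ := mul_le_of_le_one_left (by positivity) (W_le_one w))
  have h2 := F.hα.mul h
  rw [one_mul] at h2
  refine h2.congr' ?_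
  filter_upwards [F.hb, F.hα.eventually (lt_mem_nhds zero_lt_one)] with p h1 h3
  rw [nu_integral h1 _ _ h3.le φ hφc.measurable]
  ring

theorem Fam.mean {ι : Type*} {l : Filter ι} [l.IsCountablyGenerated] {s : ι → ℝ}
    {f : ι → ℝ → ℝ} {lam α : ι → ℝ} {ε δ cm cp : ℝ} (F : Fam l s f lam α ε δ cm cp) :
    Tendsto (fun p => s p * ∫ y, y ∂(Measure.map (fun y => lam p * y)
      (nuMeasure (f p) (α p) (lam p)))) l (nhds 1) := by
  have h := F.lim_phi (fun x => x) continuous_id (fun x y _ _ => le_rfl) (fun x hx => hx)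
    (fun x _ => le_rfl)
  have e : ∫ w in Set.Ioi (0:ℝ), w * Real.exp (-w) / w = 1 := by
    rw [← integral_exp_neg_Ioi_zero]
    apply setIntegral_congr_fun measurableSet_Ioi
    intro w hw
    have : w ≠ 0 := ne_of_gt hw
    simp only
    field_simp
  rwa [e] at h

theorem Fam.kappa {ι : Type*} {l : Filter ι} [l.IsCountablyGenerated] {s : ι → ℝ}
    {f : ι → ℝ → ℝ} {lam α : ι → ℝ} {ε δ cm cp : ℝ} (F : Fam l s f lam α ε δ cm cp)
    (u v : ℝ) (hu : 0 < u) (huv : u < v) : ∃ κ, 0 < κ ∧ ∀ᶠ p in l, κ ≤ s p *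
      (Measure.map (fun y => lam p * y) (nuMeasure (f p) (α p) (lam p))).real (Set.Ioo u v) := by
  set T : ℝ → ℝ := fun w => max 0 (min (w - u) (v - w)) with hT
  have hTc : Continuous T := by fun_prop
  have hT0 : ∀ x, 0 ≤ T x := fun x => le_max_left _ _
  have hT1 : ∀ x, 0 ≤ x → T x ≤ x := fun x hx =>
    max_le hx ((min_le_left _ _).trans (by linarith))
  have hTL : ∀ x y, 0 ≤ x → 0 ≤ y → |T x - T y| ≤ |x - y| := by
    intro x y _ _
    refine (abs_max_sub_max_le_max _ _ _ _).trans (max_le (by simp) ?_)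
    refine (abs_min_sub_min_le_max _ _ _ _).trans (max_le (le_of_eq ?_) (le_of_eq ?_))
    · congr 1; ring
    · rw [abs_sub_comm]; congr 1; ring
  have h := F.lim_phi T hTc hTL (fun x _ => hT0 x) hT1
  have hpos : 0 < ∫ w in Set.Ioi (0:ℝ), T w * Real.exp (-w) / w := by
    rw [setIntegral_pos_iff_support_of_nonneg_ae]
    · have hsub : Set.Ioo u v ⊆ Function.support (fun w => T w * Real.exp (-w) / w) ∩ Set.Ioi 0 := by
        intro w hw
        have hw0 : 0 < w := hu.trans hw.1
        refine ⟨?_, hw0⟩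
        have : 0 < T w := lt_max_of_lt_right (lt_min (by linarith [hw.1]) (by linarith [hw.2]))
        exact ne_of_gt (by positivity)
      refine lt_of_lt_of_le ?_ (measure_mono hsub)
      simp [huv]
    · refine (ae_restrict_iff' measurableSet_Ioi).2 (ae_of_all _ fun w hw => ?_)
      have : 0 < w := hw
      have := hT0 w
      simp only [Pi.zero_apply]
      positivity
    · refine Integrable.mono' (integrableOn_exp_neg_Ioi 0)
        (Measurable.aestronglyMeasurable (by have := hTc.measurable; fun_prop)) ?_
      refine (ae_restrict_iff' measurableSet_Ioi).2 (ae_of_all _ fun w hw => ?_)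
      have hw : 0 < w := hw
      have h0 := hT0 w
      rw [Real.norm_of_nonneg (by positivity), div_le_iff₀ hw, mul_comm]
      gcongr
      exact hT1 w hw.le
  set I := ∫ w in Set.Ioi (0:ℝ), T w * Real.exp (-w) / w
  have hvu : 0 < v - u := by linarith
  refine ⟨I / 2 / (v - u), by positivity, ?_⟩
  filter_upwards [F.hb, F.hα.eventually (lt_mem_nhds zero_lt_one), F.heq,
    h.eventually (lt_mem_nhds (half_lt_self hpos))] with p h1 h3 h4 h5
  have := nu_prob h1 _ _ h3.le h4
  set ρ := Measure.map (fun y => lam p * y) (nuMeasure (f p) (α p) (lam p))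
  have hρ : IsProbabilityMeasure ρ := Measure.isProbabilityMeasure_map (by fun_prop)
  have hs0 : 0 < s p := by linarith [h1.s1]
  have hle : ∀ y, T y ≤ (Set.Ioo u v).indicator (fun _ => v - u) y := by
    intro y
    by_cases hy : y ∈ Set.Ioo u v
    · rw [Set.indicator_of_mem hy]
      exact max_le hvu.le ((min_le_left _ _).trans (by linarith [hy.2]))
    · rw [Set.indicator_of_notMem hy]
      refine max_le le_rfl ?_
      by_contra hc
      push Not at hc
      have := lt_min_iff.1 hc
      exact hy ⟨by linarith [this.1], by linarith [this.2]⟩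
  have hint : Integrable ((Set.Ioo u v).indicator (fun _ => v - u)) ρ :=
    (integrable_const _).indicator measurableSet_Ioo
  have hle2 : ∫ y, T y ∂ρ ≤ (v - u) * ρ.real (Set.Ioo u v) := by
    calc _ ≤ ∫ y, (Set.Ioo u v).indicator (fun _ => v - u) y ∂ρ :=
          integral_mono_of_nonneg (ae_of_all _ hT0) hint (ae_of_all _ hle)
      _ = _ := by
        rw [integral_indicator_const _ measurableSet_Ioo, smul_eq_mul, mul_comm]
  rw [div_le_iff₀ hvu]
  have := mul_le_mul_of_nonneg_left hle2 hs0.le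
  nlinarith

theorem Fam.moments {ι : Type*} {l : Filter ι} {s : ι → ℝ}
    {f : ι → ℝ → ℝ} {lam α : ι → ℝ} {ε δ cm cp : ℝ} (F : Fam l s f lam α ε δ cm cp) :
    ∃ B : ℝ, 0 ≤ B ∧ ∀ᶠ p in l,
      Integrable (fun y : ℝ => Real.sqrt y)
        (Measure.map (fun y => lam p * y) (nuMeasure (f p) (α p) (lam p))) ∧
      Integrable (fun y : ℝ => y ^ 2)
        (Measure.map (fun y => lam p * y) (nuMeasure (f p) (α p) (lam p))) ∧
      s p * ∫ y, Real.sqrt y ∂(Measure.map (fun y => lam p * y)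
        (nuMeasure (f p) (α p) (lam p))) ≤ B ∧
      s p * ∫ y, y ^ 2 ∂(Measure.map (fun y => lam p * y)
        (nuMeasure (f p) (α p) (lam p))) ≤ B := by
  obtain ⟨B, hB, HB⟩ := W_int ε cm cp F.hε F.hcm F.hcp
  obtain ⟨K, hK, HK⟩ := exp_rpow_bound (3 / 2) (by norm_num)
  have htail := tail_tendsto l s F.hs ε δ F.hε F.hδ0 F.hδ1
  refine ⟨2 * (max 1 K * B), by positivity, ?_⟩
  filter_upwards [F.hb, F.hl, F.hc, htail.eventually (ge_mem_nhds zero_lt_one),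
    F.hα.eventually (lt_mem_nhds zero_lt_one), F.hα.eventually (gt_mem_nhds one_lt_two)]
    with p h1 h2 h3 h4 h5 h6
  obtain ⟨hWi, hWB⟩ := HB δ (s p) (f p) (lam p) h1 h2 h3.1 h3.2 h4
  have hs0 : 0 < s p := by linarith [h1.s1]
  have main : ∀ φ : ℝ → ℝ, Measurable φ → (∀ w, 0 < w → 0 ≤ φ w) →
      (∀ w, 0 < w → φ w * Real.exp (-w) ≤ max 1 K * (√w * Real.exp (-(w / 2)))) →
      Integrable φ (Measure.map (fun y => lam p * y) (nuMeasure (f p) (α p) (lam p))) ∧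
      s p * ∫ y, φ y ∂(Measure.map (fun y => lam p * y)
        (nuMeasure (f p) (α p) (lam p))) ≤ 2 * (max 1 K * B) := by
    intro φ hφm hφ0 hφ
    have hI : IntegrableOn (fun x => φ (lam p * f p x) * Real.exp (-(lam p * f p x)))
        (Set.Ioi 0) := by
      refine Integrable.mono' (hWi.const_mul (max 1 K)) ?_ ?_
      · have := h1.aem
        have h7 : AEMeasurable (fun x => φ (lam p * f p x)) (volume.restrict (Set.Ioi 0)) :=
          hφm.comp_aemeasurable (this.const_mul _)
        exact AEMeasurable.aestronglyMeasurable (by fun_prop)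
      · refine (ae_restrict_iff' measurableSet_Ioi).2 (ae_of_all _ fun x hx => ?_)
        have hw : 0 < lam p * f p x := mul_pos h2 (h1.pos _ hx)
        rw [Real.norm_of_nonneg (mul_nonneg (hφ0 _ hw) (Real.exp_pos _).le)]
        exact hφ _ hw
    refine ⟨nu_integrable h1 _ _ h5.le φ hφm hI, ?_⟩
    rw [nu_integral h1 _ _ h5.le φ hφm]
    have k1 := setIntegral_mono_on hI (hWi.const_mul (max 1 K)) measurableSet_Ioi
      fun x hx => hφ _ (mul_pos h2 (h1.pos _ hx))
    rw [integral_const_mul] at k1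
    have k2 := mul_le_mul_of_nonneg_left k1 hs0.le
    have k3 : s p * ∫ x in Set.Ioi (0:ℝ), φ (lam p * f p x) * Real.exp (-(lam p * f p x)) ≤
        max 1 K * B := by
      have := mul_le_mul_of_nonneg_left hWB (show 0 ≤ max 1 K by positivity)
      linarith
    calc _ = α p * (s p * ∫ x in Set.Ioi (0:ℝ), φ (lam p * f p x) * Real.exp (-(lam p * f p x))) := by
          ring
      _ ≤ α p * (max 1 K * B) := mul_le_mul_of_nonneg_left k3 h5.le
      _ ≤ _ := mul_le_mul_of_nonneg_right h6.le (by positivity)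
  have r1 := main (fun y => √y) (by fun_prop) (fun w _ => by positivity) (by
    intro w hw
    calc √w * Real.exp (-w) ≤ √w * Real.exp (-(w / 2)) := by
          gcongr; linarith
      _ = 1 * (√w * Real.exp (-(w / 2))) := (one_mul _).symm
      _ ≤ _ := by
        gcongr
        exact le_max_left _ _)
  have r2 := main (fun y => y ^ 2) (by fun_prop) (fun w _ => by positivity) (by
    intro w hw
    have e : w ^ 2 * Real.exp (-w) =
        (w ^ (3 / 2 : ℝ) * Real.exp (-(w / 2))) * (√w * Real.exp (-(w / 2))) := by
      have e1 : w ^ (3 / 2 : ℝ) * √w = w ^ 2 := by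
        rw [Real.sqrt_eq_rpow, ← Real.rpow_add hw, ← Real.rpow_natCast]
        norm_num
      have e2 : Real.exp (-w) = Real.exp (-(w / 2)) * Real.exp (-(w / 2)) := by
        rw [← Real.exp_add]; congr 1; ring
      rw [← e1, e2]
      ring
    rw [e]
    gcongr
    exact (HK w hw).trans (le_max_right _ _))
  exact ⟨r1.1, r2.1, r1.2, r2.2⟩

theorem Fam.main {ι : Type*} {l : Filter ι} [l.IsCountablyGenerated] {s : ι → ℝ}
    {f : ι → ℝ → ℝ} {lam α : ι → ℝ} {ε δ cm cp : ℝ} (F : Fam l s f lam α ε δ cm cp)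
    (χ : ι → ℝ → ℝ) (hχ : ∀ᶠ p in l, (∀ u, 0 ≤ χ p u) ∧ (∀ u, u < 0 → χ p u = 0) ∧
      MonotoneOn (χ p) (Set.Ici 0) ∧ ∀ u, χ p u ≤ 1) :
    (∃ K : ℝ, 0 ≤ K ∧ ∀ᶠ p in l, ∀ t, (s p)⁻¹ *
      (mbarChar (nuMeasure (f p) (α p) (lam p)) (lam p) (χ p) t).toReal ≤ K) ∧
    ∀ η : ℝ, 0 < η → ∃ T, 0 ≤ T ∧ ∀ᶠ p in l, ∀ t, T ≤ lam p * t →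
      |(s p)⁻¹ * (mbarChar (nuMeasure (f p) (α p) (lam p)) (lam p) (χ p) t).toReal -
        ∫ z in Set.Ioi (0:ℝ), Real.exp (-z) * χ p (z / lam p)| ≤ η := by
  obtain ⟨B, hB, HB⟩ := F.moments
  obtain ⟨κ, hκ, Hκ⟩ := F.kappa 1 2 one_pos one_lt_two
  have hR : ∀ᶠ p in l, Ren (s p) (Measure.map (fun y => lam p * y)
      (nuMeasure (f p) (α p) (lam p))) (fun z => Real.exp (-z) * χ p (z / lam p))
      (fun τ => (s p)⁻¹ * (mbarChar (nuMeasure (f p) (α p) (lam p)) (lam p) (χ p)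
        (τ / lam p)).toReal) (max 1 (Real.exp 1 / κ)) B := by
    filter_upwards [F.hb, F.hl, F.heq, HB, Hκ, hχ, F.hα.eventually (lt_mem_nhds zero_lt_one)]
      with p h1 h2 h3 h4 h5 h6 h7
    have := nu_prob h1 _ _ h7.le h3
    have hρ : IsProbabilityMeasure (Measure.map (fun y => lam p * y)
      (nuMeasure (f p) (α p) (lam p))) := Measure.isProbabilityMeasure_map (by fun_prop)
    have hs0 : 0 < s p := by linarith [h1.s1]
    refine (mbar_ren _ (nu_pos h1 _ _) (lam p) (s p) κ B h2 hs0 hκ ?_ h4.1 h4.2.1 h4.2.2.1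
      h4.2.2.2 (χ p) h6.1 h6.2.1 h6.2.2.1 h6.2.2.2).mono (le_max_right _ _)
    refine h5.trans ?_
    gcongr
    · exact measure_ne_top _ _
    · exact fun x hx => hx.1
  constructor
  · refine ⟨max 1 (Real.exp 1 / κ), by positivity, ?_⟩
    filter_upwards [hR, F.hl] with p h1 h2 t
    have := h1.VK (lam p * t)
    rwa [mul_div_cancel_left₀ _ h2.ne'] at this
  · intro η hη
    obtain ⟨T, hT, H⟩ := ren_main l s _ _ _ (max 1 (Real.exp 1 / κ)) B (le_max_left _ _) hB hR
      F.kappa F.mean (min η 1) (by positivity) (min_le_right _ _)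
    refine ⟨T, hT, ?_⟩
    filter_upwards [H, F.hl] with p h1 h2 t ht
    have := h1 (lam p * t) ht
    rw [mul_div_cancel_left₀ _ h2.ne'] at this
    exact this.trans (min_le_left _ _)

theorem base_ev (s : ℕ → ℝ) (hs : Tendsto s atTop atTop)
    (f f' : ℕ → ℝ → ℝ)
    (hf_cont : ∀ n, ContinuousOn (f n) (Set.Ioi 0))
    (hf_mono : ∀ n, StrictMonoOn (f n) (Set.Ioi 0))
    (hf_pos : ∀ n x, 0 < x → 0 < f n x)
    (hf_deriv : ∀ n x, 0 < x → HasDerivAt (f n) (f' n x) x)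
    (hD1 : ∃ ε₀ : ℝ, 0 < ε₀ ∧ ∃ δ₀ ∈ Set.Ioc (0:ℝ) 1, ∃ n₀ : ℕ,
      ∀ n ≥ n₀, ∀ x : ℝ, 1 - δ₀ ≤ x → x ≤ 1 →
        ε₀ * s n ≤ x * f' n x / f n x ∧ x * f' n x / f n x ≤ s n / ε₀)
    (hD3 : ∃ ε₀ : ℝ, 0 < ε₀ ∧ ∃ n₀ : ℕ, ∀ n ≥ n₀, ∀ x : ℝ, 1 ≤ x →
      ε₀ * s n ≤ x * f' n x / f n x) :
    ∃ ε δ : ℝ, 0 < ε ∧ ε ≤ 1 ∧ 0 < δ ∧ δ < 1 ∧ ∀ᶠ n in atTop, Base ε δ (s n) (f n) := by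
  obtain ⟨e1, he1, d, hd, m1, H1⟩ := hD1
  obtain ⟨e2, he2, m2, H2⟩ := hD3
  have h0 : 0 < min (min e1 e2) 1 := lt_min (lt_min he1 he2) one_pos
  have hle1 : min (min e1 e2) 1 ≤ e1 := (min_le_left _ _).trans (min_le_left _ _)
  have hle2 : min (min e1 e2) 1 ≤ e2 := (min_le_left _ _).trans (min_le_right _ _)
  have hle3 : min (min e1 e2) 1 ≤ 1 := min_le_right _ _
  have hd0 : 0 < min d (1 / 2) := lt_min hd.1 (by norm_num)
  have hd1 : min d (1 / 2) ≤ 1 / 2 := min_le_right _ _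
  have hd2 : min d (1 / 2) ≤ d := min_le_left _ _
  generalize min (min e1 e2) 1 = ε at *
  generalize min d (1 / 2) = δ at *
  refine ⟨ε, δ, h0, hle3, hd0, by linarith, ?_⟩
  filter_upwards [eventually_ge_atTop m1, eventually_ge_atTop m2, hs.eventually_ge_atTop 1]
    with n hn1 hn2 hs1
  refine ⟨h0, hle3, hd0, by linarith, hs1, hf_pos n, hf_cont n, (hf_mono n).monotoneOn, ?_, ?_⟩
  · intro x hx hx1
    have hx0 : 0 < x := by linarith
    have h := pow_growth (f n) (f' n) x 1 (ε * s n) hx0 hx1 (hf_pos n) (hf_deriv n)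
      (fun y hy hy1 => (mul_le_mul_of_nonneg_right hle1 (by linarith)).trans
        (H1 n hn1 y (by linarith) hy1).1)
    have hp : 0 < x ^ (ε * s n) := Real.rpow_pos_of_pos hx0 _
    rw [one_div, Real.inv_rpow hx0.le] at h
    calc f n x = (f n x * (x ^ (ε * s n))⁻¹) * x ^ (ε * s n) := by field_simp
      _ ≤ _ := mul_le_mul_of_nonneg_right h hp.le
  · intro x hx
    have h := pow_growth (f n) (f' n) 1 x (ε * s n) one_pos hx (hf_pos n) (hf_deriv n)
      (fun y hy hy1 => (mul_le_mul_of_nonneg_right hle2 (by linarith)).trans (H2 n hn2 y hy))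
    simpa using h

theorem alpha_bound (a s Λ : ℝ) (ha : 0 < a) (hs : 0 < s) (hΛ : |Real.log a| ≤ Λ) (hΛs : Λ ≤ s) :
    |s * (1 / a ^ (1 / s) - 1)| ≤ 2 * Λ ∧ |a ^ (1 / s) - 1| ≤ 2 * Λ / s := by
  have e1 : a ^ (1 / s) = Real.exp (Real.log a / s) := by
    rw [Real.rpow_def_of_pos ha]; congr 1; ring
  have e2 : 1 / a ^ (1 / s) = Real.exp (-(Real.log a / s)) := by
    rw [e1, Real.exp_neg, one_div]
  have hx : |Real.log a / s| ≤ Λ / s := by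
    rw [abs_div, abs_of_pos hs]; exact div_le_div_of_nonneg_right hΛ hs.le
  have hx1 : |Real.log a / s| ≤ 1 := hx.trans ((div_le_one hs).2 hΛs)
  have k1 := Real.abs_exp_sub_one_le hx1
  have k2 := Real.abs_exp_sub_one_le (x := -(Real.log a / s)) (by rwa [abs_neg])
  rw [abs_neg] at k2
  constructor
  · rw [e2, abs_mul, abs_of_pos hs]
    have : s * |Real.exp (-(Real.log a / s)) - 1| ≤ s * (2 * (Λ / s)) :=
      mul_le_mul_of_nonneg_left (by linarith) hs.le
    calc _ ≤ _ := this
      _ = _ := by field_simp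
  · rw [e1, mul_div_assoc]; linarith

theorem log_bound (A : Set ℝ) (hA : IsCompact A) (hA0 : A ⊆ Set.Ioo 0 2) :
    ∃ Λ : ℝ, 0 < Λ ∧ ∀ a ∈ A, |Real.log a| ≤ Λ := by
  have hc : ContinuousOn Real.log A := fun a ha =>
    (Real.continuousAt_log (hA0 ha).1.ne').continuousWithinAt
  obtain ⟨C, hC⟩ := hA.exists_bound_of_continuousOn hc
  exact ⟨max C 1, lt_max_of_lt_right one_pos, fun a ha => (hC a ha).trans (le_max_left _ _)⟩

theorem c_bounds (s : ℕ → ℝ) (hs : Tendsto s atTop atTop)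
    (f : ℕ → ℝ → ℝ) (ε δ : ℝ)
    (hS : ∀ x : ℝ, 0 ≤ x → Tendsto (fun n => f n (x ^ (1 / s n)) / f n 1) atTop (nhds x))
    (hε : 0 < ε) (hδ0 : 0 < δ) (hδ1 : δ < 1)
    (hb : ∀ᶠ n in atTop, Base ε δ (s n) (f n))
    (lam : ℕ → ℝ → ℝ) (n₀ : ℕ)
    (hlam : ∀ n ≥ n₀, ∀ a : ℝ, 0 < a → 0 < lam n a ∧
      a ^ (1 / s n) * ∫ x in Set.Ioi (0:ℝ), Real.exp (-(lam n a * f n x)) = 1)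
    (A : Set ℝ) (hA0 : ∀ a ∈ A, 0 < a) (Λ : ℝ) (hΛ0 : 0 < Λ) (hΛ : ∀ a ∈ A, |Real.log a| ≤ Λ) :
    ∃ cm cp : ℝ, 0 < cm ∧ 0 < cp ∧ ∀ᶠ n in atTop, ∀ a ∈ A,
      cm ≤ lam n a * f n 1 ∧ lam n a * f n 1 ≤ cp := by
  obtain ⟨C1, hC1, HU⟩ := c_upper ε hε
  obtain ⟨ℓ, hℓ⟩ : ∃ ℓ : ℝ, ℓ = 4 * (C1 + 2 * Λ) + 1 := ⟨_, rfl⟩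
  obtain ⟨L, hL⟩ : ∃ L : ℝ, L = Real.exp 1 * (2 * Λ + 1 + 1 / ε) + 1 := ⟨_, rfl⟩
  have hℓ0 : 0 < ℓ := by rw [hℓ]; positivity
  have hL0 : 0 < L := by rw [hL]; positivity
  refine ⟨Real.exp (-L) / 2, 2 * Real.exp ℓ, by positivity, by positivity, ?_⟩
  have t1 := (hS (Real.exp (-ℓ)) (Real.exp_pos _).le).eventually
    (lt_mem_nhds (show Real.exp (-ℓ) / 2 < Real.exp (-ℓ) by linarith [Real.exp_pos (-ℓ)]))
  have t2 := (hS (Real.exp L) (Real.exp_pos _).le).eventually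
    (gt_mem_nhds (show Real.exp L < 2 * Real.exp L by linarith [Real.exp_pos L]))
  have t3 := (tail_tendsto atTop s hs ε δ hε hδ0 hδ1).eventually
    (gt_mem_nhds (show (0:ℝ) < 1 by norm_num))
  filter_upwards [hb, t1, t2, t3, eventually_ge_atTop n₀, hs.eventually_ge_atTop Λ,
    hs.eventually_ge_atTop ℓ] with n hbn h1 h2 h3 hn hsΛ hsℓ a ha
  have hs0 : 0 < s n := by linarith [hbn.s1]
  have hf1 := hbn.pos 1 one_pos
  obtain ⟨hl, heq⟩ := hlam n hn a (hA0 a ha)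
  have hab := (alpha_bound a (s n) Λ (hA0 a ha) hs0 (hΛ a ha) hsΛ).1
  have hα : 0 < a ^ (1 / s n) := Real.rpow_pos_of_pos (hA0 a ha) _
  rw [← Real.exp_mul, show -ℓ * (1 / s n) = -(ℓ / s n) by ring, lt_div_iff₀ hf1] at h1
  rw [← Real.exp_mul, show L * (1 / s n) = L / s n by ring, div_lt_iff₀ hf1] at h2
  refine ⟨c_lower ε δ (s n) (f n) (lam n a) _ Λ L hbn hl hα heq hab hL0.le (by linarith) h3.le
    (by linarith), HU δ (s n) (f n) (lam n a) _ Λ ℓ hbn hl hα heq hab hℓ0 hsℓ (by linarith)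
    (by linarith)⟩

/-- The set of admissible parameters. -/
def Adm (A : Set ℝ) : Set (ℝ × (ℝ → ℝ)) :=
  {q | q.1 ∈ A ∧ (∀ u, 0 ≤ q.2 u) ∧ (∀ u < 0, q.2 u = 0) ∧ MonotoneOn q.2 (Set.Ici 0) ∧
    ∀ u, q.2 u ≤ 1}

theorem core (s : ℕ → ℝ) (hs : Tendsto s atTop atTop)
    (f : ℕ → ℝ → ℝ) (ε δ : ℝ)
    (hS : ∀ x : ℝ, 0 ≤ x → Tendsto (fun n => f n (x ^ (1 / s n)) / f n 1) atTop (nhds x))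
    (hε : 0 < ε) (hε1 : ε ≤ 1) (hδ0 : 0 < δ) (hδ1 : δ < 1)
    (hb : ∀ᶠ n in atTop, Base ε δ (s n) (f n))
    (lam : ℕ → ℝ → ℝ) (n₀ : ℕ)
    (hlam : ∀ n ≥ n₀, ∀ a : ℝ, 0 < a → 0 < lam n a ∧
      a ^ (1 / s n) * ∫ x in Set.Ioi (0:ℝ), Real.exp (-(lam n a * f n x)) = 1)
    (A : Set ℝ) (hA0 : ∀ a ∈ A, 0 < a) (Λ : ℝ) (hΛ0 : 0 < Λ) (hΛ : ∀ a ∈ A, |Real.log a| ≤ Λ)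
    (cm cp : ℝ) (hcm : 0 < cm) (hcp : 0 < cp)
    (hc : ∀ᶠ n in atTop, ∀ a ∈ A, cm ≤ lam n a * f n 1 ∧ lam n a * f n 1 ≤ cp) :
    (∃ K, 0 ≤ K ∧ ∀ᶠ n in atTop, ∀ q ∈ Adm A, ∀ t, (s n)⁻¹ *
      (mbarChar (nuMeasure (f n) (q.1 ^ (1 / s n)) (lam n q.1)) (lam n q.1) q.2 t).toReal ≤ K) ∧
    ∀ η > 0, ∃ T, 0 ≤ T ∧ ∀ᶠ n in atTop, ∀ q ∈ Adm A, ∀ t, T ≤ lam n q.1 * t → |(s n)⁻¹ *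
      (mbarChar (nuMeasure (f n) (q.1 ^ (1 / s n)) (lam n q.1)) (lam n q.1) q.2 t).toReal -
        ∫ z in Set.Ioi (0:ℝ), Real.exp (-z) * q.2 (z / lam n q.1)| ≤ η := by
  have F : Fam ((atTop : Filter ℕ) ×ˢ 𝓟 (Adm A)) (fun p => s p.1) (fun p => f p.1)
      (fun p => lam p.1 p.2.1) (fun p => p.2.1 ^ (1 / s p.1)) ε δ cm cp := by
    refine ⟨hε, hε1, hδ0, hδ1, hcm, hcp, hs.comp tendsto_fst, tendsto_fst.eventually hb,
      ?_, ?_, fun y hy => (hS y hy.le).comp tendsto_fst, ?_, ?_⟩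
    · rw [eventually_prod_principal_iff]
      filter_upwards [eventually_ge_atTop n₀] with n hn q hq
      exact (hlam n hn q.1 (hA0 _ hq.1)).1
    · rw [eventually_prod_principal_iff]
      filter_upwards [hc] with n hn q hq
      exact hn q.1 hq.1
    · rw [tendsto_iff_dist_tendsto_zero]
      have h1 : Tendsto (fun p : ℕ × (ℝ × (ℝ → ℝ)) => 2 * Λ / s p.1)
          ((atTop : Filter ℕ) ×ˢ 𝓟 (Adm A)) (nhds 0) :=
        Tendsto.div_atTop tendsto_const_nhds (hs.comp tendsto_fst)
      refine squeeze_zero' (Eventually.of_forall fun _ => dist_nonneg) ?_ h1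
      rw [eventually_prod_principal_iff]
      filter_upwards [hs.eventually_ge_atTop Λ] with n hn q hq
      exact (alpha_bound q.1 (s n) Λ (hA0 _ hq.1) (by linarith) (hΛ _ hq.1) hn).2
    · rw [eventually_prod_principal_iff]
      filter_upwards [eventually_ge_atTop n₀] with n hn q hq
      exact (hlam n hn q.1 (hA0 _ hq.1)).2
  have hχ : ∀ᶠ p : ℕ × (ℝ × (ℝ → ℝ)) in (atTop : Filter ℕ) ×ˢ 𝓟 (Adm A),
      (∀ u, 0 ≤ p.2.2 u) ∧ (∀ u < 0, p.2.2 u = 0) ∧ MonotoneOn p.2.2 (Set.Ici 0) ∧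
      ∀ u, p.2.2 u ≤ 1 := by
    rw [eventually_prod_principal_iff]
    exact Eventually.of_forall fun n q hq => hq.2
  obtain ⟨⟨K, hK, h1⟩, h2⟩ := F.main (fun p => p.2.2) hχ
  rw [eventually_prod_principal_iff] at h1
  refine ⟨⟨K, hK, h1⟩, fun η hη => ?_⟩
  obtain ⟨T, hT, h3⟩ := h2 η hη
  rw [eventually_prod_principal_iff] at h3
  exact ⟨T, hT, h3⟩

theorem adm_div (A : Set ℝ) (a : ℝ) (ha : a ∈ A) (χ : ℝ → ℝ) (C : ℝ) (hC : 0 < C)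
    (h0 : ∀ u, 0 ≤ χ u) (h1 : ∀ u, u < 0 → χ u = 0) (h2 : MonotoneOn χ (Set.Ici 0))
    (h3 : ∀ u, χ u ≤ C) : ((a, fun u => χ u / C) : ℝ × (ℝ → ℝ)) ∈ Adm A :=
  ⟨ha, fun u => div_nonneg (h0 u) hC.le, fun u hu => by simp [h1 u hu],
    fun x hx y hy hxy => div_le_div_of_nonneg_right (h2 hx hy hxy) hC.le,
    fun u => (div_le_one hC).2 (h3 u)⟩


/-- asymptotics of the mean of one-vertex characteristics, uniformly over compact
`A ⊂ (0,2)`, bounded non-negative non-decreasing characteristics `χ` (with bound `C`), and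
`t` with `λ_n(1) t ≥ K`; together with the uniform bound `m̄_t^χ(ã) ≤ K' C s_n`. -/
theorem statement19 (s : ℕ → ℝ) (hs_pos : ∀ n, 0 < s n) (hs : Tendsto s atTop atTop)
    (f f' : ℕ → ℝ → ℝ)
    (hf_cont : ∀ n, ContinuousOn (f n) (Set.Ioi 0))
    (hf_mono : ∀ n, StrictMonoOn (f n) (Set.Ioi 0))
    (hf_pos : ∀ n x, 0 < x → 0 < f n x)
    (hf_deriv : ∀ n x, 0 < x → HasDerivAt (f n) (f' n x) x)
    -- Condition (S)
    (hS : ∀ x : ℝ, 0 ≤ x → Tendsto (fun n => f n (x ^ (1 / s n)) / f n 1) atTop (nhds x))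
    -- Condition (D1)
    (hD1 : ∃ ε₀ : ℝ, 0 < ε₀ ∧ ∃ δ₀ ∈ Set.Ioc (0:ℝ) 1, ∃ n₀ : ℕ,
      ∀ n ≥ n₀, ∀ x : ℝ, 1 - δ₀ ≤ x → x ≤ 1 →
        ε₀ * s n ≤ x * f' n x / f n x ∧ x * f' n x / f n x ≤ s n / ε₀)
    -- Condition (D3)
    (hD3 : ∃ ε₀ : ℝ, 0 < ε₀ ∧ ∃ n₀ : ℕ, ∀ n ≥ n₀, ∀ x : ℝ, 1 ≤ x →
      ε₀ * s n ≤ x * f' n x / f n x)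
    -- the parameters `λ_n(a^{1/s_n})`, defined for sufficiently large n
    (lam : ℕ → ℝ → ℝ) (n₀ : ℕ)
    (hlam : ∀ n ≥ n₀, ∀ a : ℝ, 0 < a → 0 < lam n a ∧
      a ^ (1 / s n) * ∫ x in Set.Ioi (0:ℝ), Real.exp (-(lam n a * f n x)) = 1) :
    -- (i)
    (∀ ε : ℝ, 0 < ε → ∀ A : Set ℝ, IsCompact A → A ⊆ Set.Ioo 0 2 →
      ∃ K : ℝ, ∃ n₁ : ℕ, ∀ n ≥ n₁, ∀ a ∈ A, ∀ χ : ℝ → ℝ, ∀ C : ℝ,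
        (∀ u, 0 ≤ χ u) → (∀ u, u < 0 → χ u = 0) → MonotoneOn χ (Set.Ici 0) →
        (∀ u, χ u ≤ C) →
        ∀ t : ℝ, K ≤ lam n 1 * t →
          |(s n)⁻¹ *
              (mbarChar (nuMeasure (f n) (a ^ (1 / s n)) (lam n a)) (lam n a) χ t).toReal -
            ∫ z in Set.Ioi (0:ℝ), Real.exp (-z) * χ (z / lam n a)| ≤ ε * C) ∧
    -- (ii) a uniform bound with a constant independent of ε
    (∀ A : Set ℝ, IsCompact A → A ⊆ Set.Ioo 0 2 →
      ∃ K' : ℝ, ∃ n₂ : ℕ, ∀ n ≥ n₂, ∀ a ∈ A, ∀ χ : ℝ → ℝ, ∀ C : ℝ,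
        (∀ u, 0 ≤ χ u) → (∀ u, u < 0 → χ u = 0) → MonotoneOn χ (Set.Ici 0) →
        (∀ u, χ u ≤ C) →
        ∀ t : ℝ, 0 ≤ t →
          (mbarChar (nuMeasure (f n) (a ^ (1 / s n)) (lam n a)) (lam n a) χ t).toReal
            ≤ K' * C * s n) := by
  obtain ⟨ε, δ, hε, hε1, hδ0, hδ1, hb⟩ :=
    base_ev s hs f f' hf_cont hf_mono hf_pos hf_deriv hD1 hD3
  have key : ∀ A : Set ℝ, IsCompact A → A ⊆ Set.Ioo 0 2 → ∃ B : Set ℝ, A ⊆ B ∧ (1:ℝ) ∈ B ∧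
      (∀ a ∈ B, 0 < a) ∧ ∃ Λ : ℝ, 0 < Λ ∧ ∀ a ∈ B, |Real.log a| ≤ Λ := by
    intro A hA hA2
    have hB : insert 1 A ⊆ Set.Ioo (0:ℝ) 2 :=
      Set.insert_subset ⟨one_pos, one_lt_two⟩ hA2
    exact ⟨insert 1 A, Set.subset_insert _ _, Set.mem_insert _ _, fun a ha => (hB ha).1,
      log_bound _ (hA.insert 1) hB⟩
  constructor
  · intro η hη A hA hA2
    obtain ⟨B, hAB, h1B, hB0, Λ, hΛ0, hΛ⟩ := key A hA hA2
    obtain ⟨cm, cp, hcm, hcp, hc⟩ :=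
      c_bounds s hs f ε δ hS hε hδ0 hδ1 hb lam n₀ hlam B hB0 Λ hΛ0 hΛ
    obtain ⟨-, H⟩ := core s hs f ε δ hS hε hε1 hδ0 hδ1 hb lam n₀ hlam B hB0 Λ hΛ0 hΛ
      cm cp hcm hcp hc
    obtain ⟨T, hT, HT⟩ := H η hη
    obtain ⟨n₁, hn₁⟩ := eventually_atTop.1 (HT.and (hc.and (eventually_ge_atTop n₀)))
    refine ⟨T * (cp / cm), n₁, ?_⟩
    intro n hn a ha χ C h0 h1 h2 h3 t ht
    obtain ⟨q1, q2, q3⟩ := hn₁ n hn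
    have hC0 : 0 ≤ C := (h0 0).trans (h3 0)
    rcases hC0.eq_or_lt with hC | hC
    · have hz : ∀ u, χ u = 0 := fun u => le_antisymm (by rw [hC]; exact h3 u) (h0 u)
      rw [mbar_zero _ _ _ hz]
      simp [hz, ← hC]
    · have hla := (hlam n q3 a (hB0 a (hAB ha))).1
      have hl1 := (hlam n q3 1 one_pos).1
      have hf1 := hf_pos n 1 one_pos
      have ht0 : 0 ≤ t := by
        have : 0 ≤ lam n 1 * t := le_trans (by positivity) ht
        exact nonneg_of_mul_nonneg_right this hl1
      have hTa : T ≤ lam n a * t := by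
        have b1 := (q2 a (hAB ha)).1
        have b2 := (q2 1 h1B).2
        have b3 : lam n 1 * cm ≤ lam n a * cp := by
          have c1 : (lam n 1 * f n 1) * cm ≤ cp * (lam n a * f n 1) :=
            mul_le_mul b2 b1 hcm.le hcp.le
          refine le_of_mul_le_mul_right ?_ hf1
          linarith
        have b4 : T * cp ≤ lam n 1 * t * cm := by
          have := mul_le_mul_of_nonneg_right ht hcm.le
          calc T * cp = T * (cp / cm) * cm := by field_simp
            _ ≤ _ := this
        have b5 := mul_le_mul_of_nonneg_right b3 ht0
        refine le_of_mul_le_mul_right ?_ hcp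
        linarith
      have := q1 (a, fun u => χ u / C) (adm_div B a (hAB ha) χ C hC h0 h1 h2 h3) t hTa
      simp only at this
      rw [mbar_scale _ _ C hC χ t]
      have e : ∫ z in Set.Ioi (0:ℝ), Real.exp (-z) * χ (z / lam n a) =
          C * ∫ z in Set.Ioi (0:ℝ), Real.exp (-z) * (χ (z / lam n a) / C) := by
        rw [← integral_const_mul]
        congr 1
        ext z
        field_simp
      rw [e, mul_left_comm, ← mul_sub, abs_mul, abs_of_pos hC, mul_comm]
      exact mul_le_mul_of_nonneg_right this hC.le
  · intro A hA hA2
    obtain ⟨B, hAB, h1B, hB0, Λ, hΛ0, hΛ⟩ := key A hA hA2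
    obtain ⟨cm, cp, hcm, hcp, hc⟩ :=
      c_bounds s hs f ε δ hS hε hδ0 hδ1 hb lam n₀ hlam B hB0 Λ hΛ0 hΛ
    obtain ⟨⟨K, hK, H⟩, -⟩ := core s hs f ε δ hS hε hε1 hδ0 hδ1 hb lam n₀ hlam B hB0 Λ hΛ0 hΛ
      cm cp hcm hcp hc
    obtain ⟨n₁, hn₁⟩ := eventually_atTop.1 H
    refine ⟨K, n₁, ?_⟩
    intro n hn a ha χ C h0 h1 h2 h3 t ht
    have hC0 : 0 ≤ C := (h0 0).trans (h3 0)
    rcases hC0.eq_or_lt with hC | hC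
    · have hz : ∀ u, χ u = 0 := fun u => le_antisymm (by rw [hC]; exact h3 u) (h0 u)
      rw [mbar_zero _ _ _ hz]
      simp [← hC]
    · have := hn₁ n hn (a, fun u => χ u / C) (adm_div B a (hAB ha) χ C hC h0 h1 h2 h3) t
      simp only at this
      rw [mbar_scale _ _ C hC χ t]
      rw [inv_mul_le_iff₀ (hs_pos n)] at this
      calc _ ≤ C * (s n * K) := mul_le_mul_of_nonneg_left this hC.le
        _ = _ := by ring
end
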